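/- Suppose a finite group G admits a group K = FH of automorphisms which is a Frobenius group with kernel F and complement H (that is, F is a nontrivial proper normal subgroup of K, K = FH with F ∩ H = 1, and C_F(h) = 1 for every nontrivial h ∈ H), such that C_G(F) = 1. Then G = ⟨C_G(H)^f : f ∈ F⟩, i.e. G is generated by the images of C_G(H) under the elements of F. -/

import Mathlib

set_option linter.unusedSectionVars false
namespace FrobGen
open Subgroup

section basics
variable {G : Type*} [Group G]

/-- conjugate subgroup `g A g⁻¹` -/
def cj (g : G) (A : Subgroup G) : Subgroup G := A.map (MulAut.conj g).toMonoidHom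

lemma mem_cj {g : G} {A : Subgroup G} {x : G} : x ∈ cj g A ↔ g⁻¹ * x * g ∈ A := by
  constructor
  · rintro ⟨a, ha, rfl⟩
    simpa [MulAut.conj_apply, mul_assoc] using ha
  · intro h
    exact ⟨_, h, by simp [MulAut.conj_apply, mul_assoc]⟩

lemma cj_mem {g : G} {A : Subgroup G} {x : G} (hx : x ∈ A) : g * x * g⁻¹ ∈ cj g A := by
  rw [mem_cj]; simpa [mul_assoc] using hx

lemma cj_one (A : Subgroup G) : cj 1 A = A := by ext x; simp [mem_cj]

lemma cj_mul (g h : G) (A : Subgroup G) : cj (g * h) A = cj g (cj h A) := by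
  ext x; simp [mem_cj, mul_assoc]

lemma cj_mono {g : G} {A B : Subgroup G} (h : A ≤ B) : cj g A ≤ cj g B := Subgroup.map_mono h

lemma cj_inv_cj (g : G) (A : Subgroup G) : cj g⁻¹ (cj g A) = A := by
  rw [← cj_mul]; simp [cj_one]

lemma cj_cj_inv (g : G) (A : Subgroup G) : cj g (cj g⁻¹ A) = A := by
  rw [← cj_mul]; simp [cj_one]

lemma card_cj (g : G) (A : Subgroup G) : Nat.card (cj g A) = Nat.card A :=
  Subgroup.card_map_of_injective (MulAut.conj g).injective

lemma cj_inf (g : G) (A B : Subgroup G) : cj g (A ⊓ B) = cj g A ⊓ cj g B := by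
  ext x; simp [mem_cj]

lemma cj_sup (g : G) (A B : Subgroup G) : cj g (A ⊔ B) = cj g A ⊔ cj g B := Subgroup.map_sup _ _ _

lemma cj_le_iff {g : G} {A B : Subgroup G} : cj g A ≤ B ↔ A ≤ cj g⁻¹ B := by
  constructor
  · intro h; rw [← cj_inv_cj g A]; exact cj_mono h
  · intro h; rw [← cj_cj_inv g B]; exact cj_mono h

lemma cj_le_of_le {g : G} {A B : Subgroup G} (hA : A ≤ B) (hg : g ∈ B) : cj g A ≤ B := by
  intro x hx
  rw [mem_cj] at hx
  have := B.mul_mem (B.mul_mem hg (hA hx)) (B.inv_mem hg)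
  simpa [mul_assoc] using this

lemma cj_eq_of_mem {g : G} {A : Subgroup G} (hg : g ∈ A) : cj g A = A := by
  apply le_antisymm (cj_le_of_le le_rfl hg)
  have := cj_mono (g := g) (cj_le_of_le le_rfl (A.inv_mem hg))
  rwa [cj_cj_inv] at this

lemma cj_normal {g : G} {A : Subgroup G} (hA : A.Normal) : cj g A = A := by
  ext x
  rw [mem_cj]
  constructor
  · intro h; simpa [mul_assoc] using hA.conj_mem _ h g
  · intro h; simpa [mul_assoc] using hA.conj_mem _ h g⁻¹

/-- normalizer of a subgroup -/
def Nz (A : Subgroup G) : Subgroup G := Subgroup.normalizer (A : Set G)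

lemma mem_Nz {g : G} {A : Subgroup G} : g ∈ Nz A ↔ cj g A = A := by
  rw [Nz, Subgroup.mem_normalizer_iff'']
  constructor
  · intro h; ext x; rw [mem_cj]; exact (h x).symm
  · intro h x
    have : x ∈ cj g A ↔ x ∈ A := by rw [h]
    rw [← this, mem_cj]

lemma mem_Nz_of_le [Finite G] {g : G} {A : Subgroup G} (h : ∀ x ∈ A, g * x * g⁻¹ ∈ A) :
    g ∈ Nz A := by
  rw [mem_Nz]
  apply Subgroup.eq_of_le_of_card_ge
  · rintro x ⟨a, ha, rfl⟩; exact h a ha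
  · rw [card_cj]

lemma Nz_conj {g x : G} {A : Subgroup G} (hg : g ∈ Nz A) (hx : x ∈ A) : g * x * g⁻¹ ∈ A := by
  rw [mem_Nz] at hg; rw [← hg]; exact cj_mem hx

lemma Nz_conj' {g x : G} {A : Subgroup G} (hg : g ∈ Nz A) (hx : x ∈ A) : g⁻¹ * x * g ∈ A := by
  simpa using Nz_conj ((Nz A).inv_mem hg) hx

lemma le_Nz (A : Subgroup G) : A ≤ Nz A := Subgroup.le_normalizer

lemma Nz_eq_top {A : Subgroup G} : Nz A = ⊤ ↔ A.Normal := Subgroup.normalizer_eq_top_iff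

lemma normal_of_le_Nz {A : Subgroup G} (h : ⊤ ≤ Nz A) : A.Normal := Nz_eq_top.1 (top_le_iff.1 h)

lemma Nz_inf_le (A B : Subgroup G) : Nz A ⊓ Nz B ≤ Nz (A ⊓ B) := by
  rintro g ⟨ha, hb⟩
  have ha : cj g A = A := mem_Nz.1 ha
  have hb : cj g B = B := mem_Nz.1 hb
  rw [mem_Nz, cj_inf, ha, hb]

lemma Nz_sup_le (A B : Subgroup G) : Nz A ⊓ Nz B ≤ Nz (A ⊔ B) := by
  rintro g ⟨ha, hb⟩
  have ha : cj g A = A := mem_Nz.1 ha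
  have hb : cj g B = B := mem_Nz.1 hb
  rw [mem_Nz, cj_sup, ha, hb]

lemma Nz_cj (g : G) (A : Subgroup G) : Nz (cj g A) = cj g (Nz A) := by
  ext x
  rw [mem_cj, mem_Nz, mem_Nz, cj_mul (g⁻¹ * x), cj_mul g⁻¹]
  constructor
  · intro h
    rw [h, cj_inv_cj]
  · intro h
    have := congrArg (cj g) h
    rwa [cj_cj_inv] at this

/-- elements of a product with a normalizing subgroup -/
lemma mem_sup_of_le_Nz {A B : Subgroup G} (h : B ≤ Nz A) {x : G} :
    x ∈ A ⊔ B ↔ ∃ a ∈ A, ∃ b ∈ B, x = a * b := by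
  constructor
  · intro hx
    let C : Subgroup G :=
      { carrier := {x | ∃ a ∈ A, ∃ b ∈ B, x = a * b}
        one_mem' := ⟨1, A.one_mem, 1, B.one_mem, by simp⟩
        mul_mem' := by
          rintro _ _ ⟨a, ha, b, hb, rfl⟩ ⟨c, hc, d, hd, rfl⟩
          exact ⟨a * (b * c * b⁻¹), A.mul_mem ha (Nz_conj (h hb) hc), b * d, B.mul_mem hb hd,
            by group⟩
        inv_mem' := by
          rintro _ ⟨a, ha, b, hb, rfl⟩
          exact ⟨b⁻¹ * a⁻¹ * b, Nz_conj' (h hb) (A.inv_mem ha), b⁻¹, B.inv_mem hb, by group⟩ }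
    have hA : A ≤ C := fun a ha => ⟨a, ha, 1, B.one_mem, by simp⟩
    have hB : B ≤ C := fun b hb => ⟨1, A.one_mem, b, hb, by simp⟩
    exact (sup_le hA hB) hx
  · rintro ⟨a, ha, b, hb, rfl⟩
    exact mul_mem (le_sup_left (a := A) (b := B) ha) (le_sup_right (a := A) (b := B) hb)

lemma exists_of_cover {A B : Subgroup G} [hA : A.Normal] (h : A ⊔ B = ⊤) (x : G) :
    ∃ a ∈ A, ∃ b ∈ B, x = a * b := by
  refine (mem_sup_of_le_Nz (A := A) (B := B) ?_).1 (by rw [h]; trivial)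
  rw [Nz_eq_top.2 hA]; exact le_top

end basics

section syl
variable {G : Type*} [Group G] [Finite G] {p : ℕ} [hp : Fact p.Prime]

/-- relative Sylow subgroup -/
def IsSyl (p : ℕ) (P X : Subgroup G) : Prop := P ≤ X ∧ IsPGroup p P ∧ ¬ p ∣ P.relIndex X

lemma isPGroup_subgroupOf {P X : Subgroup G} (h : IsPGroup p P) : IsPGroup p (P.subgroupOf X) :=
  h.comap_of_injective _ X.subtype_injective

lemma IsSyl.exists_sylow {P X : Subgroup G} (h : IsSyl p P X) :
    ∃ S : Sylow p X, (S : Subgroup X).map X.subtype = P := by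
  obtain ⟨h1, h2, h3⟩ := h
  have h4 : ¬ p ∣ (P.subgroupOf X).index := h3
  refine ⟨IsPGroup.toSylow (isPGroup_subgroupOf (X := X) h2) h4, ?_⟩
  rw [IsPGroup.toSylow_coe]
  exact Subgroup.map_subgroupOf_eq_of_le h1

lemma isSyl_of_sylow {X : Subgroup G} (S : Sylow p X) :
    IsSyl p ((S : Subgroup X).map X.subtype) X := by
  refine ⟨Subgroup.map_subtype_le _, S.2.map _, ?_⟩
  have : ((S : Subgroup X).map X.subtype).subgroupOf X = S :=
    Subgroup.comap_map_eq_self_of_injective X.subtype_injective _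
  rw [Subgroup.relIndex, this]
  exact S.not_dvd_index

lemma isSyl_top_of_sylow (S : Sylow p G) : IsSyl p (S : Subgroup G) ⊤ := by
  refine ⟨le_top, S.2, ?_⟩
  rw [Subgroup.relIndex_top_right]; exact S.not_dvd_index

lemma IsSyl.exists_sylow_top {P : Subgroup G} (h : IsSyl p P ⊤) :
    ∃ S : Sylow p G, (S : Subgroup G) = P := by
  refine ⟨IsPGroup.toSylow h.2.1 ?_, IsPGroup.toSylow_coe _ _⟩
  have := h.2.2; rwa [Subgroup.relIndex_top_right] at this

lemma exists_isSyl_ge {Q X : Subgroup G} (hQ : IsPGroup p Q) (hQX : Q ≤ X) :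
    ∃ P, IsSyl p P X ∧ Q ≤ P := by
  obtain ⟨S, hS⟩ := (isPGroup_subgroupOf (X := X) hQ).exists_le_sylow
  refine ⟨_, isSyl_of_sylow S, ?_⟩
  rw [← Subgroup.map_subgroupOf_eq_of_le hQX]
  exact Subgroup.map_mono hS

lemma isPGroup_bot' : IsPGroup p (⊥ : Subgroup G) := IsPGroup.of_bot

lemma exists_isSyl (p : ℕ) [Fact p.Prime] (X : Subgroup G) : ∃ P, IsSyl p P X := by
  obtain ⟨P, hP, -⟩ := exists_isSyl_ge (p := p) isPGroup_bot' (bot_le : (⊥ : Subgroup G) ≤ X)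
  exact ⟨P, hP⟩

lemma IsSyl.card {P X : Subgroup G} (h : IsSyl p P X) :
    Nat.card P = p ^ (Nat.card X).factorization p := by
  obtain ⟨S, rfl⟩ := h.exists_sylow
  rw [Subgroup.card_map_of_injective X.subtype_injective, S.card_eq_multiplicity]

lemma card_pGroup_dvd {Q X : Subgroup G} (hQ : IsPGroup p Q) (hQX : Q ≤ X) :
    Nat.card Q ∣ p ^ (Nat.card X).factorization p := by
  obtain ⟨P, hP, hle⟩ := exists_isSyl_ge hQ hQX
  rw [← hP.card]; exact Subgroup.card_dvd_of_le hle

lemma card_pGroup_le {Q X : Subgroup G} (hQ : IsPGroup p Q) (hQX : Q ≤ X) :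
    Nat.card Q ≤ p ^ (Nat.card X).factorization p :=
  Nat.le_of_dvd (pow_pos hp.out.pos _) (card_pGroup_dvd hQ hQX)

lemma isSyl_of_card {P X : Subgroup G} (hle : P ≤ X) (hP : IsPGroup p P)
    (h : p ^ (Nat.card X).factorization p ≤ Nat.card P) : IsSyl p P X := by
  obtain ⟨Q, hQ, hle'⟩ := exists_isSyl_ge hP hle
  have : P = Q := Subgroup.eq_of_le_of_card_ge hle' (by rw [hQ.card]; exact h)
  rw [this]; exact hQ

lemma IsSyl.eq_of_le {P Q X : Subgroup G} (h : IsSyl p P X) (hQ : IsPGroup p Q) (hQX : Q ≤ X)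
    (hPQ : P ≤ Q) : P = Q :=
  Subgroup.eq_of_le_of_card_ge hPQ (by rw [h.card]; exact card_pGroup_le hQ hQX)

lemma IsSyl.of_le {P X X' : Subgroup G} (h : IsSyl p P X) (hP : P ≤ X') (hX : X' ≤ X) :
    IsSyl p P X' := by
  refine ⟨hP, h.2.1, fun hd => h.2.2 ?_⟩
  rw [← Subgroup.relIndex_mul_relIndex P X' X hP hX]
  exact Dvd.dvd.mul_right hd _

lemma isPGroup_cj {A : Subgroup G} (g : G) (h : IsPGroup p A) : IsPGroup p (cj g A) := h.map _

lemma IsSyl.cj {P X : Subgroup G} (h : IsSyl p P X) (g : G) : IsSyl p (cj g P) (cj g X) :=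
  isSyl_of_card (cj_mono h.1) (isPGroup_cj g h.2.1) (by rw [card_cj, card_cj, h.card])

lemma IsSyl.cj_mem {P X : Subgroup G} (h : IsSyl p P X) {g : G} (hg : g ∈ X) :
    IsSyl p (FrobGen.cj g P) X := by
  have := h.cj g; rwa [cj_eq_of_mem hg] at this

/-- conjugacy of Sylow subgroups -/
lemma IsSyl.conj {P Q X : Subgroup G} (hP : IsSyl p P X) (hQ : IsSyl p Q X) :
    ∃ x ∈ X, FrobGen.cj x P = Q := by
  obtain ⟨S, rfl⟩ := hP.exists_sylow
  obtain ⟨T, rfl⟩ := hQ.exists_sylow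
  obtain ⟨x, rfl⟩ := MulAction.exists_smul_eq X S T
  refine ⟨x, x.2, ?_⟩
  ext y
  rw [mem_cj]
  constructor
  · rintro ⟨s, hs, e⟩
    refine ⟨x * s * x⁻¹, ?_, ?_⟩
    · rw [Sylow.coe_subgroup_smul]
      exact ⟨s, hs, by simp [MulAut.conj_apply]⟩
    · simp only [Subgroup.coe_subtype] at e
      simp [e, mul_assoc]
  · rintro ⟨s, hs, e⟩
    rw [Sylow.coe_subgroup_smul] at hs
    obtain ⟨t, ht, rfl⟩ := hs
    refine ⟨t, ht, ?_⟩
    simp only [Subgroup.coe_subtype] at e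
    simp [← e, mul_assoc]

lemma IsSyl.conj_le {P Q X : Subgroup G} (hP : IsSyl p P X) (hQ : IsPGroup p Q) (hQX : Q ≤ X) :
    ∃ x ∈ X, FrobGen.cj x Q ≤ P := by
  obtain ⟨R, hR, hQR⟩ := exists_isSyl_ge hQ hQX
  obtain ⟨x, hx, rfl⟩ := hR.conj hP
  exact ⟨x, hx, cj_mono hQR⟩

lemma IsSyl.frattini {P N X : Subgroup G} (hP : IsSyl p P N) (hX : X ≤ Nz N) {x : G} (hx : x ∈ X) :
    ∃ n ∈ N, n * x ∈ Nz P := by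
  have h1 := hP.cj x
  rw [mem_Nz.1 (hX hx)] at h1
  obtain ⟨n, hn, e⟩ := h1.conj hP
  exact ⟨n, hn, by rw [mem_Nz, cj_mul, e]⟩

lemma IsSyl.inf {P X N : Subgroup G} (hP : IsSyl p P X) (hN : X ≤ Nz N) (hNX : N ≤ X) :
    IsSyl p (P ⊓ N) N := by
  have hPN : IsPGroup p (P ⊓ N : Subgroup G) := hP.2.1.to_inf_left
  obtain ⟨Q, hQ, hle⟩ := exists_isSyl_ge hPN inf_le_right
  obtain ⟨x, hx, hxQ⟩ := hP.conj_le hQ.2.1 (hQ.1.trans hNX)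
  have h2 : FrobGen.cj x Q ≤ P ⊓ N := by
    refine le_inf hxQ ?_
    have := cj_mono (g := x) hQ.1
    rwa [mem_Nz.1 (hN hx)] at this
  have : Nat.card Q ≤ Nat.card (P ⊓ N : Subgroup G) := by
    rw [← card_cj x Q]; exact Subgroup.card_le_of_le h2
  exact isSyl_of_card inf_le_right hPN (by rw [← hQ.card]; exact this)

lemma IsSyl.map {G' : Type*} [Group G'] [Finite G'] {P X : Subgroup G} (hP : IsSyl p P X) (f : G →* G') :
    IsSyl p (P.map f) (X.map f) := by
  refine ⟨Subgroup.map_mono hP.1, hP.2.1.map f, fun hd => hP.2.2 (hd.trans ?_)⟩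
  rw [← Subgroup.relIndex_comap]
  exact Subgroup.relIndex_dvd_of_le_left _ (Subgroup.le_comap_map f P)

lemma isSyl_of_map_inj {G' : Type*} [Group G'] [Finite G'] {P X : Subgroup G} {f : G →* G'}
    (hf : Function.Injective f) (h : IsSyl p (P.map f) (X.map f)) : IsSyl p P X := by
  have hle : P ≤ X := (Subgroup.map_le_map_iff_of_injective hf).1 h.1
  have hPG : IsPGroup p P := by
    have := h.2.1.comap_of_injective f hf
    rwa [Subgroup.comap_map_eq_self_of_injective hf] at this
  refine isSyl_of_card hle hPG ?_
  have := h.card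
  rw [Subgroup.card_map_of_injective hf, Subgroup.card_map_of_injective hf] at this
  rw [this]

lemma IsSyl.self {P : Subgroup G} (h : IsPGroup p P) : IsSyl p P P :=
  ⟨le_rfl, h, by simp [hp.out.one_lt.ne']⟩

lemma not_dvd_of_isSyl_bot {X : Subgroup G} (h : IsSyl p ⊥ X) : ¬ p ∣ Nat.card X := by
  have := h.2.2; rwa [Subgroup.relIndex_bot_left] at this

lemma IsSyl.ne_bot {P X : Subgroup G} (h : IsSyl p P X) (hd : p ∣ Nat.card X) : P ≠ ⊥ := by
  rintro rfl; exact not_dvd_of_isSyl_bot h hd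

lemma pGroup_dvd {P : Subgroup G} (h : IsPGroup p P) (hne : P ≠ ⊥) : p ∣ Nat.card P := by
  rcases h.card_eq_or_dvd with h1 | h1
  · exact absurd (Subgroup.card_eq_one.1 h1) hne
  · exact h1

lemma inf_eq_bot_of_coprime {P N : Subgroup G} (h : IsPGroup p P) (hN : ¬ p ∣ Nat.card N) :
    P ⊓ N = ⊥ := by
  by_contra hne
  exact hN ((pGroup_dvd h.to_inf_left hne).trans (Subgroup.card_dvd_of_le inf_le_right))

/-- normalizers grow in p-groups -/
lemma lt_Nz_of_lt {D P : Subgroup G} (hP : IsPGroup p P) (h : D < P) : D < Nz D ⊓ P := by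
  refine lt_of_le_of_ne (le_inf (le_Nz D) h.le) fun e => ?_
  have : Group.IsNilpotent P := hP.isNilpotent
  have hnc := Group.normalizerCondition_of_isNilpotent (G := P)
  have h1 : D.subgroupOf P < ⊤ := by
    rw [lt_top_iff_ne_top]; intro h2
    exact h.not_ge (Subgroup.subgroupOf_eq_top.1 h2)
  obtain ⟨-, x, hx, hxn⟩ := SetLike.lt_iff_le_and_exists.1 (hnc _ h1)
  apply hxn
  rw [Subgroup.mem_subgroupOf, e]
  refine ⟨?_, x.2⟩
  apply mem_Nz_of_le
  intro y hy
  have := (Subgroup.mem_normalizer_iff.1 hx ⟨y, h.le hy⟩).1 (by simpa [Subgroup.mem_subgroupOf] using hy)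
  simpa [Subgroup.mem_subgroupOf] using this

lemma exists_sylow_of_prime_dvd {X : Subgroup G} (h : p ∣ Nat.card X) : ∃ x ∈ X, orderOf x = p := by
  obtain ⟨x, hx⟩ := exists_prime_orderOf_dvd_card' p h
  exact ⟨x, x.2, by rw [← hx, Subgroup.orderOf_coe]⟩

end syl
end FrobGen

set_option linter.unusedSectionVars false
namespace FrobGen
open Subgroup
open scoped commutatorElement

section pn
variable {G : Type*} [Group G] [Finite G] {p : ℕ} [hp : Fact p.Prime]

/-- `N` is a normal `p`-complement of `X` -/
def IsPC (p : ℕ) (N X : Subgroup G) : Prop :=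
  N ≤ X ∧ X ≤ Nz N ∧ ¬ p ∣ Nat.card N ∧ ∀ x ∈ X, ∃ k : ℕ, x ^ (p ^ k) ∈ N

/-- `X` has a normal `p`-complement -/
def PN (p : ℕ) (X : Subgroup G) : Prop := ∃ N, IsPC p N X

lemma PN.mono {X X' : Subgroup G} (h : PN p X) (hle : X' ≤ X) : PN p X' := by
  obtain ⟨N, h1, h2, h3, h4⟩ := h
  refine ⟨N ⊓ X', inf_le_right, ?_, fun hd => h3 (hd.trans (Subgroup.card_dvd_of_le inf_le_left)), ?_⟩
  · exact le_trans (le_inf (hle.trans h2) (le_Nz X')) (Nz_inf_le N X')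
  · intro x hx
    obtain ⟨k, hk⟩ := h4 x (hle hx)
    exact ⟨k, hk, pow_mem hx _⟩

lemma Nz_map_le {G' : Type*} [Group G'] (f : G →* G') {A B : Subgroup G} (h : A ≤ Nz B) :
    A.map f ≤ Nz (B.map f) := by
  rintro _ ⟨a, ha, rfl⟩
  rw [mem_Nz]
  have e := mem_Nz.1 (h ha)
  ext x
  rw [mem_cj]
  constructor
  · rintro ⟨b, hb, hbx⟩
    refine ⟨a * b * a⁻¹, Nz_conj (h ha) hb, ?_⟩
    simp [hbx, mul_assoc]
  · rintro ⟨b, hb, rfl⟩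
    exact ⟨a⁻¹ * b * a, Nz_conj' (h ha) hb, by simp⟩

lemma PN.map {G' : Type*} [Group G'] [Finite G'] {X : Subgroup G} (h : PN p X) (f : G →* G') :
    PN p (X.map f) := by
  obtain ⟨N, h1, h2, h3, h4⟩ := h
  refine ⟨N.map f, Subgroup.map_mono h1, Nz_map_le f h2, fun hd => h3 (hd.trans (Subgroup.card_map_dvd N f)), ?_⟩
  rintro _ ⟨x, hx, rfl⟩
  obtain ⟨k, hk⟩ := h4 x hx
  exact ⟨k, _, hk, by simp⟩

lemma PN.of_map {G' : Type*} [Group G'] [Finite G'] {X : Subgroup G} (f : G →* G')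
    (h : PN p (X.map f)) (hk : ¬ p ∣ Nat.card (f.ker ⊓ X : Subgroup G)) : PN p X := by
  obtain ⟨N, h1, h2, h3, h4⟩ := h
  refine ⟨N.comap f ⊓ X, inf_le_right, ?_, ?_, ?_⟩
  · intro x hx
    apply mem_Nz_of_le
    rintro y ⟨hy, hyX⟩
    refine ⟨?_, X.mul_mem (X.mul_mem hx hyX) (X.inv_mem hx)⟩
    have := Nz_conj (h2 (Subgroup.mem_map_of_mem f hx)) hy
    simpa [Subgroup.mem_comap] using this
  · intro hd
    obtain ⟨x, ⟨hx, hxX⟩, ho⟩ := exists_sylow_of_prime_dvd hd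
    have hfx : f x = 1 := by
      rw [← orderOf_eq_one_iff]
      have d1 : orderOf (f x) ∣ p := by rw [← ho]; exact orderOf_map_dvd f x
      rcases (Nat.dvd_prime hp.out).1 d1 with e | e
      · exact e
      · exfalso; apply h3; rw [← e]
        exact Subgroup.orderOf_dvd_natCard N hx
    apply hk
    rw [← ho]
    exact Subgroup.orderOf_dvd_natCard _ ⟨hfx, hxX⟩
  · intro x hx
    obtain ⟨k, hk⟩ := h4 _ (Subgroup.mem_map_of_mem f hx)
    refine ⟨k, ?_, pow_mem hx _⟩
    simpa [Subgroup.mem_comap] using hk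

lemma PN.of_map_inj {G' : Type*} [Group G'] [Finite G'] {X : Subgroup G} {f : G →* G'}
    (hf : Function.Injective f) (h : PN p (X.map f)) : PN p X := by
  refine h.of_map f ?_
  rw [(MonoidHom.ker_eq_bot_iff f).2 hf]
  simp [hp.out.one_lt.ne']

lemma IsPGroup.pn {X : Subgroup G} (h : IsPGroup p X) : PN p X := by
  refine ⟨⊥, bot_le, ?_, by simp [hp.out.one_lt.ne'], fun x hx => ?_⟩
  · rw [Nz_eq_top.2 inferInstance]; exact le_top
  · obtain ⟨k, hk⟩ := h ⟨x, hx⟩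
    exact ⟨k, by simpa [Subtype.ext_iff] using hk⟩

lemma relIndex_of_pow {N X : Subgroup G} (h1 : N ≤ X) (h2 : X ≤ Nz N)
    (h4 : ∀ x ∈ X, ∃ k : ℕ, x ^ (p ^ k) ∈ N) : ∃ n, N.relIndex X = p ^ n := by
  have hn : (N.subgroupOf X).Normal := by
    rw [Subgroup.normal_subgroupOf_iff h1]
    intro a b ha hb
    exact Nz_conj (h2 hb) ha
  have hpg : IsPGroup p (X ⧸ N.subgroupOf X) := by
    intro x
    obtain ⟨x, rfl⟩ := QuotientGroup.mk_surjective x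
    obtain ⟨k, hk⟩ := h4 x x.2
    refine ⟨k, ?_⟩
    rw [← QuotientGroup.mk_pow, QuotientGroup.eq_one_iff]
    simpa [Subgroup.mem_subgroupOf] using hk
  obtain ⟨n, hn⟩ := IsPGroup.iff_card.1 hpg
  exact ⟨n, hn⟩

lemma sup_of_pow {N X P : Subgroup G} (h1 : N ≤ X) (h2 : X ≤ Nz N)
    (h4 : ∀ x ∈ X, ∃ k : ℕ, x ^ (p ^ k) ∈ N) (hP : IsSyl p P X) : N ⊔ P = X := by
  apply le_antisymm (sup_le h1 hP.1)
  rw [← Subgroup.relIndex_eq_one]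
  obtain ⟨n, hn⟩ := relIndex_of_pow h1 h2 h4
  have d1 : (N ⊔ P).relIndex X ∣ p ^ n := by
    rw [← hn]; exact Subgroup.relIndex_dvd_of_le_left _ le_sup_left
  have d2 : (N ⊔ P).relIndex X ∣ P.relIndex X := Subgroup.relIndex_dvd_of_le_left _ le_sup_right
  obtain ⟨k, hk, e⟩ := (Nat.dvd_prime_pow hp.out).1 d1
  rcases Nat.eq_zero_or_pos k with rfl | hk0
  · simpa using e
  · exact absurd ((dvd_pow_self p hk0.ne').trans (e ▸ d2)) hP.2.2

lemma IsPC.sup {N X P : Subgroup G} (h : IsPC p N X) (hP : IsSyl p P X) : N ⊔ P = X :=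
  sup_of_pow h.1 h.2.1 h.2.2.2 hP

/-- a `p`-group acting by conjugation on a subgroup of order divisible by `p` has fixed points -/
lemma exists_fixed {A W : Subgroup G} (hA : IsPGroup p A) (hd : p ∣ Nat.card W) (h : A ≤ Nz W) :
    ∃ w ∈ W, w ≠ 1 ∧ ∀ a ∈ A, a * w = w * a := by
  let act : MulAction A W :=
    { smul := fun a w => ⟨a * w * (a : G)⁻¹, Nz_conj (h a.2) w.2⟩
      one_smul := fun w => Subtype.ext (by change (1 : G) * w * (1 : G)⁻¹ = w; simp)
      mul_smul := fun a b w => Subtype.ext (by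
        change ((a * b : A) : G) * w * ((a * b : A) : G)⁻¹ = a * (b * w * (b : G)⁻¹) * (a : G)⁻¹
        push_cast; group) }
  have h1 : (1 : W) ∈ MulAction.fixedPoints A W := by
    intro a
    exact Subtype.ext (by change (a : G) * 1 * (a : G)⁻¹ = 1; simp)
  obtain ⟨w, hw, hne⟩ := hA.exists_fixed_point_of_prime_dvd_card_of_fixed_point W hd h1
  refine ⟨w, w.2, fun e => hne (Subtype.ext e.symm), fun a ha => ?_⟩
  have : a * (w : G) * a⁻¹ = w := congrArg Subtype.val (hw ⟨a, ha⟩)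
  rw [← mul_inv_eq_iff_eq_mul]; exact this

lemma IsPC.exists_mul {N X P : Subgroup G} (h : IsPC p N X) (hP : IsSyl p P X) {x : G} (hx : x ∈ X) :
    ∃ n ∈ N, ∃ s ∈ P, x = n * s := by
  rw [← h.sup hP] at hx
  exact (mem_sup_of_le_Nz (hP.1.trans h.2.1)).1 hx

/-- two subgroups normalizing each other with trivial intersection commute -/
lemma commute_of_Nz {A B : Subgroup G} (h1 : A ≤ Nz B) (h2 : B ≤ Nz A) (h : A ⊓ B = ⊥) {a b : G}
    (ha : a ∈ A) (hb : b ∈ B) : a * b = b * a := by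
  have : a * b * a⁻¹ * b⁻¹ ∈ A ⊓ B := by
    constructor
    · have := A.mul_mem ha (Nz_conj (h2 hb) (A.inv_mem ha))
      simpa [mul_assoc] using this
    · exact B.mul_mem (Nz_conj (h1 ha) hb) (B.inv_mem hb)
  rw [h, Subgroup.mem_bot] at this
  calc a * b = (a * b * a⁻¹ * b⁻¹) * b * a := by group
    _ = b * a := by rw [this]; group

lemma IsPC.commute {N X D : Subgroup G} (h : IsPC p N X) (hD : IsPGroup p D) (hDX : D ≤ X)
    (hX : X ≤ Nz D) {n d : G} (hn : n ∈ N) (hd : d ∈ D) : n * d = d * n := by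
  refine commute_of_Nz (h.1.trans hX) (hDX.trans h.2.1) ?_ hn hd
  rw [inf_comm]
  exact inf_eq_bot_of_coprime hD h.2.2.1

lemma IsPC.mem_iff {N X : Subgroup G} (h : IsPC p N X) {x : G} (hx : x ∈ X) :
    x ∈ N ↔ ¬ p ∣ orderOf x := by
  constructor
  · intro hxN hd
    exact h.2.2.1 (hd.trans (Subgroup.orderOf_dvd_natCard N hxN))
  · intro hd
    obtain ⟨k, hk⟩ := h.2.2.2 x hx
    have hc : Nat.Coprime (p ^ k) (orderOf x) :=
      Nat.Coprime.pow_left _ ((Nat.Prime.coprime_iff_not_dvd hp.out).2 hd)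
    obtain ⟨m, hm⟩ := exists_pow_eq_self_of_coprime hc
    rw [← hm]; exact pow_mem hk _

lemma orderOf_conj (g n : G) : orderOf (g * n * g⁻¹) = orderOf n := by
  have := orderOf_injective (MulAut.conj g).toMonoidHom (MulAut.conj g).injective n
  simpa [MulAut.conj_apply] using this

lemma mem_Nz_closure {s : Set G} {g : G} (h : ∀ x ∈ s, g * x * g⁻¹ ∈ Subgroup.closure s) :
    g ∈ Nz (Subgroup.closure s) := by
  apply mem_Nz_of_le
  intro x hx
  have h1 : Subgroup.closure s ≤ (Subgroup.closure s).comap (MulAut.conj g).toMonoidHom := by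
    rw [Subgroup.closure_le]; intro y hy; exact h y hy
  exact h1 hx

lemma IsPC.Nz_le {N X : Subgroup G} (h : IsPC p N X) : Nz X ≤ Nz N := by
  intro g hg
  apply mem_Nz_of_le
  intro n hn
  have hX := Nz_conj hg (h.1 hn)
  rw [h.mem_iff hX]
  rw [orderOf_conj, ← h.mem_iff (h.1 hn)]
  exact hn

lemma orderOf_dvd_pgroup {P : Subgroup G} (hP : IsPGroup p P) {q : ℕ} [Fact q.Prime] (hq : p ≠ q) {x : G}
    (hx : x ∈ P) (ho : x ^ q = 1) : x = 1 := by
  obtain ⟨k, hk⟩ := hP ⟨x, hx⟩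
  have hk : x ^ p ^ k = 1 := by simpa [Subtype.ext_iff] using hk
  have hc : Nat.Coprime (p ^ k) q := Nat.Coprime.pow_left _ ((Nat.coprime_primes hp.out Fact.out).2 hq)
  rw [← orderOf_eq_one_iff]
  exact Nat.eq_one_of_dvd_coprimes hc (orderOf_dvd_of_pow_eq_one hk) (orderOf_dvd_of_pow_eq_one ho)

lemma pn_top_of_nilpotent [hn : Group.IsNilpotent G] : PN p (⊤ : Subgroup G) := by
  classical
  by_cases hd : p ∣ Nat.card G
  swap
  · refine ⟨⊤, le_rfl, le_Nz _, by simpa using hd, fun x _ => ⟨0, trivial⟩⟩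
  have hno : ∀ {q : ℕ} [Fact q.Prime] (P : Sylow q G), (P : Subgroup G).Normal := by
    have := ((Group.isNilpotent_of_finite_tfae (G := G)).out 0 3).1 hn
    intro q hq P; exact this q hq P
  let e := Sylow.directProductOfNormal (G := G) hno
  have hmem : p ∈ (Nat.card G).primeFactors := Nat.mem_primeFactors.2 ⟨hp.out, hd, Nat.card_pos.ne'⟩
  let N : Subgroup G :=
    { carrier := {g | (e.symm g) ⟨p, hmem⟩ = 1}
      one_mem' := by simp
      mul_mem' := by
        intro a b ha hb
        simp only [Set.mem_ofPred_eq, map_mul, Pi.mul_apply] at *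
        simp [ha, hb]
      inv_mem' := by
        intro a ha
        simp only [Set.mem_ofPred_eq, map_inv, Pi.inv_apply] at *
        simp [ha] }
  have hNn : ∀ g n : G, n ∈ N → g * n * g⁻¹ ∈ N := by
    intro g n hn
    have hn : (e.symm n) ⟨p, hmem⟩ = 1 := hn
    change (e.symm (g * n * g⁻¹)) ⟨p, hmem⟩ = 1
    simp [map_mul, hn]
  refine ⟨N, le_top, fun g _ => mem_Nz_of_le (fun x hx => hNn g x hx), ?_, ?_⟩
  · intro hdN
    obtain ⟨x, hx, ho⟩ := exists_sylow_of_prime_dvd hdN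
    have hx : (e.symm x) ⟨p, hmem⟩ = 1 := hx
    have hx1 : e.symm x = 1 := by
      ext ⟨q, hq⟩ P
      by_cases hqp : q = p
      · subst hqp; exact congrArg Subtype.val (congrFun hx P)
      · have : Fact q.Prime := ⟨Nat.prime_of_mem_primeFactors hq⟩
        have hpow : (e.symm x) ^ p = 1 := by
          rw [← map_pow, ← ho, pow_orderOf_eq_one, map_one]
        have h1 : ((e.symm x ⟨q, hq⟩ P : P) : G) ^ p = 1 := by
          have := congrFun (congrFun hpow ⟨q, hq⟩) P
          simp only [Pi.pow_apply, Pi.one_apply] at this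
          rw [← Subgroup.coe_pow, this]; rfl
        exact orderOf_dvd_pgroup P.2 hqp (e.symm x ⟨q, hq⟩ P).2 h1
    have : x = 1 := by simpa using hx1
    rw [this, orderOf_one] at ho
    exact hp.out.one_lt.ne ho
  · intro x _
    have hfin : Finite (∀ P : Sylow p G, (P : Subgroup G)) := inferInstance
    have hPG : IsPGroup p (∀ P : Sylow p G, (P : Subgroup G)) := by
      have : Subsingleton (Sylow p G) := by
        have := Sylow.unique_of_normal (Classical.arbitrary (Sylow p G)) (hno _)
        infer_instance
      intro f
      obtain ⟨k, hk⟩ := (Classical.arbitrary (Sylow p G)).2 (f (Classical.arbitrary (Sylow p G)))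
      refine ⟨k, ?_⟩
      ext P
      have hP : P = Classical.arbitrary (Sylow p G) := Subsingleton.elim _ _
      rw [hP]
      simp [hk]
    obtain ⟨k, hk⟩ := hPG ((e.symm x) ⟨p, hmem⟩)
    refine ⟨k, ?_⟩
    change (e.symm (x ^ p ^ k)) ⟨p, hmem⟩ = 1
    rw [map_pow]; exact hk

lemma map_top_subtype (X : Subgroup G) : (⊤ : Subgroup X).map X.subtype = X := by
  rw [← MonoidHom.range_eq_map, Subgroup.range_subtype]

lemma pn_of_nilpotent {X : Subgroup G} (h : Group.IsNilpotent X) : PN p X := by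
  have := (pn_top_of_nilpotent (G := X) (p := p)).map X.subtype
  rwa [map_top_subtype] at this

/-- a Sylow subgroup controlling its own fusion has a normal complement -/
theorem fusion_top {P : Subgroup G} (hP : IsSyl p P ⊤)
    (hf : ∀ x ∈ P, ∀ g : G, g * x * g⁻¹ ∈ P → ∃ s ∈ P, g * x * g⁻¹ = s * x * s⁻¹) :
    PN p (⊤ : Subgroup G) := by
  classical
  let N : Subgroup G := Subgroup.closure {g | ¬ p ∣ orderOf g}
  have hNz : ⊤ ≤ Nz N := by
    intro g _
    refine mem_Nz_closure fun x hx => Subgroup.subset_closure ?_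
    have : orderOf (g * x * g⁻¹) = orderOf x := orderOf_conj g x
    simpa [this] using hx
  have hQ : IsSyl p (P ⊓ N) N := hP.inf hNz le_top
  obtain ⟨S, hS⟩ := hQ.exists_sylow
  have htriv : ∀ n : N, (S : Subgroup N).transferFocal n = 1 := by
    have hle : N ≤ ((S : Subgroup N).transferFocal.ker).map N.subtype := by
      rw [Subgroup.closure_le]
      intro g hg
      have hgN : g ∈ N := Subgroup.subset_closure hg
      refine ⟨⟨g, hgN⟩, ?_, rfl⟩
      have hpg : IsPGroup p (S ⧸ (S : Subgroup N).focalSubgroupOf) := S.2.to_quotient _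
      rw [SetLike.mem_coe, MonoidHom.mem_ker]
      set y := (S : Subgroup N).transferFocal ⟨g, hgN⟩ with hy
      by_contra hne
      have d1 := hpg.dvd_orderOf hne
      apply hg
      have d2 : orderOf y ∣ orderOf (⟨g, hgN⟩ : N) := orderOf_map_dvd _ _
      rw [Subgroup.orderOf_mk] at d2
      exact d1.trans d2
    intro n
    obtain ⟨m, hm, e⟩ := hle n.2
    have : m = n := Subtype.ext e
    rw [← this]; exact hm
  have hfoc : (S : Subgroup N) ≤ (S : Subgroup N).focalSubgroup := by
    intro s hs
    obtain ⟨n, hn⟩ := Subgroup.transferFocal_surjective S (QuotientGroup.mk ⟨s, hs⟩)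
    rw [htriv n] at hn
    have := (QuotientGroup.eq_one_iff _).1 hn.symm
    simpa [Subgroup.focalSubgroupOf_def, Subgroup.mem_subgroupOf] using this
  have hcom : P ⊓ N ≤ ⁅P ⊓ N, P⁆ := by
    have h1 : (S : Subgroup N).map N.subtype ≤ ((S : Subgroup N).focalSubgroup).map N.subtype :=
      Subgroup.map_mono hfoc
    rw [hS] at h1
    refine h1.trans ?_
    rw [Subgroup.focalSubgroup_def, MonoidHom.map_closure, Subgroup.closure_le]
    rintro _ ⟨_, ⟨hgS, x, hx, u, rfl⟩, rfl⟩
    have hxP : (x : G) ∈ P ⊓ N := by rw [← hS]; exact ⟨x, hx, rfl⟩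
    have hcP : (x * u * x⁻¹ * u⁻¹ : G) ∈ P ⊓ N := by
      rw [← hS]; exact ⟨_, hgS, by simp [commutatorElement_def]⟩
    obtain ⟨s, hs, e⟩ := hf (x : G)⁻¹ (P.inv_mem hxP.1) u (by
      have := P.mul_mem (P.inv_mem hxP.1) hcP.1
      simpa [mul_assoc] using this)
    have : N.subtype ⁅x, u⁆ = ⁅(x : G), s⁆ := by
      simp only [commutatorElement_def, Subgroup.coe_subtype, Subgroup.coe_mul, Subgroup.coe_inv]
      rw [mul_assoc, mul_assoc, ← mul_assoc (u : G), e]; group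
    rw [this]
    exact Subgroup.commutator_mem_commutator hxP hs
  have hall : ∀ n, P ⊓ N ≤ P.lowerCentralSeries n := by
    intro n
    induction n with
    | zero => exact inf_le_left
    | succ n ih =>
      refine hcom.trans ?_
      rw [Subgroup.lowerCentralSeries_succ]
      exact Subgroup.commutator_mono ih le_rfl
  have : Group.IsNilpotent P := hP.2.1.isNilpotent
  have hbot : P ⊓ N = ⊥ := by
    obtain ⟨n, hn⟩ := (Subgroup.isNilpotent_iff_lowerCentralSeries P).1 this
    exact le_bot_iff.1 (hn ▸ hall n)
  refine ⟨N, le_top, hNz, ?_, fun x _ => ?_⟩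
  · rw [hbot] at hQ; exact not_dvd_of_isSyl_bot hQ
  · obtain ⟨k, m, hm, e⟩ := Nat.exists_eq_pow_mul_and_not_dvd (orderOf_pos x).ne' p hp.out.ne_one
    refine ⟨k, Subgroup.subset_closure ?_⟩
    have : orderOf (x ^ p ^ k) = m := by
      rw [orderOf_pow_of_dvd (pow_pos hp.out.pos k).ne' (e ▸ dvd_mul_right _ _), e]
      exact Nat.mul_div_cancel_left _ (pow_pos hp.out.pos k)
    simpa [this] using hm

lemma top_Nz_top : (⊤ : Subgroup G) ≤ Nz ⊤ := le_Nz _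

theorem fusion_rel {P X : Subgroup G} (hP : IsSyl p P X)
    (hf : ∀ x ∈ P, ∀ g ∈ X, g * x * g⁻¹ ∈ P → ∃ s ∈ P, g * x * g⁻¹ = s * x * s⁻¹) :
    PN p X := by
  have h1 : IsSyl p (P.subgroupOf X) ⊤ := by
    apply isSyl_of_map_inj X.subtype_injective
    rwa [Subgroup.map_subgroupOf_eq_of_le hP.1, map_top_subtype]
  have h2 := fusion_top h1 (by
    intro x hx g hg
    obtain ⟨s, hs, e⟩ := hf x hx g g.2 hg
    exact ⟨⟨s, hP.1 hs⟩, hs, Subtype.ext e⟩)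
  have := h2.map X.subtype
  rwa [map_top_subtype] at this

lemma frob_aux (hN : ∀ D : Subgroup G, IsPGroup p D → D ≠ ⊥ → PN p (Nz D)) (n : ℕ) :
    ∀ P Q : Subgroup G, IsSyl p P ⊤ → IsSyl p Q ⊤ →
      Nat.card P - Nat.card (P ⊓ Q : Subgroup G) ≤ n →
      ∃ c : G, (∀ d ∈ P ⊓ Q, c * d = d * c) ∧ cj c P = Q := by
  induction n using Nat.strong_induction_on with
  | _ n ih =>
  intro P Q hP hQ hn
  by_cases hD : P ⊓ Q = ⊥
  · obtain ⟨x, -, e⟩ := hP.conj hQ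
    refine ⟨x, ?_, e⟩
    rw [hD]; intro d hd; rw [Subgroup.mem_bot.1 hd]; simp
  by_cases hPQ : P = Q
  · subst hPQ; exact ⟨1, by simp, cj_one _⟩
  set D := P ⊓ Q with hDdef
  have hDP : D < P := lt_of_le_of_ne inf_le_left fun e =>
    hPQ (hP.eq_of_le hQ.2.1 le_top (inf_eq_left.1 e))
  have hDQ : D < Q := lt_of_le_of_ne inf_le_right fun e =>
    hPQ (hQ.eq_of_le hP.2.1 le_top (inf_eq_right.1 e)).symm
  have hDp : IsPGroup p D := hP.2.1.to_inf_left
  have hP1 := lt_Nz_of_lt hP.2.1 hDP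
  have hQ1 := lt_Nz_of_lt hQ.2.1 hDQ
  obtain ⟨S, hS, hPS⟩ := exists_isSyl_ge (p := p) (Q := Nz D ⊓ P) (X := Nz D) hP.2.1.to_inf_right inf_le_left
  obtain ⟨T, hT, hQT⟩ := exists_isSyl_ge (p := p) (Q := Nz D ⊓ Q) (X := Nz D) hQ.2.1.to_inf_right inf_le_left
  obtain ⟨M, hM⟩ := hN D hDp hD
  obtain ⟨x, hx, hxe⟩ := hS.conj hT
  obtain ⟨m, hm, s, hs, rfl⟩ := hM.exists_mul hS hx
  rw [cj_mul, cj_eq_of_mem hs] at hxe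
  have hmD : ∀ d ∈ D, m * d = d * m := fun d hd => hM.commute hDp (le_Nz D) le_rfl hm hd
  obtain ⟨S', hS', hSS'⟩ := exists_isSyl_ge (p := p) hS.2.1 le_top
  obtain ⟨T', hT', hTT'⟩ := exists_isSyl_ge (p := p) hT.2.1 le_top
  have hcardP : ∀ {A : Subgroup G}, IsSyl p A ⊤ → Nat.card A = Nat.card P := by
    intro A hA; rw [hA.card, hP.card]
  have key : ∀ A B : Subgroup G, IsSyl p A ⊤ → IsSyl p B ⊤ → D < A ⊓ B →
      ∃ c : G, (∀ d ∈ D, c * d = d * c) ∧ cj c A = B := by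
    intro A B hA hB hlt
    have h1 : Nat.card D < Nat.card (A ⊓ B : Subgroup G) := by
      by_contra hle
      exact hlt.ne (Subgroup.eq_of_le_of_card_ge hlt.le (not_lt.1 hle))
    have h2 : Nat.card (A ⊓ B : Subgroup G) ≤ Nat.card P := by
      rw [← hcardP hA]; exact Subgroup.card_le_of_le inf_le_left
    obtain ⟨c, hc, e⟩ := ih (Nat.card A - Nat.card (A ⊓ B : Subgroup G))
      (by rw [hcardP hA]; omega) A B hA hB le_rfl
    exact ⟨c, fun d hd => hc d (hlt.le hd), e⟩
  obtain ⟨c1, hc1, e1⟩ := key P S' hP hS' (lt_of_lt_of_le hP1 (le_inf inf_le_right (hPS.trans hSS')))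
  obtain ⟨c3, hc3, e3⟩ := key T' Q hT' hQ (lt_of_lt_of_le hQ1 (le_inf (hQT.trans hTT') inf_le_right))
  obtain ⟨c2, hc2, e2⟩ := key (cj m S') T' (hS'.cj_mem trivial) hT' (by
    refine lt_of_lt_of_le hQ1 (le_inf (hQT.trans ?_) (hQT.trans hTT'))
    rw [← hxe]; exact cj_mono hSS')
  refine ⟨c3 * c2 * m * c1, ?_, ?_⟩
  · intro d hd
    calc c3 * c2 * m * c1 * d = c3 * c2 * m * (c1 * d) := by group
      _ = c3 * c2 * (m * d) * c1 := by rw [hc1 d hd]; group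
      _ = c3 * (c2 * d) * m * c1 := by rw [hmD d hd]; group
      _ = (c3 * d) * c2 * m * c1 := by rw [hc2 d hd]; group
      _ = d * (c3 * c2 * m * c1) := by rw [hc3 d hd]; group
  · rw [cj_mul, cj_mul, cj_mul, e1, e2, e3]

/-- Frobenius normal p-complement theorem -/
theorem frobenius_pn (hN : ∀ D : Subgroup G, IsPGroup p D → D ≠ ⊥ → PN p (Nz D)) :
    PN p (⊤ : Subgroup G) := by
  obtain ⟨P, hP⟩ := exists_isSyl p (⊤ : Subgroup G)
  apply fusion_top hP
  intro x hx g hg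
  by_cases hbot : P = ⊥
  · subst hbot
    rw [Subgroup.mem_bot] at hx; subst hx
    exact ⟨1, Subgroup.one_mem _, by simp⟩
  obtain ⟨c, hc, e⟩ := frob_aux hN _ P (cj g⁻¹ P) hP (hP.cj_mem trivial) le_rfl
  have hcx := hc x ⟨hx, mem_cj.2 (by simpa using hg)⟩
  have hgc : g * c ∈ Nz P := by rw [mem_Nz, cj_mul, e, cj_cj_inv]
  obtain ⟨M, hM⟩ := hN P hP.2.1 hbot
  obtain ⟨m, hm, s, hs, e2⟩ := hM.exists_mul (hP.of_le (le_Nz P) le_top) hgc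
  refine ⟨s, hs, ?_⟩
  have h1 : s * x * s⁻¹ ∈ P := P.mul_mem (P.mul_mem hs hx) (P.inv_mem hs)
  have h2 := hM.commute hP.2.1 (le_Nz P) le_rfl hm h1
  calc g * x * g⁻¹ = g * (x * c) * c⁻¹ * g⁻¹ := by group
    _ = (g * c) * x * (g * c)⁻¹ := by rw [← hcx]; group
    _ = (m * (s * x * s⁻¹)) * m⁻¹ := by rw [e2]; group
    _ = s * x * s⁻¹ := by rw [h2]; group

end pn
end FrobGen

set_option linter.unusedSectionVars false
namespace FrobGen
open Subgroup

section JZ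
variable {G : Type*} [Group G] [Finite G] {p : ℕ} [hp : Fact p.Prime]

/-- `Ω₁(Z(S))` -/
def Zp (p : ℕ) (S : Subgroup G) : Subgroup G where
  carrier := {z | z ∈ S ∧ z ^ p = 1 ∧ ∀ s ∈ S, s * z = z * s}
  one_mem' := ⟨S.one_mem, one_pow _, by simp⟩
  mul_mem' := by
    rintro a b ⟨ha, ha', ha''⟩ ⟨hb, hb', hb''⟩
    refine ⟨S.mul_mem ha hb, ?_, fun s hs => ?_⟩
    · rw [(show Commute a b from hb'' a ha).mul_pow, ha', hb', one_mul]
    · rw [← mul_assoc, ha'' s hs, mul_assoc, hb'' s hs, mul_assoc]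
  inv_mem' := by
    rintro a ⟨ha, ha', ha''⟩
    refine ⟨S.inv_mem ha, by rw [inv_pow, ha', inv_one], fun s hs => ?_⟩
    exact ((show Commute s a from ha'' s hs).inv_right).eq

lemma mem_Zp {S : Subgroup G} {z : G} : z ∈ Zp p S ↔ z ∈ S ∧ z ^ p = 1 ∧ ∀ s ∈ S, s * z = z * s :=
  Iff.rfl

lemma Zp_le (S : Subgroup G) : Zp p S ≤ S := fun _ h => h.1

/-- elementary abelian -/
def IsEA (p : ℕ) (A : Subgroup G) : Prop := (∀ x ∈ A, x ^ p = 1) ∧ ∀ x ∈ A, ∀ y ∈ A, x * y = y * x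

def IsMaxEA (p : ℕ) (S A : Subgroup G) : Prop :=
  A ≤ S ∧ IsEA p A ∧ ∀ B ≤ S, IsEA p B → Nat.card B ≤ Nat.card A

/-- Thompson subgroup -/
def Jp (p : ℕ) (S : Subgroup G) : Subgroup G := sSup {A | IsMaxEA p S A}

lemma Jp_le (S : Subgroup G) : Jp p S ≤ S := sSup_le fun _ h => h.1

lemma le_Jp {S A : Subgroup G} (h : IsMaxEA p S A) : A ≤ Jp p S := le_sSup h

lemma IsEA.isPGroup {A : Subgroup G} (h : IsEA p A) : IsPGroup p A := by
  intro x
  exact ⟨1, by rw [pow_one]; exact Subtype.ext (h.1 x x.2)⟩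

lemma isEA_bot : IsEA p (⊥ : Subgroup G) := by
  refine ⟨fun x hx => ?_, fun x hx y hy => ?_⟩
  · rw [Subgroup.mem_bot.1 hx, one_pow]
  · rw [Subgroup.mem_bot.1 hx, Subgroup.mem_bot.1 hy]

lemma exists_maxEA (p : ℕ) [Fact p.Prime] (S : Subgroup G) : ∃ A, IsMaxEA p S A := by
  have hfin : (Set.univ : Set (Subgroup G)).Finite := Set.toFinite _
  obtain ⟨A, hA, hmax⟩ := Set.exists_max_image {A : Subgroup G | A ≤ S ∧ IsEA p A}
    (fun A => Nat.card A) (Set.toFinite _) ⟨⊥, bot_le, isEA_bot⟩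
  exact ⟨A, hA.1, hA.2, fun B hB hE => hmax B ⟨hB, hE⟩⟩

lemma isEA_zpowers {x : G} (hx : x ^ p = 1) : IsEA p (Subgroup.zpowers x) := by
  refine ⟨?_, ?_⟩
  · rintro _ ⟨n, rfl⟩
    change (x ^ n) ^ p = 1
    rw [← zpow_natCast, zpow_comm, zpow_natCast, hx, one_zpow]
  · rintro _ ⟨n, rfl⟩ _ ⟨m, rfl⟩
    exact (zpow_mul_comm x n m)

lemma exists_order_p {S : Subgroup G} (hS : IsPGroup p S) (h : S ≠ ⊥) : ∃ x ∈ S, x ^ p = 1 ∧ x ≠ 1 := by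
  obtain ⟨x, hx, ho⟩ := exists_sylow_of_prime_dvd (pGroup_dvd hS h)
  refine ⟨x, hx, ?_, ?_⟩
  · rw [← ho]; exact pow_orderOf_eq_one x
  · rintro rfl; rw [orderOf_one] at ho; exact hp.out.one_lt.ne ho

lemma Jp_ne_bot {S : Subgroup G} (hS : IsPGroup p S) (h : S ≠ ⊥) : Jp p S ≠ ⊥ := by
  obtain ⟨x, hx, hxp, hx1⟩ := exists_order_p hS h
  obtain ⟨A, hA⟩ := exists_maxEA p S
  intro hbot
  have hAb : A = ⊥ := le_bot_iff.1 (hbot ▸ le_Jp hA)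
  have h1 := hA.2.2 (Subgroup.zpowers x) (by rwa [Subgroup.zpowers_le]) (isEA_zpowers hxp)
  rw [hAb, Subgroup.card_bot] at h1
  have h2 := Subgroup.eq_bot_of_card_le _ h1
  exact hx1 (Subgroup.zpowers_eq_bot.1 h2)

lemma Zp_ne_bot {S : Subgroup G} (hS : IsPGroup p S) (h : S ≠ ⊥) : Zp p S ≠ ⊥ := by
  have : Nontrivial S := (Subgroup.nontrivial_iff_ne_bot S).2 h
  have hb : Subgroup.center S ≠ ⊥ := (hS.bot_lt_center).ne'
  obtain ⟨x, hx, hxp, hx1⟩ := exists_order_p (hS.to_subgroup (Subgroup.center S)) hb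
  intro hbot
  have : (x : G) ∈ Zp p S := by
    refine ⟨x.2, by exact_mod_cast congrArg Subtype.val hxp, fun s hs => ?_⟩
    exact congrArg Subtype.val (Subgroup.mem_center_iff.1 hx ⟨s, hs⟩)
  rw [hbot, Subgroup.mem_bot] at this
  exact hx1 (Subtype.ext this)

section map
variable {G' : Type*} [Group G'] [Finite G'] {f : G →* G'} {S : Subgroup G}

lemma inj_on_of (hf : ∀ x ∈ S, f x = 1 → x = 1) {x y : G} (hx : x ∈ S) (hy : y ∈ S) (h : f x = f y) :
    x = y := by
  have := hf (x * y⁻¹) (S.mul_mem hx (S.inv_mem hy)) (by simp [h])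
  exact mul_inv_eq_one.1 this

lemma card_map_of (hf : ∀ x ∈ S, f x = 1 → x = 1) {A : Subgroup G} (hA : A ≤ S) :
    Nat.card (A.map f) = Nat.card A := by
  have : Set.InjOn f (A : Set G) := fun x hx y hy h => inj_on_of hf (hA hx) (hA hy) h
  exact Nat.card_image_of_injOn this

lemma Zp_map (hf : ∀ x ∈ S, f x = 1 → x = 1) : Zp p (S.map f) = (Zp p S).map f := by
  ext y
  constructor
  · rintro ⟨⟨s, hs, rfl⟩, h1, h2⟩
    refine ⟨s, ⟨hs, hf _ (S.pow_mem hs p) (by rw [map_pow]; exact h1), fun t ht => ?_⟩, rfl⟩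
    refine inj_on_of hf (S.mul_mem ht hs) (S.mul_mem hs ht) ?_
    simpa using h2 (f t) ⟨t, ht, rfl⟩
  · rintro ⟨z, ⟨h1, h2, h3⟩, rfl⟩
    refine ⟨⟨z, h1, rfl⟩, by rw [← map_pow, h2, map_one], ?_⟩
    rintro _ ⟨s, hs, rfl⟩
    rw [← map_mul, h3 s hs, map_mul]

lemma IsEA.map {A : Subgroup G} (h : IsEA p A) (f : G →* G') : IsEA p (A.map f) := by
  refine ⟨?_, ?_⟩
  · rintro _ ⟨a, ha, rfl⟩; rw [← map_pow, h.1 a ha, map_one]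
  · rintro _ ⟨a, ha, rfl⟩ _ ⟨b, hb, rfl⟩
    rw [← map_mul, h.2 a ha b hb, map_mul]

lemma IsEA.of_map (hf : ∀ x ∈ S, f x = 1 → x = 1) {A : Subgroup G} (hA : A ≤ S)
    (h : IsEA p (A.map f)) : IsEA p A := by
  refine ⟨?_, ?_⟩
  · intro x hx
    exact hf _ (S.pow_mem (hA hx) p) (by rw [map_pow]; exact h.1 _ ⟨x, hx, rfl⟩)
  · intro x hx y hy
    refine inj_on_of hf (S.mul_mem (hA hx) (hA hy)) (S.mul_mem (hA hy) (hA hx)) ?_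
    simpa using h.2 _ ⟨x, hx, rfl⟩ _ ⟨y, hy, rfl⟩

lemma eq_map_of_le {B : Subgroup G'} (hB : B ≤ S.map f) : (B.comap f ⊓ S).map f = B := by
  apply le_antisymm
  · rintro _ ⟨x, ⟨hx, -⟩, rfl⟩; exact hx
  · intro b hb
    obtain ⟨s, hs, rfl⟩ := hB hb
    exact ⟨s, ⟨hb, hs⟩, rfl⟩

lemma IsMaxEA.map (hf : ∀ x ∈ S, f x = 1 → x = 1) {A : Subgroup G} (h : IsMaxEA p S A) :
    IsMaxEA p (S.map f) (A.map f) := by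
  refine ⟨Subgroup.map_mono h.1, h.2.1.map f, fun B hB hE => ?_⟩
  have e := eq_map_of_le hB
  have hE' : IsEA p (B.comap f ⊓ S) := IsEA.of_map hf inf_le_right (by rw [e]; exact hE)
  have := h.2.2 _ inf_le_right hE'
  rw [card_map_of hf h.1, ← e, card_map_of hf inf_le_right]
  exact this

lemma Jp_map (hf : ∀ x ∈ S, f x = 1 → x = 1) : Jp p (S.map f) = (Jp p S).map f := by
  apply le_antisymm
  · apply sSup_le
    intro B hB
    have e := eq_map_of_le hB.1
    rw [← e]
    apply Subgroup.map_mono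
    apply le_Jp
    refine ⟨inf_le_right, IsEA.of_map hf inf_le_right (by rw [e]; exact hB.2.1), fun C hC hE => ?_⟩
    have := hB.2.2 (C.map f) (Subgroup.map_mono hC) (hE.map f)
    rw [card_map_of hf hC] at this
    rw [← card_map_of hf (A := B.comap f ⊓ S) inf_le_right, e]
    exact this
  · rw [Subgroup.map_le_iff_le_comap]
    apply sSup_le
    intro A hA
    rw [← Subgroup.map_le_iff_le_comap]
    exact le_Jp (hA.map hf)
end map

lemma conj_inj (g : G) (S : Subgroup G) : ∀ x ∈ S, (MulAut.conj g).toMonoidHom x = 1 → x = 1 := by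
  intro x _ h
  exact (MulEquiv.map_eq_one_iff (MulAut.conj g)).1 h

lemma Zp_cj (g : G) (S : Subgroup G) : Zp p (cj g S) = cj g (Zp p S) := Zp_map (conj_inj g S)
lemma Jp_cj (g : G) (S : Subgroup G) : Jp p (cj g S) = cj g (Jp p S) := Jp_map (conj_inj g S)

lemma Nz_le_Zp (S : Subgroup G) : Nz S ≤ Nz (Zp p S) := by
  intro g hg; rw [mem_Nz] at *; rw [← Zp_cj, hg]

lemma Nz_le_Jp (S : Subgroup G) : Nz S ≤ Nz (Jp p S) := by
  intro g hg; rw [mem_Nz] at *; rw [← Jp_cj, hg]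

lemma Jp_eq_of_le {S T : Subgroup G} (h1 : Jp p S ≤ T) (h2 : T ≤ S) : Jp p T = Jp p S := by
  obtain ⟨A0, hA0⟩ := exists_maxEA p S
  apply le_antisymm
  · apply sSup_le
    intro A hA
    apply le_Jp
    refine ⟨hA.1.trans h2, hA.2.1, fun B hB hE => ?_⟩
    exact (hA0.2.2 B hB hE).trans (hA.2.2 A0 ((le_Jp hA0).trans h1) hA0.2.1)
  · apply sSup_le
    intro A hA
    apply le_Jp
    exact ⟨(le_Jp hA).trans h1, hA.2.1, fun B hB hE => hA.2.2 B (hB.trans h2) hE⟩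

end JZ
end FrobGen

set_option linter.unusedSectionVars false
namespace FrobGen
open Subgroup

section ringlem
variable {R : Type*} [Ring R] {p : ℕ}

lemma zsmul_kill (hp : p.Prime) (hR : (p : R) = 0) {n : R} {k : ℤ} {j : ℕ} (hk : ¬ (p : ℤ) ∣ k)
    {t : ℤ} (h : (k * t ^ j) • n = 0) : t • n = 0 := by
  have hpn : (p : ℤ) • n = 0 := by simp [hR]
  by_cases ht : (p : ℤ) ∣ t
  · obtain ⟨s, rfl⟩ := ht
    rw [mul_comm, mul_smul, hpn, smul_zero]
  · have hp' : Prime (p : ℤ) := Nat.prime_iff_prime_int.1 hp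
    have h1 : ¬ (p : ℤ) ∣ k * t ^ j := by
      intro hd
      rcases hp'.dvd_or_dvd hd with h | h
      · exact hk h
      · exact ht (hp'.dvd_of_dvd_pow h)
    have hc : IsCoprime (p : ℤ) (k * t ^ j) := (Prime.coprime_iff_not_dvd hp').2 h1
    obtain ⟨u, v, huv⟩ := hc
    have : n = 0 := by
      calc n = (u * p + v * (k * t ^ j)) • n := by rw [huv, one_smul]
        _ = 0 := by rw [add_smul, mul_smul, mul_smul, hpn, h]; simp
    rw [this, smul_zero]

lemma ring_sq_zero (hp : p.Prime) (hR : (p : R) = 0) {n : R} (hn : (1 + n) ^ p = 1)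
    (hs : ∀ z, ∃ t : ℤ, n * z * n = t • n) : n * n = 0 := by
  obtain ⟨t, ht⟩ := hs 1
  rw [mul_one] at ht
  have h1 := Commute.add_pow_prime_eq hp (Commute.one_left n)
  simp only [hR, zero_mul, add_zero, one_pow, hn] at h1
  have h2 : n ^ p = 0 := by simpa using h1.symm
  have h3 : ∀ k : ℕ, n ^ (k + 1) = (t ^ k) • n := by
    intro k
    induction k with
    | zero => simp
    | succ k ih => rw [pow_succ, ih, smul_mul_assoc, ht, smul_smul, pow_succ]
  obtain ⟨k, hk⟩ := Nat.exists_eq_succ_of_ne_zero hp.ne_zero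
  rw [hk, Nat.succ_eq_add_one, h3] at h2
  rw [ht]
  have : ¬ (p : ℤ) ∣ 1 := by
    intro h; have := Int.natAbs_dvd_natAbs.2 h; simp at this; exact hp.one_lt.ne' this
  exact zsmul_kill hp hR (k := 1) (j := k) this (by rwa [one_mul])

lemma ring_ncn (hp : p.Prime) (hp2 : p ≠ 2) (hR : (p : R) = 0) {n x : R} (hnn : n * n = 0)
    (hs : ∀ z, ∃ t : ℤ, n * z * n = t • n)
    (hx : (1 + n) * x * (1 - n) * x = x * ((1 + n) * x * (1 - n))) : n * x * n = 0 := by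
  obtain ⟨t, ht⟩ := hs x
  rw [ht]
  have h1 : n * ((1 + n) * x * (1 - n) * x) * n = n * (x * ((1 + n) * x * (1 - n))) * n := by rw [hx]
  have e1 : n * ((1 + n) * x * (1 - n) * x) * n
      = n * x * x * n + n * n * x * x * n - (n * x * n) * x * n - n * n * x * n * x * n := by noncomm_ring
  have e2 : n * (x * ((1 + n) * x * (1 - n))) * n
      = n * x * x * n + (n * x * n) * x * n - n * x * x * (n * n) - (n * x * n) * x * (n * n) := by noncomm_ring
  rw [e1, e2, hnn, ht] at h1
  simp only [zero_mul, mul_zero, add_zero, sub_zero, smul_mul_assoc] at h1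
  rw [ht, smul_smul] at h1
  have h2 : (2 * t ^ 2) • n = 0 := by
    have : (2 * t ^ 2) • n = (t * t) • n + (t * t) • n := by rw [← add_smul]; congr 1; ring
    rw [this]
    calc _ = (n * x * x * n + (t * t) • n) - (n * x * x * n - (t * t) • n) := by abel
      _ = 0 := by rw [← h1, sub_self]
  refine zsmul_kill hp hR (k := 2) (j := 2) ?_ h2
  intro h
  have := Int.natAbs_dvd_natAbs.2 h
  simp at this
  exact hp2 ((Nat.prime_dvd_prime_iff_eq hp Nat.prime_two).1 this)

lemma one_add_pow_sq_zero {m : R} (h : m * m = 0) (k : ℕ) : (1 + m) ^ k = 1 + k * m := by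
  induction k with
  | zero => simp
  | succ k ih =>
    rw [pow_succ, ih]
    have : (1 + (k:R) * m) * (1 + m) = 1 + m + k * m + k * (m * m) := by noncomm_ring
    rw [this, h]; push_cast; noncomm_ring

lemma ring_main (hp : p.Prime) (hp2 : p ≠ 2) (hR : (p : R) = 0) {α α' x y : R}
    (hα : α ^ p = 1) (h1 : α * α' = 1) (h3 : x * y = 1) (h4 : y * x = 1)
    (hs : ∀ z, ∃ t : ℤ, (α - 1) * z * (α - 1) = t • (α - 1))
    (hx : α * x * α' * x = x * (α * x * α')) (hy : α * y * α' * y = y * (α * y * α')) :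
    (α' * y * α * x) ^ p = 1 := by
  obtain ⟨n, hn⟩ : ∃ n, n = α - 1 := ⟨_, rfl⟩
  have ha : α = 1 + n := by rw [hn]; abel
  rw [← hn] at hs
  have hnn : n * n = 0 := ring_sq_zero hp hR (by rw [← ha]; exact hα) hs
  have ha' : α' = 1 - n := by
    have : (1 - n) * α = 1 := by
      rw [ha]; have : (1 - n) * (1 + n) = 1 - n * n := by noncomm_ring
      rw [this, hnn, sub_zero]
    calc α' = (1 - n) * α * α' := by rw [this, one_mul]
      _ = 1 - n := by rw [mul_assoc, h1, mul_one]
  have hnx : n * x * n = 0 := ring_ncn hp hp2 hR hnn hs (by rw [← ha, ← ha']; exact hx)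
  have hny : n * y * n = 0 := ring_ncn hp hp2 hR hnn hs (by rw [← ha, ← ha']; exact hy)
  have e : α' * y * α * x = 1 + (y * n * x - n) := by
    rw [ha, ha']
    have : (1 - n) * y * (1 + n) * x = y * x + y * n * x - n * (y * x) - n * y * n * x := by noncomm_ring
    rw [this, h4, hny]; simp; abel
  have hm : (y * n * x - n) * (y * n * x - n) = 0 := by
    have : (y * n * x - n) * (y * n * x - n)
      = y * n * (x * y) * n * x - y * (n * x * n) - n * y * n * x + n * n := by noncomm_ring
    rw [this, h3, hnx, hny, hnn, mul_one, mul_assoc y n n, hnn]; simp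
  rw [e, one_add_pow_sq_zero hm, hR, zero_mul, add_zero]
end ringlem

/-- noncyclic generation formula -/
lemma end_formula {R : Type*} [Ring R] {p : ℕ} (hp : p.Prime) {α β : R} (hc : Commute α β)
    (hβ : β ^ p = 1)
    (h1 : ∀ j, (α - 1) * ∑ i ∈ Finset.range p, (α * β ^ j) ^ i = 0)
    (h2 : (α - 1) * ∑ i ∈ Finset.range p, β ^ i = 0) : (α - 1) * (p : R) = 0 := by
  have h3 : ∑ j ∈ Finset.range p, (α - 1) * ∑ i ∈ Finset.range p, (α * β ^ j) ^ i = 0 :=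
    Finset.sum_eq_zero fun j _ => h1 j
  rw [← Finset.mul_sum, Finset.sum_comm] at h3
  obtain ⟨k, hk⟩ := Nat.exists_eq_succ_of_ne_zero hp.ne_zero
  have h4 : ∀ i ∈ Finset.range p, i ≠ 0 → (α - 1) * ∑ j ∈ Finset.range p, (α * β ^ j) ^ i = 0 := by
    intro i hi hi0
    have e : ∑ j ∈ Finset.range p, (α * β ^ j) ^ i = α ^ i * ∑ j ∈ Finset.range p, β ^ j := by
      rw [Finset.mul_sum]
      have hcop : Nat.Coprime p i := by
        rw [Nat.Prime.coprime_iff_not_dvd hp]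
        intro hd
        exact absurd (Nat.le_of_dvd (Nat.pos_of_ne_zero hi0) hd) (by simpa using hi)
      have h5 : ∀ j, (α * β ^ j) ^ i = α ^ i * β ^ ((i * j) % p) := by
        intro j
        rw [(hc.pow_right j).mul_pow, ← pow_mul, mul_comm j i]
        congr 1
        conv_lhs => rw [← Nat.div_add_mod (i * j) p, pow_add, pow_mul, hβ, one_pow, one_mul]
      simp_rw [h5]
      refine Finset.sum_nbij (fun j => (i * j) % p) ?_ ?_ ?_ ?_
      · intro j _; simp [Nat.mod_lt _ hp.pos]
      · intro a ha b hb hab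
        have ha' : a < p := by simpa using ha
        have hb' : b < p := by simpa using hb
        have : i * a ≡ i * b [MOD p] := hab
        have := Nat.ModEq.cancel_left_of_coprime (hcop) this
        exact Nat.ModEq.eq_of_lt_of_lt this ha' hb'
      · apply Finset.surjOn_of_injOn_of_card_le
        · intro j _; simp [Nat.mod_lt _ hp.pos]
        · intro a ha b hb hab
          have ha' : a < p := by simpa using ha
          have hb' : b < p := by simpa using hb
          have : i * a ≡ i * b [MOD p] := hab
          have := Nat.ModEq.cancel_left_of_coprime (hcop) this
          exact Nat.ModEq.eq_of_lt_of_lt this ha' hb'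
        · exact le_rfl
      · intro j _; rfl
    rw [e, ← mul_assoc]
    have : (α - 1) * α ^ i = α ^ i * (α - 1) := by
      rw [sub_mul, mul_sub, one_mul, mul_one, ← pow_succ, ← pow_succ']
    rw [this, mul_assoc, h2, mul_zero]
  rw [Finset.mul_sum] at h3
  rw [Finset.sum_eq_single_of_mem 0 (by simp [hp.pos]) h4] at h3
  simpa using h3

section ac
open scoped IsMulCommutative
variable {G : Type*} [Group G]

/-- the conjugation action of `g` on a commutative subgroup, as additive endomorphism -/
def acHom (M : Subgroup G) [IsMulCommutative M] {g : G} (h : g ∈ Nz M) : AddMonoid.End (Additive M) :=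
  AddMonoidHom.mk'
    (fun x : Additive M => Additive.ofMul (⟨g * (x.toMul : G) * g⁻¹, Nz_conj h x.toMul.2⟩ : M))
    (by intro x y; apply Additive.toMul.injective; ext; simp)

open Classical in
/-- the conjugation action, extended by `1` -/
noncomputable def ac (M : Subgroup G) [IsMulCommutative M] (g : G) : AddMonoid.End (Additive M) :=
  if h : g ∈ Nz M then acHom M h else 1

variable {M : Subgroup G} [IsMulCommutative M]

/-- coercion to the group -/
def val (x : Additive M) : G := (x.toMul : G)

lemma val_inj {x y : Additive M} (h : val x = val y) : x = y :=
  Additive.toMul.injective (Subtype.ext h)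
lemma val_mem (x : Additive M) : val x ∈ M := x.toMul.2
@[simp] lemma val_add (x y : Additive M) : val (x + y) = val x * val y := rfl
@[simp] lemma val_zero : val (0 : Additive M) = 1 := rfl
@[simp] lemma val_neg (x : Additive M) : val (-x) = (val x)⁻¹ := rfl
@[simp] lemma val_sub (x y : Additive M) : val (x - y) = val x * (val y)⁻¹ := by
  rw [sub_eq_add_neg]; rfl
@[simp] lemma val_nsmul (n : ℕ) (x : Additive M) : val (n • x) = val x ^ n := rfl
@[simp] lemma val_zsmul (n : ℤ) (x : Additive M) : val (n • x) = val x ^ n := rfl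
/-- element of `M` as element of the additive group -/
def mk {x : G} (hx : x ∈ M) : Additive M := Additive.ofMul ⟨x, hx⟩
@[simp] lemma val_mk {x : G} (hx : x ∈ M) : val (mk hx) = x := rfl

lemma val_ac {g : G} (h : g ∈ Nz M) (x : Additive M) : val (ac M g x) = g * val x * g⁻¹ := by
  unfold ac; rw [dif_pos h]; rfl

lemma ac_one : ac M 1 = 1 := by
  refine DFunLike.ext _ _ fun x => val_inj ?_; rw [val_ac (one_mem _)]; show _ = val x; simp

lemma ac_mul {g h : G} (hg : g ∈ Nz M) (hh : h ∈ Nz M) : ac M (g * h) = ac M g * ac M h := by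
  refine DFunLike.ext _ _ fun x => val_inj ?_
  rw [val_ac (mul_mem hg hh)]
  show _ = val (ac M g (ac M h x))
  rw [val_ac hg, val_ac hh]; simp [mul_assoc]

lemma ac_pow {g : G} (hg : g ∈ Nz M) (k : ℕ) : ac M (g ^ k) = ac M g ^ k := by
  induction k with
  | zero => simp [ac_one]
  | succ k ih => rw [pow_succ, ac_mul (pow_mem hg _) hg, ih, pow_succ]

lemma ac_eq_one {g : G} (h : ∀ x ∈ M, g * x = x * g) : ac M g = 1 := by
  have hg : g ∈ Nz M := by
    rw [mem_Nz]; ext x; rw [mem_cj]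
    constructor
    · intro hx
      have := h _ hx
      have e : x = g⁻¹ * x * g := by
        have h3 : x * g = g⁻¹ * x * g * g := by rw [← this]; group
        have := mul_right_cancel h3
        exact this
      rw [e]; exact hx
    · intro hx; rw [mul_assoc, ← h x hx]; simpa using hx
  refine DFunLike.ext _ _ fun x => val_inj ?_; rw [val_ac hg]
  show _ = val x
  rw [h _ (val_mem x)]; simp

lemma comm_of_ac_eq_one {g : G} (hg : g ∈ Nz M) (h : ac M g = 1) {x : G} (hx : x ∈ M) :
    g * x = x * g := by
  have h1 := val_ac hg (mk hx)
  rw [h] at h1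
  have h2 : x = g * x * g⁻¹ := h1
  nth_rw 2 [h2]; simp

end ac
end FrobGen

set_option linter.unusedSectionVars false
namespace FrobGen
open Subgroup

section A0
open scoped IsMulCommutative
variable {G Γ : Type*} [Group G] [Finite G] [Group Γ] {p : ℕ} [hp : Fact p.Prime]

lemma card_sup_zpowers_le {A0 : Subgroup G} {a : G} (h : ∀ x ∈ A0, x * a = a * x) (ha : a ^ p = 1) :
    Nat.card (A0 ⊔ zpowers a : Subgroup G) ≤ p * Nat.card A0 := by
  have hc : a ∈ Nz A0 := mem_Nz_of_le fun x hx => by rw [← h x hx]; simpa using hx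
  have hz : zpowers a ≤ Nz A0 := by rw [zpowers_le]; exact hc
  have : Finite (A0 × zpowers a) := inferInstance
  have h1 : Nat.card (A0 ⊔ zpowers a : Subgroup G) ≤ Nat.card (A0 × zpowers a) := by
    apply Nat.card_le_card_of_surjective
      (fun y : A0 × zpowers a => (⟨y.1 * y.2, mul_mem (mem_sup_left y.1.2) (mem_sup_right y.2.2)⟩ :
        (A0 ⊔ zpowers a : Subgroup G)))
    rintro ⟨x, hx⟩
    obtain ⟨u, hu, v, hv, rfl⟩ := (mem_sup_of_le_Nz hz).1 hx
    exact ⟨(⟨u, hu⟩, ⟨v, hv⟩), rfl⟩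
  refine h1.trans ?_
  rw [Nat.card_prod, mul_comm, Nat.card_zpowers]
  exact Nat.mul_le_mul_right _ (Nat.le_of_dvd hp.out.pos (orderOf_dvd_of_pow_eq_one ha))

lemma mem_of_pow_coprime {A : Subgroup G} {b : G} {k l : ℕ} (h1 : b ^ k ∈ A) (h2 : b ^ l ∈ A)
    (h : Nat.Coprime k l) : b ∈ A := by
  have e := Nat.gcd_eq_gcd_ab k l
  rw [Nat.Coprime.gcd_eq_one h] at e
  have : b = (b ^ k) ^ (Nat.gcdA k l) * (b ^ l) ^ (Nat.gcdB k l) := by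
    rw [← zpow_natCast, ← zpow_natCast, ← zpow_mul, ← zpow_mul, ← zpow_add, ← e]; simp
  rw [this]
  exact mul_mem (zpow_mem h1 _) (zpow_mem h2 _)

lemma exists_A0 (π : G →* Γ) {A : Subgroup G} {B : Subgroup Γ} (hA : IsEA p A)
    (hB : ∀ x ∈ B, ∀ y ∈ B, x * y = y * x) {m : ℕ} (hpm : ¬ p ∣ m) (hm : ∀ x ∈ B, x ^ m = 1)
    (hAB : ∀ a ∈ A, π a ∈ Nz B) {a1 : G} {b1 : Γ} (ha1 : a1 ∈ A) (hb1 : b1 ∈ B)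
    (h1 : π a1 * b1 ≠ b1 * π a1) :
    ∃ A0 ≤ A, ∃ a ∈ A, ∃ b ∈ B, (∀ x ∈ A0, π x * b = b * π x) ∧ π a * b ≠ b * π a ∧
      Nat.card A ≤ p * Nat.card A0 := by
  classical
  let S : Set (Subgroup G) := {A0 | A0 ≤ A ∧ ∃ a ∈ A, ∃ b ∈ B, (∀ x ∈ A0, π x * b = b * π x) ∧
    π a * b ≠ b * π a}
  have hS : S.Nonempty := ⟨⊥, bot_le, a1, ha1, b1, hb1, by simp, h1⟩
  obtain ⟨A0, ⟨hA0, a, ha, b, hb, hc, hab⟩, hmax⟩ :=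
    Set.exists_max_image S (fun X => Nat.card X) (Set.toFinite _) hS
  refine ⟨A0, hA0, a, ha, b, hb, hc, hab, ?_⟩
  by_contra hlt
  push Not at hlt
  have hcomm : ∀ x ∈ A, ∀ y ∈ A, x * y = y * x := hA.2
  have hpow : ∀ x ∈ A, x ^ p = 1 := hA.1
  have haA0 : a ∉ A0 := fun h => hab (hc a h)
  set A1 := A0 ⊔ zpowers a with hA1
  have hA1A : A1 ≤ A := sup_le hA0 (by rw [zpowers_le]; exact ha)
  have hcard := card_sup_zpowers_le (p := p) (A0 := A0) (a := a) (fun x hx => hcomm x (hA0 hx) a ha) (hpow a ha)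
  obtain ⟨β, hβ, hβ1⟩ : ∃ β ∈ A, β ∉ A1 := by
    by_contra! h
    have : A = A1 := le_antisymm h hA1A
    rw [this] at hlt; exact absurd hcard (not_le.2 hlt)
  -- maximality
  have key : ∀ y ∈ A, y ∉ A0 → ∀ c ∈ B, (∀ x ∈ A0, π x * c = c * π x) → π y * c = c * π y →
      π a * c = c * π a := by
    intro y hy hy0 c hcB hc0 hcy
    by_contra hne
    have hmem : A0 ⊔ zpowers y ∈ S := by
      refine ⟨sup_le hA0 (by rw [zpowers_le]; exact hy), a, ha, c, hcB, ?_, hne⟩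
      have : A0 ⊔ zpowers y ≤ (centralizer {c}).comap π := by
        refine sup_le (fun x hx => ?_) ?_
        · rw [mem_comap, mem_centralizer_singleton_iff]; exact (hc0 x hx)
        · rw [zpowers_le, mem_comap, mem_centralizer_singleton_iff]; exact hcy
      intro x hx
      have := this hx
      rw [mem_comap, mem_centralizer_singleton_iff] at this
      exact this
    have h2 : Nat.card (A0 ⊔ zpowers y : Subgroup G) ≤ Nat.card A0 := hmax _ hmem
    have h3 : A0 = A0 ⊔ zpowers y := Subgroup.eq_of_le_of_card_ge le_sup_left h2
    exact hy0 (by rw [h3]; exact mem_sup_right (mem_zpowers y))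
  let M : Subgroup Γ := B ⊓ centralizer (π '' A0)
  have hM : ∀ {c : Γ}, c ∈ M ↔ c ∈ B ∧ ∀ x ∈ A0, π x * c = c * π x := by
    intro c
    rw [mem_inf, mem_centralizer_iff]
    simp
  have hMc : IsMulCommutative M := ⟨⟨fun x y => Subtype.ext (hB _ (hM.1 x.2).1 _ (hM.1 y.2).1)⟩⟩
  have hN : ∀ y ∈ A, π y ∈ Nz M := by
    intro y hy
    refine Nz_inf_le _ _ ⟨hAB y hy, ?_⟩
    have : ∀ x ∈ A0, π x * π y = π y * π x := fun x hx => by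
      rw [← map_mul, ← map_mul, hcomm x (hA0 hx) y hy]
    show π y ∈ Nz _
    rw [mem_Nz]
    ext c
    rw [mem_cj, mem_centralizer_iff, mem_centralizer_iff]
    simp only [Set.forall_mem_image]
    refine forall₂_congr fun x hx => ?_
    have h5 := this x hx
    have h6 : π x * (π y)⁻¹ = (π y)⁻¹ * π x := (Commute.inv_right (show Commute (π x) (π y) from h5))
    rw [show π x * ((π y)⁻¹ * c * π y) = (π y)⁻¹ * (π x * c) * π y by rw [← mul_assoc, ← mul_assoc, h6]; group,
      show (π y)⁻¹ * c * π y * π x = (π y)⁻¹ * (c * π x) * π y by rw [mul_assoc _ (π y), ← h5]; group]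
    simp
  have hfix : ∀ y ∈ A, y ∉ A0 → ∀ x : Additive M, ac M (π y) x = x → ac M (π a) x = x := by
    intro y hy hy0 x hx
    apply val_inj
    have h2 := congrArg val hx
    rw [val_ac (hN y hy)] at h2
    rw [val_ac (hN a ha)]
    have h3 := hM.1 (val_mem x)
    have := key y hy hy0 (val x) h3.1 h3.2 (by nth_rw 2 [← h2]; simp)
    rw [this]; simp
  have hsum : ∀ y ∈ A, y ∉ A0 → (ac M (π a) - 1) * ∑ i ∈ Finset.range p, (ac M (π y)) ^ i = 0 := by
    intro y hy hy0
    have hg : ac M (π y) * ∑ i ∈ Finset.range p, (ac M (π y)) ^ i = ∑ i ∈ Finset.range p, (ac M (π y)) ^ i := by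
      have := mul_geom_sum (ac M (π y)) p
      rw [← ac_pow (hN y hy), ← map_pow, hpow y hy, map_one, ac_one, sub_self, sub_mul, one_mul] at this
      exact sub_eq_zero.1 this
    refine DFunLike.ext _ _ fun x => ?_
    have h2 := hfix y hy hy0 ((∑ i ∈ Finset.range p, (ac M (π y)) ^ i) x) (DFunLike.congr_fun hg x)
    show ac M (π a) ((∑ i ∈ Finset.range p, (ac M (π y)) ^ i) x) - (∑ i ∈ Finset.range p, (ac M (π y)) ^ i) x = 0
    rw [h2, sub_self]
  have hβ0 : β ∉ A0 := fun h => hβ1 (mem_sup_left h)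
  have hform := end_formula (R := AddMonoid.End (Additive M)) hp.out (α := ac M (π a)) (β := ac M (π β))
    (by
      show _ * _ = _ * _
      rw [← ac_mul (hN a ha) (hN β hβ), ← ac_mul (hN β hβ) (hN a ha), ← map_mul, ← map_mul, hcomm a ha β hβ])
    (by rw [← ac_pow (hN β hβ), ← map_pow, hpow β hβ, map_one, ac_one])
    (by
      intro j
      rw [← ac_pow (hN β hβ), ← ac_mul (hN a ha) (pow_mem (hN β hβ) _), ← map_pow, ← map_mul]
      apply hsum _ (mul_mem ha (pow_mem hβ _))
      intro hmem
      by_cases hj : p ∣ j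
      · obtain ⟨k, rfl⟩ := hj
        rw [pow_mul, hpow β hβ, one_pow, mul_one] at hmem
        exact haA0 hmem
      · have h3 : β ^ j ∈ A1 := by
          have : a⁻¹ * (a * β ^ j) ∈ A1 :=
            mul_mem (inv_mem (mem_sup_right (mem_zpowers a))) (mem_sup_left hmem)
          simpa using this
        exact hβ1 (mem_of_pow_coprime (k := p) (l := j) (by rw [hpow β hβ]; exact one_mem _) h3
          ((Nat.Prime.coprime_iff_not_dvd hp.out).2 hj)))
    (hsum β hβ hβ0)
  have hbM : b ∈ M := hM.2 ⟨hb, hc⟩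
  have h7 := DFunLike.congr_fun hform (mk hbM)
  have h8 : p • (ac M (π a) (mk hbM) - mk hbM) = 0 := by
    rw [smul_sub, ← map_nsmul]
    exact h7
  have h9 : m • (ac M (π a) (mk hbM) - mk hbM) = 0 := by
    apply val_inj
    rw [val_nsmul]
    exact hm _ (hM.1 (val_mem _)).1
  have h10 : ac M (π a) (mk hbM) - mk hbM = 0 := by
    have hcp := (Nat.Prime.coprime_iff_not_dvd hp.out).2 hpm
    have : addOrderOf (ac M (π a) (mk hbM) - mk hbM) ∣ Nat.gcd p m :=
      Nat.dvd_gcd (addOrderOf_dvd_of_nsmul_eq_zero h8) (addOrderOf_dvd_of_nsmul_eq_zero h9)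
    rw [hcp.gcd_eq_one, Nat.dvd_one, AddMonoid.addOrderOf_eq_one_iff] at this
    exact this
  have h11 := congrArg val (sub_eq_zero.1 h10)
  rw [val_ac (hN a ha), val_mk] at h11
  apply hab
  nth_rw 2 [← h11]; simp
end A0
end FrobGen

set_option linter.unusedSectionVars false
namespace FrobGen
open Subgroup

lemma scalar_lemma {M : Type*} [AddCommGroup M] [Finite M] {p : ℕ} (hp : p.Prime) (n : AddMonoid.End M)
    (hM : ∀ x : M, p • x = 0) (hc : Nat.card M ≤ p * Nat.card (AddMonoidHom.ker n)) (z : AddMonoid.End M) :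
    ∃ t : ℤ, n * z * n = t • n := by
  have hr : Nat.card (AddMonoidHom.range n) ≤ p := by
    have h1 : Nat.card (AddMonoidHom.ker n) * Nat.card (AddMonoidHom.range n) = Nat.card M := by
      have h2 := AddSubgroup.card_mul_index (AddMonoidHom.ker (n : M →+ M))
      have h3 : (AddMonoidHom.ker n).index = Nat.card (AddMonoidHom.range n) := AddSubgroup.index_ker (G := M) (G' := M) n
      exact h3 ▸ h2
    rw [← h1, mul_comm] at hc
    exact Nat.le_of_mul_le_mul_right hc Nat.card_pos
  by_cases hn : n = 0
  · exact ⟨0, by rw [hn]; simp⟩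
  obtain ⟨v, hv⟩ : ∃ v, n v ≠ 0 := by
    by_contra! h
    exact hn (DFunLike.ext _ _ h)
  have ho : addOrderOf (n v) = p := by
    have : Fact p.Prime := ⟨hp⟩
    exact addOrderOf_eq_prime (hM _) hv
  have he : AddSubgroup.zmultiples (n v) = AddMonoidHom.range n := by
    apply AddSubgroup.eq_of_le_of_card_ge
    · rw [AddSubgroup.zmultiples_le]; exact ⟨v, rfl⟩
    · rw [Nat.card_zmultiples, ho]; exact hr
  have hcyc : ∀ x, ∃ k : ℤ, n x = k • n v := by
    intro x
    have : n x ∈ AddSubgroup.zmultiples (n v) := by rw [he]; exact ⟨x, rfl⟩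
    obtain ⟨k, hk⟩ := this
    exact ⟨k, hk.symm⟩
  obtain ⟨t, ht⟩ := hcyc (z (n v))
  refine ⟨t, DFunLike.ext _ _ fun x => ?_⟩
  obtain ⟨k, hk⟩ := hcyc x
  show n (z (n x)) = t • n x
  rw [hk, map_zsmul, map_zsmul, ht, smul_comm]

section core
open scoped IsMulCommutative
variable {G : Type*} [Group G] [Finite G] {p : ℕ} [hp : Fact p.Prime]

lemma card_mul_relIndex' {A B : Subgroup G} (h : A ≤ B) : Nat.card A * A.relIndex B = Nat.card B := by
  have := Subgroup.card_mul_index (A.subgroupOf B)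
  rw [Nat.card_congr (Subgroup.subgroupOfEquivOfLe h).toEquiv] at this
  exact this

lemma mk_comm_iff {U : Subgroup G} [hU : U.Normal] {x y : G} :
    QuotientGroup.mk' U x * QuotientGroup.mk' U y = QuotientGroup.mk' U y * QuotientGroup.mk' U x ↔
      x * y * x⁻¹ * y⁻¹ ∈ U := by
  rw [← QuotientGroup.eq_one_iff (N := U)]
  show _ ↔ QuotientGroup.mk' U _ = 1
  rw [map_mul, map_mul, map_mul, map_inv, map_inv, mul_inv_eq_one, mul_inv_eq_iff_eq_mul]

theorem core_contra (hp2 : p ≠ 2) {U K P : Subgroup G} (hU : U.Normal) (hK : K.Normal) (hUK : U ≤ K)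
    (hP : IsSyl p P ⊤) (hUp : IsPGroup p U) {m : ℕ} (hpm : ¬ p ∣ m) (hm : ∀ x ∈ K, x ^ m ∈ U)
    (hab : ∀ a ∈ K, ∀ b ∈ K, a * b * a⁻¹ * b⁻¹ ∈ U) (hKP : K ⊔ P = ⊤)
    (hirr : ∀ R : Subgroup G, U ≤ R → R ≤ K → P ≤ Nz R → R = U ∨ R = K)
    (hCK : ∀ x ∈ K, (∀ u ∈ U, x * u = u * x) → x ∈ U)
    (hnorm : ∀ X : Subgroup G, X.Normal → IsPGroup p X → X ≤ U)
    (hJ : Nz (Jp p P) ≠ ⊤) (hZ : Nz (Zp p P) ≠ ⊤) : False := by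
  classical
  have hpp := hp.out
  have hcop : Nat.Coprime p m := (Nat.Prime.coprime_iff_not_dvd hpp).2 hpm
  have hUP : U ≤ P := by
    obtain ⟨x, -, hx⟩ := hP.conj_le hUp le_top
    rwa [cj_normal hU] at hx
  set π := QuotientGroup.mk' U with hπ
  have hcj : ∀ {N : Subgroup G}, N.Normal → ∀ g n, n ∈ N → g * n * g⁻¹ ∈ N := fun h g n hn => h.conj_mem n hn g
  have hcj' : ∀ {N : Subgroup G}, N.Normal → ∀ g n, n ∈ N → g⁻¹ * n * g ∈ N := fun h g n hn => by
    simpa using h.conj_mem n hn g⁻¹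
  let C' : Subgroup G := (centralizer (π '' K)).comap π
  have hC' : ∀ {x}, x ∈ C' ↔ ∀ k ∈ K, π k * π x = π x * π k := by
    intro x; rw [mem_comap, mem_centralizer_iff]; simp
  have hC'n : ∀ g, ∀ x ∈ C', g * x * g⁻¹ ∈ C' := by
    intro g x hx
    rw [hC'] at *
    intro k hk
    have := hx _ (hcj' hK g k hk)
    have h2 := congrArg (fun y => π g * y * (π g)⁻¹) this
    simp only [map_mul, map_inv] at h2 ⊢
    simpa [mul_assoc] using h2
  let X : Subgroup G := P ⊓ C'
  have hXU : X ≤ U := by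
    apply hnorm X _ (hP.2.1.to_inf_left)
    apply normal_of_le_Nz
    rw [← hKP]
    refine sup_le (fun k hk => mem_Nz_of_le ?_) (fun g hg => mem_Nz_of_le ?_)
    · rintro x ⟨hxP, hxC⟩
      refine ⟨?_, hC'n _ _ hxC⟩
      have h1 : k * x * k⁻¹ * x⁻¹ ∈ U := mk_comm_iff.1 (hC'.1 hxC k hk)
      have := P.mul_mem (hUP h1) hxP
      simpa using this
    · rintro x ⟨hxP, hxC⟩
      exact ⟨P.mul_mem (P.mul_mem hg hxP) (P.inv_mem hg), hC'n _ _ hxC⟩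
  set V := Zp p U with hV
  have hVn : V.Normal := by
    rw [← Nz_eq_top, ← top_le_iff, ← Nz_eq_top.2 hU]; exact Nz_le_Zp U
  have hVU : V ≤ U := Zp_le U
  have hVc : ∀ v ∈ V, ∀ u ∈ U, u * v = v * u := fun v hv => (mem_Zp.1 hv).2.2
  have hVV : ∀ v ∈ V, ∀ w ∈ V, v * w = w * v := fun v hv w hw => hVc w hw v (hVU hv)
  have hVp : ∀ v ∈ V, v ^ p = 1 := fun v hv => (mem_Zp.1 hv).2.1
  have hZV : Zp p P ≤ V := by
    intro z hz
    obtain ⟨hzP, hzp, hzc⟩ := mem_Zp.1 hz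
    have hzX : z ∈ X := by
      refine ⟨hzP, hC'.2 fun k hk => ?_⟩
      rw [eq_comm, mk_comm_iff]
      have hzU : z ∈ centralizer (U : Set G) := by
        rw [mem_centralizer_iff]; intro u hu; exact hzc u (hUP hu)
      have hkz : k * z⁻¹ * k⁻¹ ∈ centralizer (U : Set G) := by
        have : (centralizer (U : Set G)).Normal := inferInstance
        exact this.conj_mem _ (inv_mem hzU) k
      have hc := mul_mem hzU hkz
      refine hCK _ ?_ fun u hu => ?_
      · have := mul_mem (hcj hK z k hk) (inv_mem hk)
        exact this
      · rw [mem_centralizer_iff] at hc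
        have := hc u hu
        simpa [mul_assoc] using this.symm
    exact mem_Zp.2 ⟨hXU hzX, hzp, fun s hs => hzc s (hUP hs)⟩
  -- S9
  obtain ⟨A, hA, hAU⟩ : ∃ A, IsMaxEA p P A ∧ ¬ A ≤ U := by
    by_contra! h
    have hJU : Jp p P ≤ U := sSup_le h
    apply hJ
    rw [← Jp_eq_of_le hJU hUP, ← top_le_iff, ← Nz_eq_top.2 hU]
    exact Nz_le_Jp U
  obtain ⟨a1, ha1, ha1U⟩ := Set.not_subset.1 hAU
  have ha1C : a1 ∉ C' := fun h => ha1U (hXU ⟨hA.1 ha1, h⟩)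
  rw [hC'] at ha1C
  push Not at ha1C
  obtain ⟨k1, hk1, hak⟩ := ha1C
  obtain ⟨A0, hA0, a, ha, b', hb', hcA0, hab', hcard⟩ := exists_A0 (p := p) π (A := A) (B := K.map π) hA.2.1
    (by
      rintro _ ⟨x, hx, rfl⟩ _ ⟨y, hy, rfl⟩
      exact mk_comm_iff.2 (hab x hx y hy))
    hpm
    (by
      rintro _ ⟨x, hx, rfl⟩
      rw [← map_pow]
      exact (QuotientGroup.eq_one_iff (N := U) _).2 (hm x hx))
    (by
      intro a _
      rw [Nz_eq_top.2 (hK.map π (QuotientGroup.mk'_surjective U))]; trivial)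
    ha1 (mem_map_of_mem π hk1) (fun h => hak h.symm)
  obtain ⟨b, hb, rfl⟩ := hb'
  have hA0P : A0 ≤ P := hA0.trans hA.1
  have hAc : ∀ x ∈ A, ∀ y ∈ A, x * y = y * x := hA.2.1.2
  have hAp : ∀ x ∈ A, x ^ p = 1 := hA.2.1.1
  let N0 : Subgroup G := (centralizer (π '' A0)).comap π
  have hN0 : ∀ {g}, g ∈ N0 ↔ ∀ x ∈ A0, π x * π g = π g * π x := by
    intro x; rw [mem_comap, mem_centralizer_iff]; simp
  have haN : a ∈ N0 := hN0.2 fun x hx => by rw [← map_mul, ← map_mul, hAc x (hA0 hx) a ha]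
  have hbN : b ∈ N0 := hN0.2 hcA0
  have hUN : U ≤ N0 := fun u hu => hN0.2 fun x _ => by
    have : π u = 1 := (QuotientGroup.eq_one_iff (N := U) _).2 hu
    rw [this]; simp
  let V0 : Subgroup G := V ⊓ centralizer (A0 : Set G)
  have hV0 : ∀ {v}, v ∈ V0 ↔ v ∈ V ∧ ∀ x ∈ A0, x * v = v * x := by
    intro v; rw [mem_inf, mem_centralizer_iff]; rfl
  have : IsMulCommutative V0 := ⟨⟨fun x y => Subtype.ext (hVV _ (hV0.1 x.2).1 _ (hV0.1 y.2).1)⟩⟩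
  have hN0V : N0 ≤ Nz V0 := by
    intro g hg
    refine mem_Nz_of_le fun v hv => hV0.2 ⟨hcj hVn g v (hV0.1 hv).1, fun x hx => ?_⟩
    have h1 : π x⁻¹ * π g⁻¹ = π g⁻¹ * π x⁻¹ :=
      hN0.1 (inv_mem hg) x⁻¹ (inv_mem hx)
    have h2 := mk_comm_iff.1 h1
    simp only [inv_inv] at h2
    have h3 := hVc v (hV0.1 hv).1 _ h2
    have h4 := (hV0.1 hv).2 x hx
    calc x * (g * v * g⁻¹) = g * x * ((x⁻¹ * g⁻¹ * x * g) * v) * g⁻¹ := by group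
      _ = g * (x * v) * x⁻¹ * g⁻¹ * x := by rw [h3]; group
      _ = g * v * g⁻¹ * x := by rw [h4]; group
  have hacU : ∀ u ∈ U, ac V0 u = 1 := fun u hu => ac_eq_one fun v hv => hVc v (hV0.1 hv).1 u hu
  have haceq : ∀ g ∈ N0, ∀ h ∈ N0, g * h⁻¹ ∈ U → ac V0 g = ac V0 h := by
    intro g hg h hh hu
    have : g = (g * h⁻¹) * h := by group
    rw [this, ac_mul (hN0V (hUN hu)) (hN0V hh), hacU _ hu, one_mul]
  have hpz : ∀ x : Additive V0, p • x = 0 := by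
    intro x; apply val_inj; rw [val_nsmul]; exact hVp _ (hV0.1 (val_mem x)).1
  have hR : ((p : ℕ) : AddMonoid.End (Additive V0)) = 0 := by
    refine DFunLike.ext _ _ fun x => ?_
    exact hpz x
  -- index bound
  have hidx : Nat.card V0 ≤ p * Nat.card (A0 ⊓ V0 : Subgroup G) := by
    have hEA : IsEA p (A0 ⊔ V0) := by
      have hNz : V0 ≤ Nz A0 := fun v hv => mem_Nz_of_le fun x hx => by
        rw [← (hV0.1 hv).2 x hx]; simpa using hx
      refine ⟨fun x hx => ?_, fun x hx y hy => ?_⟩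
      · obtain ⟨c, hc, v, hv, rfl⟩ := (mem_sup_of_le_Nz hNz).1 hx
        rw [(show Commute c v from (hV0.1 hv).2 c hc).mul_pow, hAp c (hA0 hc), hVp v (hV0.1 hv).1, one_mul]
      · obtain ⟨c, hc, v, hv, rfl⟩ := (mem_sup_of_le_Nz hNz).1 hx
        obtain ⟨c', hc', v', hv', rfl⟩ := (mem_sup_of_le_Nz hNz).1 hy
        have e1 : Commute c c' := hAc c (hA0 hc) c' (hA0 hc')
        have e2 : Commute c v' := (hV0.1 hv').2 c hc
        have e3 : Commute c' v := (hV0.1 hv).2 c' hc'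
        have e4 : Commute v v' := hVV v (hV0.1 hv).1 v' (hV0.1 hv').1
        exact (e1.mul_right e2).mul_left (e3.symm.mul_right e4)
    have h1 := hA.2.2 _ (sup_le hA0P (inf_le_left.trans (hVU.trans hUP))) hEA
    have h2 : A0.relIndex V0 ≤ A0.relIndex (A0 ⊔ V0) :=
      Subgroup.relIndex_le_of_le_right le_sup_right (Subgroup.index_ne_zero_of_finite)
    have h3 : Nat.card A0 * A0.relIndex (A0 ⊔ V0) = Nat.card (A0 ⊔ V0 : Subgroup G) :=
      card_mul_relIndex' le_sup_left
    have h4 : Nat.card (A0 ⊓ V0 : Subgroup G) * A0.relIndex V0 = Nat.card V0 := by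
      rw [← Subgroup.inf_relIndex_right]; exact card_mul_relIndex' inf_le_right
    have h5 : A0.relIndex V0 ≤ p := by
      have : Nat.card A0 * A0.relIndex (A0 ⊔ V0) ≤ Nat.card A0 * p := by
        rw [h3, mul_comm]; exact h1.trans hcard
      exact h2.trans (Nat.le_of_mul_le_mul_left this Nat.card_pos)
    rw [← h4, mul_comm]
    exact Nat.mul_le_mul_right _ h5
  have hac1 : ∀ {g h}, g ∈ N0 → h ∈ N0 → ac V0 (g * h) = ac V0 g * ac V0 h :=
    fun hg hh => ac_mul (hN0V hg) (hN0V hh)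
  have hfin : Finite (Additive V0) := inferInstanceAs (Finite V0)
  have hs : ∀ z, ∃ t : ℤ, (ac V0 a - 1) * z * (ac V0 a - 1) = t • (ac V0 a - 1) := by
    apply scalar_lemma hpp _ hpz
    refine (show Nat.card (Additive V0) ≤ _ from hidx).trans (Nat.mul_le_mul_left _ ?_)
    apply Nat.card_le_card_of_injective (fun x : (A0 ⊓ V0 : Subgroup G) =>
      (⟨mk (M := V0) x.2.2, by
        rw [AddMonoidHom.mem_ker]
        show ac V0 a (mk x.2.2) - mk x.2.2 = 0
        rw [sub_eq_zero]
        apply val_inj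
        rw [val_ac (hN0V haN), val_mk, hAc a ha x (hA0 x.2.1)]; simp⟩ :
        AddMonoidHom.ker (ac V0 a - 1)))
    intro x y hxy
    have := congrArg (fun z => val z.1) hxy
    exact Subtype.ext this
  have hcomm2 : ∀ c ∈ K, c ∈ N0 → ac V0 a * ac V0 c * ac V0 a⁻¹ * ac V0 c
      = ac V0 c * (ac V0 a * ac V0 c * ac V0 a⁻¹) := by
    intro c hc hcN
    have haN' := inv_mem haN
    rw [← hac1 haN hcN, ← hac1 (mul_mem haN hcN) haN', ← hac1 (mul_mem (mul_mem haN hcN) haN') hcN,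
      ← hac1 hcN (mul_mem (mul_mem haN hcN) haN')]
    apply haceq _ (mul_mem (mul_mem (mul_mem haN hcN) haN') hcN) _ (mul_mem hcN (mul_mem (mul_mem haN hcN) haN'))
    have := hab (a * c * a⁻¹) (hcj hK a c hc) c hc
    simpa [mul_assoc] using this
  have haN' := inv_mem haN
  have hbN' := inv_mem hbN
  have hone : ∀ g ∈ N0, ac V0 g * ac V0 g⁻¹ = 1 := fun g hg => by
    rw [← hac1 hg (inv_mem hg), mul_inv_cancel, ac_one]
  have hone' : ∀ g ∈ N0, ac V0 g⁻¹ * ac V0 g = 1 := fun g hg => by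
    rw [← hac1 (inv_mem hg) hg, inv_mul_cancel, ac_one]
  have hmain := ring_main hpp hp2 hR (α := ac V0 a) (α' := ac V0 a⁻¹) (x := ac V0 b) (y := ac V0 b⁻¹)
    (by rw [← ac_pow (hN0V haN), hAp a ha, ac_one]) (hone a haN) (hone b hbN) (hone' b hbN) hs
    (hcomm2 b hb hbN) (hcomm2 b⁻¹ (inv_mem hb) hbN')
  rw [← hac1 haN' hbN', ← hac1 (mul_mem haN' hbN') haN, ← hac1 (mul_mem (mul_mem haN' hbN') haN) hbN] at hmain
  set d := a⁻¹ * b⁻¹ * a * b with hd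
  have hdN : d ∈ N0 := mul_mem (mul_mem (mul_mem haN' hbN') haN) hbN
  have hdK : d ∈ K := by
    have := mul_mem (hcj' hK a _ (inv_mem hb)) hb
    exact this
  have hdU : d ∉ U := by
    intro h
    apply hab'
    have h2 : π d = 1 := (QuotientGroup.eq_one_iff (N := U) _).2 h
    rw [hd, map_mul, map_mul, map_mul, map_inv, map_inv] at h2
    calc π a * π b = π b * π a * ((π a)⁻¹ * (π b)⁻¹ * π a * π b) := by group
      _ = π b * π a := by rw [h2, mul_one]
  have hd1 : ac V0 d = 1 := by
    have h2 : ac V0 d ^ m = 1 := by rw [← ac_pow (hN0V hdN), hacU _ (hm d hdK)]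
    have := pow_gcd_eq_one.2 ⟨hmain, h2⟩
    rwa [hcop.gcd_eq_one, pow_one] at this
  -- S14
  have hdV : ∀ v ∈ V, d * v = v * d := by
    let φ : V →* G := MonoidHom.mk' (fun v => d * v * d⁻¹ * (v : G)⁻¹) (by
      rintro ⟨v, hv⟩ ⟨w, hw⟩
      show d * (v * w) * d⁻¹ * (v * w)⁻¹ = d * v * d⁻¹ * v⁻¹ * (d * w * d⁻¹ * w⁻¹)
      have h1 : v⁻¹ * (d * w * d⁻¹) = (d * w * d⁻¹) * v⁻¹ :=
        hVV _ (inv_mem hv) _ (hcj hVn d w hw)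
      have h2 : v⁻¹ * w⁻¹ = w⁻¹ * v⁻¹ := hVV _ (inv_mem hv) _ (inv_mem hw)
      calc _ = d * v * d⁻¹ * (d * w * d⁻¹) * (w⁻¹ * v⁻¹) := by group
        _ = d * v * d⁻¹ * ((d * w * d⁻¹) * v⁻¹) * w⁻¹ := by rw [← h2]; group
        _ = _ := by rw [← h1]; group)
    have hW : ∀ {w}, w ∈ φ.range ↔ ∃ v ∈ V, d * v * d⁻¹ * v⁻¹ = w := by
      intro w
      constructor
      · rintro ⟨v, rfl⟩; exact ⟨v, v.2, rfl⟩
      · rintro ⟨v, hv, rfl⟩; exact ⟨⟨v, hv⟩, rfl⟩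
    have hWV : φ.range ≤ V := by
      intro w hw
      obtain ⟨v, hv, rfl⟩ := hW.1 hw
      exact mul_mem (hcj hVn d v hv) (inv_mem hv)
    have hA0W : A0 ≤ Nz φ.range := by
      intro x hx
      refine mem_Nz_of_le fun w hw => ?_
      obtain ⟨v, hv, rfl⟩ := hW.1 hw
      have h1 := mk_comm_iff.1 (hN0.1 hdN x hx)
      refine hW.2 ⟨x * v * x⁻¹, hcj hVn x v hv, ?_⟩
      have h2 : d⁻¹ * (x * d * x⁻¹ * d⁻¹) * d ∈ U := hcj' hU d _ h1
      have h3 := hVc _ (hcj hVn x v hv) _ h2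
      symm
      calc x * (d * v * d⁻¹ * v⁻¹) * x⁻¹
          = d * ((d⁻¹ * (x * d * x⁻¹ * d⁻¹) * d) * (x * v * x⁻¹)) * (d⁻¹ * (x * d * x⁻¹ * d⁻¹) * d)⁻¹ * d⁻¹ * (x * v * x⁻¹)⁻¹ := by group
        _ = d * (x * v * x⁻¹) * d⁻¹ * (x * v * x⁻¹)⁻¹ := by rw [h3]; group
    by_contra hne
    push Not at hne
    obtain ⟨v0, hv0, hv0d⟩ := hne
    have hWne : φ.range ≠ ⊥ := by
      intro h
      have : d * v0 * d⁻¹ * v0⁻¹ ∈ φ.range := hW.2 ⟨v0, hv0, rfl⟩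
      rw [h, mem_bot, mul_inv_eq_one, mul_inv_eq_iff_eq_mul] at this
      exact hv0d this
    have hWp : IsPGroup p φ.range := hUp.to_le (hWV.trans hVU)
    obtain ⟨w, hw, hw1, hwc⟩ := exists_fixed (hP.2.1.to_le hA0P) (pGroup_dvd hWp hWne) hA0W
    have hwV0 : w ∈ V0 := hV0.2 ⟨hWV hw, fun x hx => hwc x hx⟩
    have hdw : d * w = w * d := comm_of_ac_eq_one (hN0V hdN) hd1 hwV0
    obtain ⟨v, hv, hvw⟩ := hW.1 hw
    have h1 : d * v = w * v * d := by rw [← hvw]; group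
    have h2 : ∀ j : ℕ, d ^ j * v = w ^ j * v * d ^ j := by
      intro j
      induction j with
      | zero => simp
      | succ j ih =>
        have hc : Commute d (w ^ j) := (show Commute d w from hdw).pow_right j
        calc d ^ (j + 1) * v = d * (d ^ j * v) := by rw [pow_succ']; group
          _ = (d * w ^ j) * v * d ^ j := by rw [ih]; group
          _ = w ^ j * (d * v) * d ^ j := by rw [hc.eq]; group
          _ = w ^ (j + 1) * v * d ^ (j + 1) := by rw [h1, pow_succ, pow_succ']; group
    have h3 := h2 m
    rw [hVc v hv _ (hm d hdK)] at h3
    have h4 : w ^ m = 1 := by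
      have := mul_right_cancel h3
      exact (mul_eq_right.1 this.symm)
    have h5 := pow_gcd_eq_one.2 ⟨hVp w (hWV hw), h4⟩
    rw [hcop.gcd_eq_one, pow_one] at h5
    exact hw1 h5
  let R : Subgroup G := K ⊓ centralizer (V : Set G)
  have hRK : R = K := by
    rcases hirr R (fun u hu => ⟨hUK hu, by
        show u ∈ centralizer (V : Set G)
        rw [mem_centralizer_iff]; intro v hv; exact (hVc v hv u hu).symm⟩) inf_le_left
      (by
        have h1 : (centralizer (V : Set G)).Normal := inferInstance
        refine le_trans ?_ (Nz_inf_le _ _)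
        rw [Nz_eq_top.2 hK, Nz_eq_top.2 h1]; simp) with h | h
    · exfalso
      apply hdU
      rw [← h]
      refine ⟨hdK, ?_⟩
      show d ∈ centralizer (V : Set G)
      rw [mem_centralizer_iff]; intro v hv; exact (hdV v hv).symm
    · exact h
  apply hZ
  rw [← top_le_iff, ← hKP]
  refine sup_le ?_ ((le_Nz P).trans (Nz_le_Zp P))
  intro k hk
  refine mem_Nz_of_le fun z hz => ?_
  have : k ∈ centralizer (V : Set G) := by rw [← hRK] at hk; exact hk.2
  rw [mem_centralizer_iff] at this
  rw [← this z (hZV hz)]; simpa using hz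
end core
end FrobGen

set_option linter.unusedSectionVars false
namespace FrobGen
open Subgroup
universe u

section
variable {G : Type u} [Group G] [Finite G] {p : ℕ} [hp : Fact p.Prime]

/-- Thompson subgroup or `Ω₁(Z)` -/
def Wp (b : Bool) (p : ℕ) (S : Subgroup G) : Subgroup G := match b with
  | true => Jp p S
  | false => Zp p S

lemma Wp_le (b : Bool) (S : Subgroup G) : Wp b p S ≤ S := by
  cases b
  · exact Zp_le S
  · exact Jp_le S

lemma Wp_ne_bot (b : Bool) {S : Subgroup G} (hS : IsPGroup p S) (h : S ≠ ⊥) : Wp b p S ≠ ⊥ := by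
  cases b
  · exact Zp_ne_bot hS h
  · exact Jp_ne_bot hS h

lemma Wp_map (b : Bool) {G' : Type*} [Group G'] [Finite G'] {S : Subgroup G} {f : G →* G'}
    (hf : ∀ x ∈ S, f x = 1 → x = 1) : Wp b p (S.map f) = (Wp b p S).map f := by
  cases b
  · exact Zp_map hf
  · exact Jp_map hf

lemma Wp_cj (b : Bool) (g : G) (S : Subgroup G) : Wp b p (cj g S) = cj g (Wp b p S) := by
  cases b
  · exact Zp_cj g S
  · exact Jp_cj g S

lemma Nz_le_Wp (b : Bool) (S : Subgroup G) : Nz S ≤ Nz (Wp b p S) := by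
  cases b
  · exact Nz_le_Zp S
  · exact Nz_le_Jp S

def HypT (p : ℕ) (X : Subgroup G) : Prop :=
  ∀ P, IsSyl p P X → ∀ b, PN p (Nz (Wp b p P) ⊓ X)

lemma HypT.of_one {P X : Subgroup G} (hP : IsSyl p P X) (h : ∀ b, PN p (Nz (Wp b p P) ⊓ X)) :
    HypT p X := by
  intro Q hQ b
  obtain ⟨x, hx, rfl⟩ := hP.conj hQ
  have := (h b).map (MulAut.conj x).toMonoidHom
  have e : Nz (Wp b p (cj x P)) ⊓ X = cj x (Nz (Wp b p P) ⊓ X) := by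
    rw [Wp_cj, Nz_cj, cj_inf, cj_eq_of_mem hx]
  rw [e]; exact this

lemma HypT.sub {X : Subgroup G} (h : HypT p X) : HypT p (⊤ : Subgroup X) := by
  intro P hP b
  have h1 := hP.map X.subtype
  rw [map_top_subtype] at h1
  have h2 := h _ h1 b
  apply PN.of_map_inj X.subtype_injective
  refine h2.mono ?_
  refine le_inf ?_ (Subgroup.map_subtype_le _)
  rw [Wp_map b (fun x _ hx => X.subtype_injective (by simpa using hx))]
  exact Nz_map_le _ inf_le_left

lemma PN.of_sub {X : Subgroup G} (h : PN p (⊤ : Subgroup X)) : PN p X := by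
  have := h.map X.subtype
  rwa [map_top_subtype] at this

lemma T_S12 (hIH : ∀ X : Subgroup G, X ≠ ⊤ → HypT p X → PN p X) (hT : HypT p (⊤ : Subgroup G))
    (hn : ¬ PN p (⊤ : Subgroup G)) : ∃ U : Subgroup G, U.Normal ∧ IsPGroup p U ∧ U ≠ ⊥ ∧
      ∀ X P : Subgroup G, IsPGroup p X → Nat.card U < Nat.card X → IsSyl p P ⊤ → P ≤ Nz X → PN p (Nz X) := by
  set v : Subgroup G → ℕ := fun D => (Nat.card (Nz D)).factorization p with hv
  have hne : {D : Subgroup G | IsPGroup p D ∧ D ≠ ⊥ ∧ ¬ PN p (Nz D)}.Nonempty := by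
    by_contra hc
    apply hn
    apply frobenius_pn
    intro D h1 h2
    by_contra h3
    exact hc ⟨D, h1, h2, h3⟩
  obtain ⟨U, ⟨hU1, hU2, hU3⟩, hmax⟩ := Set.exists_max_image _
    (fun D => v D * (Nat.card G + 1) + Nat.card D) (Set.toFinite _) hne
  have hbig : ∀ D : Subgroup G, Nat.card D ≤ Nat.card G := fun D => Subgroup.card_le_card_group D
  have key1 : ∀ X : Subgroup G, IsPGroup p X → X ≠ ⊥ → v U < v X → PN p (Nz X) := by
    intro X h1 h2 h3
    by_contra h4
    have h6 : v X * (Nat.card G + 1) + Nat.card X ≤ v U * (Nat.card G + 1) + Nat.card U := hmax X ⟨h1, h2, h4⟩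
    have h5 : (v U + 1) * (Nat.card G + 1) ≤ v X * (Nat.card G + 1) := Nat.mul_le_mul_right _ h3
    have := hbig U
    nlinarith
  have key2 : ∀ X : Subgroup G, IsPGroup p X → X ≠ ⊥ → v U ≤ v X → Nat.card U < Nat.card X → PN p (Nz X) := by
    intro X h1 h2 h3 h3'
    by_contra h4
    have h6 : v X * (Nat.card G + 1) + Nat.card X ≤ v U * (Nat.card G + 1) + Nat.card U := hmax X ⟨h1, h2, h4⟩
    have h5 : (v U) * (Nat.card G + 1) ≤ v X * (Nat.card G + 1) := Nat.mul_le_mul_right _ h3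
    omega
  have hUtop : Nz U = ⊤ := by
    by_contra hN
    apply hU3
    apply hIH _ hN
    obtain ⟨S, hS⟩ := exists_isSyl p (Nz U)
    have hSne : S ≠ ⊥ := hS.ne_bot ((pGroup_dvd hU1 hU2).trans (Subgroup.card_dvd_of_le (le_Nz U)))
    apply HypT.of_one hS
    intro b
    obtain ⟨P, hP, hSP⟩ := exists_isSyl_ge hS.2.1 (le_top : S ≤ ⊤)
    rcases hSP.eq_or_lt with e | hlt
    · subst e
      exact (hT S hP b).mono (inf_le_inf_left _ le_top)
    · refine PN.mono ?_ (inf_le_left)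
      have h1 := lt_Nz_of_lt hP.2.1 hlt
      apply key1 _ (hS.2.1.to_le (Wp_le b S)) (Wp_ne_bot b hS.2.1 hSne)
      have h2 : Nat.card (Nz S ⊓ P : Subgroup G) ≤ p ^ v (Wp b p S) :=
        card_pGroup_le hP.2.1.to_inf_right (inf_le_left.trans (Nz_le_Wp b S))
      have h3 : Nat.card S < Nat.card (Nz S ⊓ P : Subgroup G) := by
        by_contra h4
        exact h1.ne (Subgroup.eq_of_le_of_card_ge h1.le (not_lt.1 h4))
      rw [hS.card] at h3
      exact (Nat.pow_lt_pow_iff_right hp.out.one_lt).1 (h3.trans_le h2)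
  refine ⟨U, Nz_eq_top.1 hUtop, hU1, hU2, fun X P hX hc hP hPX => ?_⟩
  apply key2 X hX _ _ hc
  · rintro rfl
    rw [Subgroup.card_bot] at hc
    have := Nat.card_pos (α := U)
    omega
  · have h1 := card_pGroup_le hP.2.1 hPX
    rw [hP.card] at h1
    have := (Nat.pow_le_pow_iff_right hp.out.one_lt).1 h1
    simp only [hv]
    rwa [hUtop]
end
end FrobGen

set_option linter.unusedSectionVars false
namespace FrobGen
open Subgroup
universe u

section
variable {G : Type u} [Group G] [Finite G] {p : ℕ} [hp : Fact p.Prime]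

lemma card_quot_lt {U : Subgroup G} (h : U ≠ ⊥) : Nat.card (G ⧸ U) < Nat.card G := by
  rw [Subgroup.card_eq_card_quotient_mul_card_subgroup U]
  have h1 : 1 < Nat.card U := by
    by_contra h2
    have := Nat.card_pos (α := U)
    exact h (Subgroup.card_eq_one.1 (by omega))
  have := Nat.card_pos (α := G ⧸ U)
  nlinarith

lemma card_sub_lt {X : Subgroup G} (h : X ≠ ⊤) : Nat.card X < Nat.card G := by
  by_contra h1
  exact h (Subgroup.eq_top_of_card_eq X (le_antisymm (Subgroup.card_le_card_group X) (not_lt.1 h1)))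

lemma mk_surj (U : Subgroup G) [U.Normal] : Function.Surjective (QuotientGroup.mk' U) :=
  QuotientGroup.mk'_surjective U

lemma map_top_mk (U : Subgroup G) [U.Normal] : (⊤ : Subgroup G).map (QuotientGroup.mk' U) = ⊤ :=
  Subgroup.map_top_of_surjective _ (mk_surj U)

lemma pn_of_not_dvd {X : Subgroup G} (h : ¬ p ∣ Nat.card X) : PN p X :=
  ⟨X, le_rfl, le_Nz X, h, fun x hx => ⟨0, by simpa using hx⟩⟩

lemma mem_Nz_comap {G' : Type*} [Group G'] [Finite G'] {f : G →* G'} {B : Subgroup G'} {g : G}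
    (h : f g ∈ Nz B) : g ∈ Nz (B.comap f) := by
  apply mem_Nz_of_le
  intro x hx
  rw [Subgroup.mem_comap, map_mul, map_mul, map_inv]
  exact Nz_conj h hx

lemma T_S4 (hIHq : ∀ (G' : Type u) [Group G'] [Finite G'], Nat.card G' < Nat.card G →
      HypT p (⊤ : Subgroup G') → PN p (⊤ : Subgroup G')) {U : Subgroup G} [hU : U.Normal]
    (hUp : IsPGroup p U) (hUne : U ≠ ⊥)
    (hbig : ∀ X P : Subgroup G, IsPGroup p X → Nat.card U < Nat.card X → IsSyl p P ⊤ → P ≤ Nz X → PN p (Nz X)) :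
    PN p (⊤ : Subgroup (G ⧸ U)) := by
  apply hIHq _ (card_quot_lt hUne)
  set π := QuotientGroup.mk' U with hπ
  obtain ⟨P, hP⟩ := exists_isSyl p (⊤ : Subgroup G)
  have hP' := hP.map π
  rw [map_top_mk] at hP'
  apply HypT.of_one hP'
  intro b
  by_cases hb : P.map π = ⊥
  · rw [hb] at hP'
    exact (pn_of_not_dvd (not_dvd_of_isSyl_bot hP')).mono le_top
  set B := Wp b p (P.map π) with hB
  have hBne : B ≠ ⊥ := Wp_ne_bot b hP'.2.1 hb
  have hBp : IsPGroup p B := hP'.2.1.to_le (Wp_le b _)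
  have hker : π.ker = U := QuotientGroup.ker_mk' U
  have hXp : IsPGroup p (B.comap π) := hBp.comap_of_ker_isPGroup π (by rw [hker]; exact hUp)
  have hUX : U ≤ B.comap π := by
    exact hker.ge.trans (Subgroup.ker_le_comap π B)
  have hmc : (B.comap π).map π = B := Subgroup.map_comap_eq_self_of_surjective (mk_surj U) B
  have hc : Nat.card U < Nat.card (B.comap π) := by
    by_contra hc
    have : U = B.comap π := Subgroup.eq_of_le_of_card_ge hUX (not_lt.1 hc)
    apply hBne
    rw [← hmc, ← this]
    exact QuotientGroup.map_mk'_self U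
  have hPX : P ≤ Nz (B.comap π) := by
    intro x hx
    apply mem_Nz_comap
    exact Nz_le_Wp b _ (le_Nz _ (Subgroup.mem_map_of_mem π hx))
  have h1 := (hbig _ P hXp hc hP hPX).map π
  refine h1.mono ?_
  rintro x ⟨hx, -⟩
  obtain ⟨g, rfl⟩ := mk_surj U x
  exact Subgroup.mem_map_of_mem π (mem_Nz_comap hx)

/-- normalizers of images of `p`-subgroups modulo prime-to-p subgroups -/
lemma Nz_map_coprime {E R : Subgroup G} [hE : E.Normal] (hEp : ¬ p ∣ Nat.card E) (hR : IsPGroup p R) :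
    Nz (R.map (QuotientGroup.mk' E)) ≤ (Nz R).map (QuotientGroup.mk' E) := by
  intro y hy
  obtain ⟨g, rfl⟩ := mk_surj E y
  have hRE : R ≤ Nz E := by rw [Nz_eq_top.2 hE]; exact le_top
  have hcj : cj g R ≤ E ⊔ R := by
    have h1 := mem_Nz_comap hy
    rw [Subgroup.comap_map_eq, QuotientGroup.ker_mk', sup_comm] at h1
    have h2 := mem_Nz.1 h1
    rw [← h2]; exact cj_mono le_sup_right
  have hsyl : IsSyl p R (E ⊔ R) := by
    obtain ⟨R', hR', hle⟩ := exists_isSyl_ge hR (le_sup_right : R ≤ E ⊔ R)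
    have : R' ≤ R := by
      intro x hx
      obtain ⟨e, he, r, hr, rfl⟩ := (mem_sup_of_le_Nz hRE).1 (hR'.1 hx)
      have h3 : e ∈ R' ⊓ E := by
        refine ⟨?_, he⟩
        have := R'.mul_mem hx (R'.inv_mem (hle hr))
        simpa using this
      rw [inf_eq_bot_of_coprime hR'.2.1 hEp] at h3
      rw [Subgroup.mem_bot.1 h3, one_mul]; exact hr
    rwa [le_antisymm this hle] at hR'
  have hsyl' : IsSyl p (cj g R) (E ⊔ R) :=
    isSyl_of_card hcj (isPGroup_cj g hR) (by rw [card_cj, hsyl.card])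
  obtain ⟨x, hx, e⟩ := hsyl'.conj hsyl
  obtain ⟨a, ha, r, hr, hxa⟩ := (mem_sup_of_le_Nz hRE).1 (Subgroup.inv_mem _ hx)
  refine ⟨a⁻¹ * g, ?_, ?_⟩
  · change a⁻¹ * g ∈ Nz R
    rw [mem_Nz, cj_mul]
    have hx2 : a⁻¹ = r * x := by
      rw [← inv_inv x, hxa]; group
    rw [hx2, cj_mul, e, cj_eq_of_mem hr]
  · have : QuotientGroup.mk' E a⁻¹ = 1 := by
      rw [← MonoidHom.mem_ker, QuotientGroup.ker_mk']; exact E.inv_mem ha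
    rw [map_mul, this, one_mul]

lemma T_S5 (hIHq : ∀ (G' : Type u) [Group G'] [Finite G'], Nat.card G' < Nat.card G →
      HypT p (⊤ : Subgroup G') → PN p (⊤ : Subgroup G')) (hT : HypT p (⊤ : Subgroup G))
    (hn : ¬ PN p (⊤ : Subgroup G)) {E : Subgroup G} (hE : E.Normal) (hEp : ¬ p ∣ Nat.card E) : E = ⊥ := by
  by_contra hne
  apply hn
  set π := QuotientGroup.mk' E with hπ
  have hker : π.ker = E := QuotientGroup.ker_mk' E
  refine PN.of_map π ?_ ?_
  swap
  · intro hd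
    rw [hker, inf_top_eq] at hd
    exact hEp hd
  rw [map_top_mk]
  apply hIHq _ (card_quot_lt hne)
  obtain ⟨P, hP⟩ := exists_isSyl p (⊤ : Subgroup G)
  have hP' := hP.map π
  rw [map_top_mk] at hP'
  apply HypT.of_one hP'
  intro b
  rw [Wp_map b]
  · refine ((hT P hP b).map π).mono ?_
    rw [inf_top_eq, inf_top_eq]
    exact Nz_map_coprime hEp (hP.2.1.to_le (Wp_le b P))
  · intro x hx h1
    have h2 : x ∈ P ⊓ E := ⟨hx, by rw [← hker]; exact h1⟩
    rw [inf_eq_bot_of_coprime hP.2.1 hEp] at h2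
    exact Subgroup.mem_bot.1 h2

end
end FrobGen

set_option linter.unusedSectionVars false
namespace FrobGen
open Subgroup
universe u

section
variable {G : Type u} [Group G] [Finite G] {p : ℕ} [hp : Fact p.Prime]

lemma le_Nz_normal {N X : Subgroup G} (h : N.Normal) : X ≤ Nz N := by
  rw [Nz_eq_top.2 h]; exact le_top

lemma isPGroup_of_pow {X : Subgroup G} (h : ∀ x ∈ X, ∃ k : ℕ, x ^ (p ^ k) = 1) : IsPGroup p X := by
  intro x
  obtain ⟨k, hk⟩ := h x x.2
  exact ⟨k, Subtype.ext (by simpa using hk)⟩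

lemma pow_of_isPGroup {X : Subgroup G} (h : IsPGroup p X) {x : G} (hx : x ∈ X) : ∃ k : ℕ, x ^ (p ^ k) = 1 := by
  obtain ⟨k, hk⟩ := h ⟨x, hx⟩
  exact ⟨k, by simpa [Subtype.ext_iff] using hk⟩

lemma pow_card_mem {G : Type*} [Group G] {X : Subgroup G} {x : G} (hx : x ∈ X) : x ^ Nat.card X = 1 := by
  have h1 : (⟨x, hx⟩ : X) ^ Nat.card X = 1 := pow_card_eq_one'
  exact congrArg Subtype.val h1

theorem T_step (hp2 : p ≠ 2) (hIHq : ∀ (G' : Type u) [Group G'] [Finite G'], Nat.card G' < Nat.card G →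
      HypT p (⊤ : Subgroup G') → PN p (⊤ : Subgroup G')) (hT : HypT p (⊤ : Subgroup G)) :
    PN p (⊤ : Subgroup G) := by
  by_contra hn
  have hIH : ∀ X : Subgroup G, X ≠ ⊤ → HypT p X → PN p X := fun X hX h =>
    PN.of_sub (hIHq X (card_sub_lt hX) h.sub)
  obtain ⟨U, hU, hUp, hUne, hbig⟩ := T_S12 hIH hT hn
  have hquot := T_S4 hIHq hUp hUne hbig
  have hE : ∀ E : Subgroup G, E.Normal → ¬ p ∣ Nat.card E → E = ⊥ := fun E h1 h2 => T_S5 hIHq hT hn h1 h2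
  obtain ⟨P, hP⟩ := exists_isSyl p (⊤ : Subgroup G)
  have hnorm : ∀ X : Subgroup G, X.Normal → IsPGroup p X → X ≤ U := by
    intro X hX hXp
    have h1 : IsPGroup p (X ⊔ U : Subgroup G) := hXp.to_sup_of_normal_right hUp
    by_contra hXU
    have h2 : Nat.card U < Nat.card (X ⊔ U : Subgroup G) := by
      by_contra h3
      have h4 := Subgroup.eq_of_le_of_card_ge (le_sup_right : U ≤ X ⊔ U) (not_lt.1 h3)
      exact hXU (le_sup_left.trans h4.ge)
    have h3 : (X ⊔ U).Normal := inferInstance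
    have h4 := hbig _ P h1 h2 hP (le_Nz_normal h3)
    rw [Nz_eq_top.2 h3] at h4
    exact hn h4
  obtain ⟨N, -, hN2, hN3, hN4⟩ := hquot
  set π := QuotientGroup.mk' U with hπ
  have hker : π.ker = U := QuotientGroup.ker_mk' U
  have hNn : N.Normal := normal_of_le_Nz hN2
  set K := N.comap π with hKdef
  have hK : K.Normal := inferInstance
  have hUK : U ≤ K := hker.ge.trans (Subgroup.ker_le_comap π N)
  have hm : ∀ x ∈ K, x ^ Nat.card N ∈ U := by
    intro x hx
    refine hker.le ?_
    rw [MonoidHom.mem_ker, map_pow]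
    exact pow_card_mem (show π x ∈ N from hx)
  have hpc : ∀ k, Nat.Coprime (Nat.card N) (p ^ k) := fun k =>
    Nat.Coprime.pow_right _ ((Nat.Prime.coprime_iff_not_dvd hp.out).2 hN3).symm
  have hKpow : ∀ x : G, ∃ k : ℕ, x ^ (p ^ k) ∈ K := by
    intro x
    obtain ⟨k, hk⟩ := hN4 (π x) trivial
    exact ⟨k, by rw [hKdef, Subgroup.mem_comap, map_pow]; exact hk⟩
  -- p-elements of K lie in U
  have hpel : ∀ x ∈ K, (∃ k : ℕ, x ^ (p ^ k) = 1) → x ∈ U := by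
    rintro x hx ⟨k, hk⟩
    exact mem_of_pow_coprime (hm x hx) (by rw [hk]; exact U.one_mem) (hpc k)
  have hUsyl : IsSyl p U K := by
    obtain ⟨Q, hQ, hle⟩ := exists_isSyl_ge hUp hUK
    have : Q ≤ U := fun x hx => hpel x (hQ.1 hx) (pow_of_isPGroup hQ.2.1 hx)
    rwa [le_antisymm this hle] at hQ
  have hCK : ∀ x ∈ K, (∀ u ∈ U, x * u = u * x) → x ∈ U := by
    set C := K ⊓ Subgroup.centralizer (U : Set G) with hC
    have hCn : C.Normal := inferInstance
    have hcent : ∀ c ∈ C, ∀ u ∈ U, c * u = u * c := by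
      intro c hc u hu
      have : c ∈ Subgroup.centralizer (U : Set G) := hc.2
      rw [Subgroup.mem_centralizer_iff] at this
      exact (this u hu).symm
    have h1 : IsSyl p (U ⊓ C) C := hUsyl.inf (le_Nz_normal hCn) inf_le_left
    have h2 : PN p C := by
      apply fusion_rel h1
      intro x hx g hg _
      refine ⟨1, one_mem _, ?_⟩
      rw [hcent g hg x hx.1]; simp
    obtain ⟨M, hM⟩ := h2
    have hMn : M.Normal := by
      apply normal_of_le_Nz
      refine le_trans ?_ hM.Nz_le
      exact le_Nz_normal hCn
    have hMb := hE M hMn hM.2.2.1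
    have hCp : IsPGroup p C := by
      apply isPGroup_of_pow
      intro x hx
      obtain ⟨k, hk⟩ := hM.2.2.2 x hx
      rw [hMb] at hk
      exact ⟨k, Subgroup.mem_bot.1 hk⟩
    intro x hx hxu
    apply hnorm C hCn hCp
    refine ⟨hx, ?_⟩
    change x ∈ Subgroup.centralizer (U : Set G)
    rw [Subgroup.mem_centralizer_iff]
    exact fun u hu => (hxu u hu).symm
  have hpg : ∀ X : Subgroup G, U ≤ X → PN p X → IsPGroup p X := by
    rintro X hUX ⟨M, hM⟩
    have hMU : M ≤ U := by
      intro x hx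
      apply hCK
      · obtain ⟨k, hk⟩ := hKpow x
        refine mem_of_pow_coprime hk (l := Nat.card M) ?_ ?_
        · rw [pow_card_mem hx]; exact K.one_mem
        · exact Nat.Coprime.pow_left _ ((Nat.Prime.coprime_iff_not_dvd hp.out).2 hM.2.2.1)
      · intro u hu
        exact hM.commute hUp hUX (le_Nz_normal hU) hx hu
    have hMb : M = ⊥ := by
      rw [← inf_eq_bot_of_coprime hUp hM.2.2.1]
      exact (inf_eq_right.2 hMU).symm
    apply isPGroup_of_pow
    intro x hx
    obtain ⟨k, hk⟩ := hM.2.2.2 x hx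
    rw [hMb] at hk
    exact ⟨k, Subgroup.mem_bot.1 hk⟩
  have hirr : ∀ R : Subgroup G, U ≤ R → R ≤ K → P ≤ Nz R → R = U ∨ R = K := by
    intro R hUR hRK hPR
    by_cases htop : R ⊔ P = ⊤
    · right
      apply le_antisymm hRK
      intro x hx
      obtain ⟨r, hr, s, hs, rfl⟩ := (mem_sup_of_le_Nz hPR).1 (show x ∈ R ⊔ P by rw [htop]; trivial)
      have h1 : s ∈ K := by
        have := K.mul_mem (K.inv_mem (hRK hr)) hx
        simpa using this
      exact R.mul_mem hr (hUR (hpel s h1 (pow_of_isPGroup hP.2.1 hs)))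
    · left
      have h1 : PN p (R ⊔ P : Subgroup G) := by
        apply hIH _ htop
        apply HypT.of_one (hP.of_le le_sup_right le_top)
        intro b
        exact (hT P hP b).mono (inf_le_inf_left _ le_top)
      have h2 := hpg _ (hUR.trans le_sup_left) h1
      apply le_antisymm _ hUR
      intro x hx
      exact hpel x (hRK hx) (pow_of_isPGroup h2 (Subgroup.mem_sup_left hx))
  have hKP : K ⊔ P = ⊤ := sup_of_pow le_top (le_Nz_normal hK) (fun x _ => hKpow x) hP
  have hKU : K ≠ U := by
    intro h
    apply hn
    apply IsPGroup.pn
    rw [← hKP, h, sup_comm]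
    exact hP.2.1.to_sup_of_normal_right hUp
  have hmapK : K.map π = N := Subgroup.map_comap_eq_self_of_surjective (mk_surj U) N
  have hmapU : U.map π = ⊥ := QuotientGroup.map_mk'_self U
  have hab : ∀ a ∈ K, ∀ b ∈ K, a * b * a⁻¹ * b⁻¹ ∈ U := by
    have hNb : N ≠ ⊥ := by
      intro h
      apply hKU
      rw [hKdef, h, MonoidHom.comap_bot, hker]
    have hN1 : Nat.card N ≠ 1 := fun h => hNb (Subgroup.card_eq_one.1 h)
    obtain ⟨q, hq, hqN⟩ := Nat.exists_prime_and_dvd hN1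
    have : Fact q.Prime := ⟨hq⟩
    have hqp : q ≠ p := by rintro rfl; exact hN3 hqN
    obtain ⟨Q, hQ⟩ := exists_isSyl q K
    have hqK : q ∣ Nat.card K := by
      refine hqN.trans ?_
      rw [← hmapK]; exact Subgroup.card_map_dvd K π
    have hQne := hQ.ne_bot hqK
    have hRK : U ⊔ Q ≤ K := sup_le hUK hQ.1
    have hKN : K ⊔ Nz (U ⊔ Q) = ⊤ := by
      rw [eq_top_iff]
      intro x _
      obtain ⟨k, hk, hkx⟩ := hQ.frattini (le_Nz_normal hK) (Subgroup.mem_top x)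
      have h1 : k * x ∈ Nz (U ⊔ Q) := Nz_sup_le _ _ ⟨le_Nz_normal (X := ⊤) hU trivial, hkx⟩
      have h2 := Subgroup.mul_mem (K ⊔ Nz (U ⊔ Q)) (Subgroup.mem_sup_left (K.inv_mem hk)) (Subgroup.mem_sup_right h1)
      simpa using h2
    obtain ⟨S, hS, hUS⟩ := exists_isSyl_ge hUp (show U ≤ Nz (U ⊔ Q) from le_sup_left.trans (le_Nz _))
    have hKS : K ⊔ S = ⊤ := by
      rw [eq_top_iff, ← hKN]
      refine sup_le le_sup_left ?_
      have h1 := sup_of_pow (p := p) (N := K ⊓ Nz (U ⊔ Q)) inf_le_right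
        (le_trans (le_inf (le_Nz_normal hK) (le_Nz _)) (Nz_inf_le _ _))
        (fun x hx => by
          obtain ⟨k, hk⟩ := hKpow x
          exact ⟨k, hk, pow_mem hx _⟩) hS
      rw [← h1]
      exact sup_le_sup_right inf_le_left _
    have hSsyl : IsSyl p S ⊤ := by
      obtain ⟨P', hP', hle⟩ := exists_isSyl_ge hS.2.1 (le_top : S ≤ ⊤)
      have : P' ≤ S := by
        intro x hx
        obtain ⟨k, hk, s, hs, rfl⟩ := (mem_sup_of_le_Nz (le_Nz_normal hK)).1 (show x ∈ K ⊔ S by rw [hKS]; trivial)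
        have h1 : k ∈ P' := by
          have := P'.mul_mem hx (P'.inv_mem (hle hs))
          simpa using this
        exact S.mul_mem (hUS (hpel k hk (pow_of_isPGroup hP'.2.1 h1))) hs
      rwa [le_antisymm this hle] at hP'
    obtain ⟨x, -, hxS⟩ := hSsyl.conj hP
    have hPx : P ≤ Nz (cj x (U ⊔ Q)) := by
      rw [Nz_cj, ← hxS]; exact cj_mono hS.1
    have hKQ : U ⊔ Q = K := by
      rcases hirr (cj x (U ⊔ Q)) (by rw [cj_sup, cj_normal hU]; exact le_sup_left)
        (by rw [← cj_normal (g := x) hK]; exact cj_mono hRK) hPx with h1 | h1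
      · exfalso
        have h2 : cj x Q ≤ U := by rw [← h1]; exact cj_mono le_sup_right
        have h3 : q ∣ Nat.card U := by
          refine dvd_trans ?_ (Subgroup.card_dvd_of_le h2)
          rw [card_cj]; exact pGroup_dvd hQ.2.1 hQne
        obtain ⟨n, hn⟩ := hUp.exists_card_eq
        rw [hn] at h3
        exact hqp ((Nat.prime_dvd_prime_iff_eq hq hp.out).1 (hq.dvd_of_dvd_pow h3))
      · rw [← cj_inv_cj x (U ⊔ Q), h1, cj_normal hK]
    have hNq : IsPGroup q N := by
      rw [← hmapK, ← hKQ, Subgroup.map_sup, hmapU, bot_sup_eq]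
      exact hQ.2.1.map π
    have hlt : ⁅N, N⁆ ≠ N := by
      intro h
      have : Group.IsNilpotent N := hNq.isNilpotent
      have : Nontrivial N := (Subgroup.nontrivial_iff_ne_bot N).2 hNb
      have h1 := Group.IsSolvable.commutator_lt_top_of_nontrivial N
      apply h1.ne
      apply Subgroup.map_injective N.subtype_injective
      rw [Subgroup.map_subtype_commutator, map_top_subtype, h]
    have h1 : ⁅K, K⁆ ≤ K := Subgroup.commutator_le_left K K
    rcases hirr (⁅K, K⁆ ⊔ U) le_sup_right (sup_le h1 hUK) (le_Nz_normal inferInstance) with h2 | h2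
    · intro a ha b hb
      rw [← h2]
      apply Subgroup.mem_sup_left
      exact Subgroup.commutator_mem_commutator ha hb
    · exfalso
      apply hlt
      have h3 := congrArg (Subgroup.map π) h2
      rwa [Subgroup.map_sup, Subgroup.map_commutator, hmapU, sup_bot_eq, hmapK] at h3
  refine core_contra hp2 hU hK hUK hP hUp hN3 hm hab hKP hirr hCK hnorm ?_ ?_
  · intro h
    have h1 := hT P hP true
    simp only [Wp, h, inf_top_eq] at h1
    exact hn h1
  · intro h
    have h1 := hT P hP false
    simp only [Wp, h, inf_top_eq] at h1
    exact hn h1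

end

theorem thompson {p : ℕ} [hp : Fact p.Prime] (hp2 : p ≠ 2) {G : Type u} [Group G] [Finite G]
    (hT : HypT p (⊤ : Subgroup G)) : PN p (⊤ : Subgroup G) := by
  have : ∀ n : ℕ, ∀ (G : Type u) [Group G] [Finite G], Nat.card G = n → HypT p (⊤ : Subgroup G) →
      PN p (⊤ : Subgroup G) := by
    intro n
    induction n using Nat.strong_induction_on with
    | _ n ih =>
      intro G _ _ hG hT
      exact T_step hp2 (fun G' _ _ hlt h => ih _ (hG ▸ hlt) G' rfl h) hT
  exact this _ G rfl hT

theorem thompson_rel {p : ℕ} [hp : Fact p.Prime] (hp2 : p ≠ 2) {G : Type u} [Group G] [Finite G]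
    {X : Subgroup G} (hT : HypT p X) : PN p X :=
  PN.of_sub (thompson hp2 hT.sub)
end FrobGen

set_option linter.unusedSectionVars false
namespace FrobGen
open Subgroup
universe u

lemma G1 {M B ι : Type*} [AddCommGroup M] [Group B] [Fintype B] [Fintype ι] [DecidableEq ι]
    (ρ : B → AddMonoid.End M) (hρ1 : ρ 1 = 1) (hρ : ∀ a b, ρ (a * b) = ρ a * ρ b)
    (σ : ι → AddMonoid.End M) (φ : ι → B → B) (i0 : ι) (h0 : σ i0 = 1) (hφ0 : ∀ b, φ i0 b = b)
    (hc : ∀ i b, σ i * ρ b = ρ (φ i b) * σ i) (hφ : ∀ i b, φ i b⁻¹ = (φ i b)⁻¹)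
    (hinj : ∀ i, i ≠ i0 → Function.Injective (fun b => b * (φ i b)⁻¹)) :
    ∑ b, ρ b * (∑ i, σ i) * ρ b⁻¹ =
      (Fintype.card B) • (1 : AddMonoid.End M) + ∑ i ∈ Finset.univ.erase i0, (∑ b, ρ b) * σ i := by
  have h1 : ∑ b, ρ b * (∑ i, σ i) * ρ b⁻¹ = ∑ i, ∑ b, ρ (b * (φ i b)⁻¹) * σ i := by
    rw [Finset.sum_comm]
    refine Finset.sum_congr rfl fun b _ => ?_
    rw [Finset.mul_sum, Finset.sum_mul]
    refine Finset.sum_congr rfl fun i _ => ?_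
    rw [mul_assoc, hc, hφ, ← mul_assoc, hρ]
  rw [h1, ← Finset.add_sum_erase _ _ (Finset.mem_univ i0)]
  congr 1
  · simp [hφ0, hρ1, h0]
  · refine Finset.sum_congr rfl fun i hi => ?_
    rw [← Finset.sum_mul]
    congr 1
    exact Function.Bijective.sum_comp (Finite.injective_iff_bijective.1 (hinj i (Finset.ne_of_mem_erase hi))) ρ

section
variable {F : Type u} [Group F] [Finite F] {p : ℕ} [hp : Fact p.Prime]

lemma map_of_inv {α : MulAut F} {N : Subgroup F} (h : ∀ x ∈ N, α x ∈ N) : N.map (α : F →* F) = N := by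
  apply Subgroup.eq_of_le_of_card_ge
  · rintro _ ⟨x, hx, rfl⟩; exact h x hx
  · rw [Subgroup.card_map_of_injective α.injective]

lemma inv_of_map {α : MulAut F} {N : Subgroup F} (h : N.map (α : F →* F) = N) : ∀ x ∈ N, α x ∈ N := by
  intro x hx
  rw [← h]; exact ⟨x, hx, rfl⟩

lemma pow_inv_mem {α : MulAut F} {N : Subgroup F} (h : ∀ x ∈ N, α x ∈ N) (k : ℕ) : ∀ x ∈ N, (α ^ k) x ∈ N := by
  induction k with
  | zero => intro x hx; simpa using hx
  | succ k ih => intro x hx; rw [pow_succ]; exact ih _ (h x hx)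

def resAut (α : MulAut F) {N : Subgroup F} (h : ∀ x ∈ N, α x ∈ N) : MulAut N :=
  (α.subgroupMap N).trans (MulEquiv.subgroupCongr (map_of_inv h))

lemma resAut_coe (α : MulAut F) {N : Subgroup F} (h : ∀ x ∈ N, α x ∈ N) (x : N) :
    (resAut α h x : F) = α x := rfl

lemma resAut_pow_coe (α : MulAut F) {N : Subgroup F} (h : ∀ x ∈ N, α x ∈ N) (k : ℕ) (x : N) :
    ((resAut α h ^ k) x : F) = (α ^ k) x := by
  induction k with
  | zero => rfl
  | succ k ih => rw [pow_succ', pow_succ', MulAut.mul_apply, MulAut.mul_apply, resAut_coe, ih]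

lemma fpf_pow {α : MulAut F} {s : ℕ} (hs : s.Prime) (hα : α ^ s = 1) (hfix : ∀ x, α x = x → x = 1)
    {i : ℕ} (h0 : i ≠ 0) (hi : i < s) {x : F} (h : (α ^ i) x = x) : x = 1 := by
  apply hfix
  have hst : α ∈ MulAction.stabilizer (MulAut F) x := by
    refine mem_of_pow_coprime (k := i) (l := s) ?_ ?_ ?_
    · exact h
    · rw [hα]; exact one_mem _
    · exact ((Nat.Prime.coprime_iff_not_dvd hs).2 fun hd => absurd (Nat.le_of_dvd (Nat.pos_of_ne_zero h0) hd) (not_le.2 hi)).symm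
  exact hst

lemma fpf_surj {α : MulAut F} (hfix : ∀ x, α x = x → x = 1) (y : F) : ∃ x, y = x * (α x)⁻¹ := by
  have : Function.Injective (fun x : F => x * (α x)⁻¹) := by
    intro a b hab
    have hab : a * (α a)⁻¹ = b * (α b)⁻¹ := hab
    have h1 : α (b⁻¹ * a) = b⁻¹ * a := by
      rw [map_mul, map_inv]
      have : b⁻¹ * a = (α b)⁻¹ * α a := by
        have h2 : a = b * (α b)⁻¹ * α a := by rw [← hab]; simp
        calc b⁻¹ * a = b⁻¹ * (b * (α b)⁻¹ * α a) := by rw [← h2]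
          _ = _ := by simp [mul_assoc]
      exact this.symm
    have := hfix _ h1
    exact (inv_mul_eq_one.1 this).symm
  obtain ⟨x, hx⟩ := (Finite.injective_iff_surjective.1 this) y
  exact ⟨x, hx.symm⟩

lemma fpf_sylow {α : MulAut F} (hfix : ∀ x, α x = x → x = 1) (p : ℕ) [hp : Fact p.Prime] :
    ∃ P : Subgroup F, IsSyl p P ⊤ ∧ ∀ x ∈ P, α x ∈ P := by
  obtain ⟨P, hP⟩ := exists_isSyl p (⊤ : Subgroup F)
  have hP' := hP.map (α : F →* F)
  rw [Subgroup.map_top_of_surjective _ α.surjective] at hP'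
  obtain ⟨x, -, hx⟩ := hP'.conj hP
  obtain ⟨w, hw⟩ := fpf_surj hfix x
  refine ⟨cj w⁻¹ P, hP.cj_mem trivial, ?_⟩
  intro u hu
  rw [mem_cj] at hu ⊢
  have h1 : α (w⁻¹⁻¹ * u * w⁻¹) ∈ P.map (α : F →* F) := ⟨_, hu, rfl⟩
  have h2 := cj_mem (g := x) h1
  rw [hx, hw] at h2
  simpa [mul_assoc] using h2

open scoped IsMulCommutative in
/-- an invariant prime-to-p subgroup centralizes an invariant elementary abelian normal `p`-subgroup -/
lemma fpf_centralize {α : MulAut F} {s : ℕ} (hs : s.Prime) (hα : α ^ s = 1) (hfix : ∀ x, α x = x → x = 1)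
    {W Q : Subgroup F} (hW : W.Normal) (hWα : ∀ x ∈ W, α x ∈ W) (hQα : ∀ x ∈ Q, α x ∈ Q)
    (hEA : IsEA p W) (hQ : ¬ p ∣ Nat.card Q) {x y : F} (hx : x ∈ W) (hy : y ∈ Q) : y * x = x * y := by
  classical
  have : IsMulCommutative W := ⟨⟨fun a b => Subtype.ext (hEA.2 a a.2 b b.2)⟩⟩
  have : Fintype Q := Fintype.ofFinite Q
  have : NeZero s := ⟨hs.ne_zero⟩
  have hN : ∀ g : F, g ∈ Nz W := fun g => le_Nz_normal (X := ⊤) hW trivial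
  let a : AddMonoid.End (Additive W) := MonoidHom.toAdditive (resAut α hWα : W →* W)
  have ha : ∀ (k : ℕ) (z : Additive W), val ((a ^ k) z) = (α ^ k) (val z) := by
    intro k
    induction k with
    | zero => intro z; rfl
    | succ k ih =>
      intro z
      rw [pow_succ, pow_succ]
      exact ih (a z)
  have has : a ^ s = 1 := by
    refine DFunLike.ext _ _ fun z => val_inj ?_
    rw [ha, hα]; rfl
  have hsum : ∑ i : Fin s, a ^ (i : ℕ) = 0 := by
    rw [Fin.sum_univ_eq_sum_range (fun i => a ^ i)]
    refine DFunLike.ext _ _ fun z => ?_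
    have h1 : (a - 1) * ∑ i ∈ Finset.range s, a ^ i = 0 := by rw [mul_geom_sum, has, sub_self]
    have h2 : a ((∑ i ∈ Finset.range s, a ^ i) z) - (∑ i ∈ Finset.range s, a ^ i) z = 0 :=
      DFunLike.congr_fun h1 z
    apply val_inj
    apply hfix
    exact congrArg val (sub_eq_zero.1 h2)
  have key := G1 (M := Additive W) (B := Q) (ι := Fin s) (fun b => ac W (b : F)) (by simpa using ac_one)
    (fun b c => by simpa using ac_mul (hN b) (hN c)) (fun i => a ^ (i : ℕ))
    (fun i b => ⟨(α ^ (i : ℕ)) b, pow_inv_mem hQα i b b.2⟩) 0 (by simp) (by intro b; simp)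
    (by
      intro i b
      refine DFunLike.ext _ _ fun z => val_inj ?_
      change val ((a ^ (i : ℕ)) (ac W (b : F) z)) = val (ac W ((α ^ (i : ℕ)) b) ((a ^ (i : ℕ)) z))
      rw [ha, val_ac (hN _), val_ac (hN _), ha]
      simp)
    (by intro i b; apply Subtype.ext; simp)
    (by
      intro i hi b c hbc
      have hbc : (b : F) * ((α ^ (i : ℕ)) b)⁻¹ = c * ((α ^ (i : ℕ)) c)⁻¹ := congrArg Subtype.val hbc
      have h1 : (α ^ (i : ℕ)) ((c : F)⁻¹ * b) = (c : F)⁻¹ * b := by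
        rw [map_mul, map_inv]
        have h2 : (b : F) = c * ((α ^ (i : ℕ)) c)⁻¹ * (α ^ (i : ℕ)) b := by rw [← hbc]; simp
        symm
        calc (c : F)⁻¹ * b = (c : F)⁻¹ * (c * ((α ^ (i : ℕ)) c)⁻¹ * (α ^ (i : ℕ)) b) := by rw [← h2]
          _ = _ := by simp [mul_assoc]
      have h3 := fpf_pow hs hα hfix (fun h => hi (Fin.ext h)) i.2 h1
      exact Subtype.ext (inv_mul_eq_one.1 h3).symm)
  simp only [hsum, mul_zero, zero_mul, Finset.sum_const_zero] at key
  -- multiply by the action of y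
  have hyN : ac W y * ∑ b : Q, ac W (b : F) = ∑ b : Q, ac W (b : F) := by
    rw [Finset.mul_sum]
    have h1 : ∀ b : Q, ac W y * ac W (b : F) = ac W ((⟨y, hy⟩ * b : Q) : F) := fun b => by
      rw [← ac_mul (hN _) (hN _)]; rfl
    rw [Finset.sum_congr rfl fun b _ => h1 b]
    exact Equiv.sum_comp (Equiv.mulLeft (⟨y, hy⟩ : Q)) (fun b : Q => ac W (b : F))
  have h2 : ac W y * ((Fintype.card Q) • (1 : AddMonoid.End (Additive W))) = (Fintype.card Q) • (1 : AddMonoid.End (Additive W)) := by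
    have h3 := congrArg (fun t => ac W y * t) key
    simp only [mul_zero, mul_add] at h3
    rw [Finset.mul_sum] at h3
    simp only [← mul_assoc, hyN] at h3
    rw [key] at h3
    exact add_right_cancel h3.symm
  have h4 := congrArg val (DFunLike.congr_fun h2 (mk hx))
  have h5 : y * x ^ Fintype.card Q * y⁻¹ = x ^ Fintype.card Q := by
    have h6 : val (ac W y ((Fintype.card Q) • mk hx)) = val ((Fintype.card Q) • mk hx) := h4
    rwa [val_ac (hN y), val_nsmul, val_mk] at h6
  have h7 : x ∈ Subgroup.centralizer {y} := by
    refine mem_of_pow_coprime (k := Fintype.card Q) (l := p) ?_ ?_ ?_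
    · rw [Subgroup.mem_centralizer_singleton_iff]
      exact (mul_inv_eq_iff_eq_mul.1 h5).symm
    · rw [hEA.1 x hx]; exact one_mem _
    · rw [Nat.card_eq_fintype_card] at hQ
      exact ((Nat.Prime.coprime_iff_not_dvd hp.out).2 hQ).symm
  exact (Subgroup.mem_centralizer_singleton_iff.1 h7).symm

end
end FrobGen

set_option linter.unusedSectionVars false
namespace FrobGen
open Subgroup
universe u

section
variable {F : Type u} [Group F] [Finite F]

lemma eq_top_of_sylows {X : Subgroup F} (h : ∀ q : ℕ, q.Prime → ∃ Q : Subgroup F, IsSyl q Q ⊤ ∧ Q ≤ X) : X = ⊤ := by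
  by_contra hX
  have h1 : X.index ≠ 1 := fun h => hX (Subgroup.index_eq_one.1 h)
  obtain ⟨q, hq, hd⟩ := Nat.exists_prime_and_dvd h1
  obtain ⟨Q, hQ, hle⟩ := h q hq
  apply hQ.2.2
  rw [Subgroup.relIndex_top_right]
  exact hd.trans (Subgroup.index_dvd_of_le hle)

lemma exists_Zp_ne_bot {N : Subgroup F} (hN : Group.IsNilpotent N) (hne : N ≠ ⊥) :
    ∃ p : ℕ, p.Prime ∧ Zp p N ≠ ⊥ := by
  have : Nontrivial N := (Subgroup.nontrivial_iff_ne_bot N).2 hne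
  have h1 := Group.IsNilpotent.center_ne_bot N
  have h2 : Nat.card (Subgroup.center N) ≠ 1 := fun h => h1 (Subgroup.card_eq_one.1 h)
  obtain ⟨p, hp, hd⟩ := Nat.exists_prime_and_dvd h2
  have : Fact p.Prime := ⟨hp⟩
  obtain ⟨x, hx, ho⟩ := exists_sylow_of_prime_dvd hd
  refine ⟨p, hp, fun hb => ?_⟩
  have h3 : (x : F) ∈ Zp p N := by
    refine ⟨x.2, ?_, fun s hs => ?_⟩
    · have := pow_orderOf_eq_one x
      rw [ho] at this
      exact congrArg Subtype.val this
    · exact congrArg Subtype.val (Subgroup.mem_center_iff.1 hx ⟨s, hs⟩)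
  rw [hb] at h3
  have h4 : x = 1 := Subtype.ext (Subgroup.mem_bot.1 h3)
  rw [h4, orderOf_one] at ho
  exact hp.one_lt.ne ho

lemma isPGroup_of_top {p : ℕ} (h : IsPGroup p (⊤ : Subgroup F)) : IsPGroup p F := by
  intro x
  obtain ⟨k, hk⟩ := h ⟨x, trivial⟩
  exact ⟨k, congrArg Subtype.val hk⟩

theorem nilp_step {α : MulAut F} {s : ℕ} (hs : s.Prime) (hα : α ^ s = 1) (hfix : ∀ x, α x = x → x = 1)
    (IH : ∀ (F' : Type u) [Group F'] [Finite F'] (β : MulAut F'), Nat.card F' < Nat.card F → β ^ s = 1 →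
      (∀ x, β x = x → x = 1) → Group.IsNilpotent F') : Group.IsNilpotent F := by
  have ihs : ∀ N : Subgroup F, N ≠ ⊤ → (∀ x ∈ N, α x ∈ N) → Group.IsNilpotent N := by
    intro N hN hinv
    refine IH N (resAut α hinv) (card_sub_lt hN) ?_ ?_
    · ext x
      rw [resAut_pow_coe, hα]; rfl
    · intro x hx
      exact Subtype.ext (hfix _ (congrArg Subtype.val hx))
  by_cases hex : ∃ N : Subgroup F, N.Normal ∧ N ≠ ⊥ ∧ N ≠ ⊤ ∧ ∀ x ∈ N, α x ∈ N
  · obtain ⟨N, hN, hNb, hNt, hinv⟩ := hex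
    obtain ⟨p, hp, hWb⟩ := exists_Zp_ne_bot (ihs N hNt hinv) hNb
    have : Fact p.Prime := ⟨hp⟩
    set W := Zp p N with hW
    have hWn : W.Normal := normal_of_le_Nz ((le_Nz_normal hN).trans (Nz_le_Zp N))
    have hWα : ∀ x ∈ W, α x ∈ W := by
      apply inv_of_map
      rw [hW, ← Zp_map (f := (α : F →* F)) (fun x _ h => (MulEquiv.map_eq_one_iff α).1 h), map_of_inv hinv]
    have hEA : IsEA p W := ⟨fun x hx => hx.2.1, fun x hx y hy => hy.2.2 x hx.1⟩
    obtain ⟨P, hP⟩ := exists_isSyl p (⊤ : Subgroup F)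
    obtain ⟨w, hwW, hw1, hwP⟩ := exists_fixed hP.2.1 (pGroup_dvd hEA.isPGroup hWb) (le_Nz_normal hWn)
    have hcen : Subgroup.centralizer {w} = ⊤ := by
      apply eq_top_of_sylows
      intro q hq
      have : Fact q.Prime := ⟨hq⟩
      by_cases hqp : q = p
      · subst hqp
        refine ⟨P, hP, fun x hx => ?_⟩
        rw [Subgroup.mem_centralizer_singleton_iff]
        exact hwP x hx
      · obtain ⟨Q, hQ, hQα⟩ := fpf_sylow hfix q
        refine ⟨Q, hQ, fun x hx => ?_⟩
        rw [Subgroup.mem_centralizer_singleton_iff]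
        refine fpf_centralize hs hα hfix hWn hWα hQα hEA ?_ hwW hx
        intro hd
        obtain ⟨n, hn⟩ := hQ.2.1.exists_card_eq
        rw [hn] at hd
        exact hqp ((Nat.prime_dvd_prime_iff_eq hp hq).1 (hp.dvd_of_dvd_pow hd)).symm
    have hwc : w ∈ Subgroup.center F := by
      rw [Subgroup.mem_center_iff]
      intro g
      have : g ∈ Subgroup.centralizer {w} := by rw [hcen]; trivial
      exact Subgroup.mem_centralizer_singleton_iff.1 this
    have hcb : Subgroup.center F ≠ ⊥ := by
      intro h; rw [h] at hwc; exact hw1 (Subgroup.mem_bot.1 hwc)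
    have hcinv : ∀ x ∈ Subgroup.center F, α x ∈ Subgroup.center F := by
      intro x hx
      rw [Subgroup.mem_center_iff] at hx ⊢
      intro g
      have := congrArg α (hx (α.symm g))
      simpa using this
    apply Group.of_quotient_center_nilpotent
    set β : MulAut (F ⧸ Subgroup.center F) := QuotientGroup.congr _ _ α (map_of_inv hcinv) with hβ
    have hβmk : ∀ x : F, β (QuotientGroup.mk x) = QuotientGroup.mk (α x) := fun x => rfl
    refine IH _ β (card_quot_lt hcb) ?_ ?_
    · have h1 : ∀ k : ℕ, ∀ x : F, (β ^ k) (QuotientGroup.mk x) = QuotientGroup.mk ((α ^ k) x) := by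
        intro k
        induction k with
        | zero => intro x; rfl
        | succ k ih => intro x; rw [pow_succ, pow_succ, MulAut.mul_apply, hβmk, ih]; rfl
      apply MulEquiv.ext
      intro y
      obtain ⟨x, rfl⟩ := QuotientGroup.mk_surjective y
      rw [h1, hα]; rfl
    · intro y hy
      obtain ⟨x, rfl⟩ := QuotientGroup.mk_surjective y
      rw [hβmk, QuotientGroup.eq] at hy
      -- (α x)⁻¹ * x central
      obtain ⟨⟨z, hz⟩, hzz⟩ := fpf_surj (α := resAut α hcinv)
        (fun x hx => Subtype.ext (hfix _ (congrArg Subtype.val hx))) ⟨_, hy⟩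
      have hzz : (α x)⁻¹ * x = z * (α z)⁻¹ := congrArg Subtype.val hzz
      rw [QuotientGroup.eq_one_iff]
      have hzc := fun g => Subgroup.mem_center_iff.1 hz g
      have h1 : α (z⁻¹ * x) = z⁻¹ * x := by
        have h2 : x = α x * (z * (α z)⁻¹) := by rw [← hzz]; simp
        have hzα := fun g => Subgroup.mem_center_iff.1 (hcinv z hz) g
        calc α (z⁻¹ * x) = (α z)⁻¹ * α x := by rw [map_mul, map_inv]
          _ = α x * (α z)⁻¹ := by
            rw [inv_mul_eq_iff_eq_mul, ← mul_assoc, ← hzα]; simp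
          _ = z⁻¹ * (α x * (z * (α z)⁻¹)) := by
            rw [← mul_assoc (α x), hzc (α x)]; simp [mul_assoc]
          _ = z⁻¹ * x := by rw [← h2]
      have h3 := hfix _ h1
      have : z = x := inv_mul_eq_one.1 h3
      rw [← this]; exact hz
  · by_cases hodd : ∃ p : ℕ, p.Prime ∧ p ≠ 2 ∧ p ∣ Nat.card F
    · obtain ⟨p, hp, hp2, hpF⟩ := hodd
      have : Fact p.Prime := ⟨hp⟩
      obtain ⟨P, hP, hPα⟩ := fpf_sylow hfix p
      have hPb : P ≠ ⊥ := hP.ne_bot (by simpa using hpF)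
      by_contra hnil
      have hnp : ¬ IsPGroup p F := fun h => hnil h.isNilpotent
      have hinj : ∀ (S : Subgroup F), ∀ x ∈ S, (α : F →* F) x = 1 → x = 1 :=
        fun S x _ h => (MulEquiv.map_eq_one_iff α).1 h
      have hT : HypT p (⊤ : Subgroup F) := by
        apply HypT.of_one hP
        intro b
        rw [inf_top_eq]
        apply pn_of_nilpotent
        have hWα : (Wp b p P).map (α : F →* F) = Wp b p P := by
          rw [← Wp_map b (hinj P), map_of_inv hPα]
        apply ihs
        · intro htop
          apply hex
          refine ⟨Wp b p P, Nz_eq_top.1 htop, Wp_ne_bot b hP.2.1 hPb, fun h => ?_, inv_of_map hWα⟩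
          apply hnp
          apply isPGroup_of_top
          rw [← h]
          exact hP.2.1.to_le (Wp_le b P)
        · intro x hx
          have h1 := Nz_map_le (α : F →* F) (le_refl (Nz (Wp b p P)))
          rw [hWα] at h1
          exact h1 ⟨x, hx, rfl⟩
      obtain ⟨N, hN⟩ := thompson hp2 hT
      by_cases hNb : N = ⊥
      · apply hnp
        apply isPGroup_of_top
        apply isPGroup_of_pow
        intro x hx
        obtain ⟨k, hk⟩ := hN.2.2.2 x hx
        rw [hNb] at hk
        exact ⟨k, Subgroup.mem_bot.1 hk⟩
      · apply hex
        refine ⟨N, normal_of_le_Nz hN.2.1, hNb, ?_, ?_⟩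
        · rintro rfl
          exact hN.2.2.1 (by simpa using hpF)
        · intro x hx
          rw [hN.mem_iff trivial] at hx ⊢
          have h1 : orderOf (α x) = orderOf x := orderOf_injective (α : F →* F) α.injective x
          rwa [h1]
    · have h2 : IsPGroup 2 F := by
        apply IsPGroup.of_card
        apply Nat.eq_prime_pow_of_unique_prime_dvd Nat.card_pos.ne'
        intro d hd hdF
        by_contra hd2
        exact hodd ⟨d, hd, hd2, hdF⟩
      have : Fact (Nat.Prime 2) := ⟨Nat.prime_two⟩
      exact h2.isNilpotent
end

/-- Thompson: finite groups with fixed-point-free automorphisms of prime order are nilpotent -/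
theorem thompson_nilp {s : ℕ} (hs : s.Prime) {F : Type u} [Group F] [Finite F] {α : MulAut F} (hα : α ^ s = 1)
    (hfix : ∀ x, α x = x → x = 1) : Group.IsNilpotent F := by
  have : ∀ n : ℕ, ∀ (F : Type u) [Group F] [Finite F] (α : MulAut F), Nat.card F = n → α ^ s = 1 →
      (∀ x, α x = x → x = 1) → Group.IsNilpotent F := by
    intro n
    induction n using Nat.strong_induction_on with
    | _ n ih =>
      intro F _ _ α hF h1 h2
      exact nilp_step hs h1 h2 (fun F' _ _ β hlt h3 h4 => ih _ (hF ▸ hlt) F' β rfl h3 h4)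
  exact this _ F α rfl hα hfix
end FrobGen

set_option linter.unusedSectionVars false
namespace FrobGen
open Subgroup
universe u

section
variable {Y : Type u} [Group Y] [Finite Y]

lemma nilp_of_le {A B : Subgroup Y} (h : A ≤ B) (hB : Group.IsNilpotent B) : Group.IsNilpotent A :=
  (Group.isNilpotent_congr (Subgroup.subgroupOfEquivOfLe h)).1 inferInstance

lemma nilp_map {Y' : Type*} [Group Y'] {A : Subgroup Y} (hA : Group.IsNilpotent A) (f : Y →* Y') :
    Group.IsNilpotent (A.map f) :=
  Group.nilpotent_of_surjective (f.subgroupMap A) (f.subgroupMap_surjective A)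

/-- decomposition of a nilpotent group -/
structure Spl (q : ℕ) (N A B : Subgroup Y) : Prop where
  syl : IsSyl q A N
  pc : IsPC q B N
  nA : N ≤ Nz A
  comm : ∀ a ∈ A, ∀ b ∈ B, a * b = b * a
  nilB : Group.IsNilpotent B
  sup : B ⊔ A = N

lemma nilp_sylow_normal {q : ℕ} [hq : Fact q.Prime] {N A : Subgroup Y} (hN : Group.IsNilpotent N) (hA : IsSyl q A N) :
    N ≤ Nz A := by
  obtain ⟨S, rfl⟩ := hA.exists_sylow
  have h1 : (⊤ : Subgroup N) ≤ Nz (S : Subgroup N) := le_Nz_normal inferInstance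
  have := Nz_map_le N.subtype h1
  rwa [map_top_subtype] at this

lemma nilp_split {N : Subgroup Y} (hN : Group.IsNilpotent N) (q : ℕ) [hq : Fact q.Prime] :
    ∃ A B, Spl q N A B := by
  obtain ⟨A, hA⟩ := exists_isSyl q N
  obtain ⟨B, hB⟩ := pn_of_nilpotent (p := q) hN
  have hn := nilp_sylow_normal hN hA
  exact ⟨A, B, hA, hB, hn, fun a ha b hb => (hB.commute hA.2.1 hA.1 hn hb ha).symm, nilp_of_le hB.1 hN,
    hB.sup hA⟩

lemma Spl.mul {q : ℕ} {N A B : Subgroup Y} (h : Spl q N A B) {x : Y} (hx : x ∈ N) :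
    ∃ b ∈ B, ∃ a ∈ A, x = b * a := by
  rw [← h.sup] at hx
  exact (mem_sup_of_le_Nz (h.syl.1.trans h.pc.2.1)).1 hx

/-- trivial centralizer -/
def CF (G F : Subgroup Y) : Prop := ∀ g ∈ G, (∀ f ∈ F, f * g = g * f) → g = 1

lemma CF.mono {G G' F : Subgroup Y} (h : CF G F) (hle : G' ≤ G) : CF G' F := fun g hg => h g (hle hg)

lemma CF.cj {G F : Subgroup Y} (h : CF G F) {y : Y} (hy : y ∈ Nz G) : CF G (cj y F) := by
  intro g hg hc
  have := h (y⁻¹ * g * y) (by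
    have := Nz_conj (inv_mem hy) hg
    rwa [inv_inv] at this) (fun f hf => by
      have := hc _ (cj_mem hf)
      have h2 : f = y⁻¹ * (y * f * y⁻¹) * y := by group
      have : y⁻¹ * (y * f * y⁻¹ * g) * y = y⁻¹ * (g * (y * f * y⁻¹)) * y := by rw [this]
      simpa [mul_assoc] using this)
  have h2 : g = y * (y⁻¹ * g * y) * y⁻¹ := by group
  rw [h2, this]; simp

lemma CF.cent {q : ℕ} [hq : Fact q.Prime] {W F A B : Subgroup Y} (h : CF W F) (hn : F ≤ Nz W) (hs : Spl q F A B) :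
    ¬ q ∣ Nat.card (W ⊓ Subgroup.centralizer (B : Set Y) : Subgroup Y) := by
  intro hd
  have hAC : A ≤ Subgroup.centralizer (B : Set Y) := fun a ha =>
    Subgroup.mem_centralizer_iff.2 fun b hb => (hs.comm a ha b hb).symm
  obtain ⟨w, hw, hw1, hc⟩ := exists_fixed hs.syl.2.1 hd
    ((le_inf (hs.syl.1.trans hn) (hAC.trans (le_Nz _))).trans (Nz_inf_le _ _))
  apply hw1
  refine h w hw.1 fun f hf => ?_
  obtain ⟨b, hb, a, ha, rfl⟩ := hs.mul hf
  have h1 := Subgroup.mem_centralizer_iff.1 hw.2 b hb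
  rw [mul_assoc, hc a ha, ← mul_assoc, h1, mul_assoc]

lemma CF.cent_p {q : ℕ} [hq : Fact q.Prime] {W F A B : Subgroup Y} (h : CF W F) (hn : F ≤ Nz W) (hs : Spl q F A B)
    (hW : IsPGroup q W) : CF W B := by
  intro w hw hc
  have h1 := h.cent hn hs
  have hm : w ∈ W ⊓ Subgroup.centralizer (B : Set Y) := ⟨hw, Subgroup.mem_centralizer_iff.2 fun b hb => hc b hb⟩
  by_contra hne
  apply h1
  apply pGroup_dvd (hW.to_le inf_le_left)
  intro hb
  rw [hb] at hm
  exact hne (Subgroup.mem_bot.1 hm)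

lemma CF.inf_eq_bot {G F : Subgroup Y} (h : CF G F) (hF : Group.IsNilpotent F) (hn : F ≤ Nz G) : F ⊓ G = ⊥ := by
  by_contra hne
  have h2 : Nat.card (F ⊓ G : Subgroup Y) ≠ 1 := fun h => hne (Subgroup.card_eq_one.1 h)
  obtain ⟨q, hq, hd⟩ := Nat.exists_prime_and_dvd h2
  have : Fact q.Prime := ⟨hq⟩
  obtain ⟨A, B, hs⟩ := nilp_split hF q
  have hFn : F ≤ Nz (F ⊓ G) := (le_inf (le_Nz F) hn).trans (Nz_inf_le _ _)
  have hs1 := hs.syl.inf hFn inf_le_left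
  have hne1 : A ⊓ (F ⊓ G) ≠ ⊥ := by
    intro hb
    rw [hb] at hs1
    exact not_dvd_of_isSyl_bot hs1 hd
  obtain ⟨w, hw, hw1, hc⟩ := exists_fixed hs.syl.2.1 (pGroup_dvd hs1.2.1 hne1)
    ((le_inf (le_Nz A) (hs.syl.1.trans hFn)).trans (Nz_inf_le _ _))
  apply hw1
  refine h w hw.2.2 fun f hf => ?_
  obtain ⟨b, hb, a, ha, rfl⟩ := hs.mul hf
  rw [mul_assoc, hc a ha, ← mul_assoc, ← hs.comm w hw.1 b hb, mul_assoc]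

lemma CF.Nz_inf {G B : Subgroup Y} (h : CF G B) (hb : B ⊓ G = ⊥) (hn : B ≤ Nz G) {g : Y} (hg : g ∈ G) (hN : g ∈ Nz B) :
    g = 1 := by
  apply h g hg
  intro f hf
  have : f * g * f⁻¹ * g⁻¹ ∈ B ⊓ G := by
    constructor
    · have : f * g * f⁻¹ * g⁻¹ = f * (g * f⁻¹ * g⁻¹) := by group
      rw [this]
      exact B.mul_mem hf (Nz_conj hN (B.inv_mem hf))
    · exact G.mul_mem (Nz_conj (hn hf) hg) (G.inv_mem hg)
  rw [hb, Subgroup.mem_bot] at this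
  have := mul_inv_eq_one.1 this
  exact mul_inv_eq_iff_eq_mul.1 this

lemma CF.Nz_le {G F B : Subgroup Y} (hG : G.Normal) (ht : G ⊔ F = ⊤) (h : CF G B) (hb : B ⊓ G = ⊥) (hFB : F ≤ Nz B) :
    Nz B ≤ F := by
  intro y hy
  obtain ⟨g, hg, f, hf, rfl⟩ := exists_of_cover ht y
  have : g ∈ Nz B := by
    have := (Nz B).mul_mem hy ((Nz B).inv_mem (hFB hf))
    rwa [mul_inv_cancel_right] at this
  rw [h.Nz_inf hb (le_Nz_normal hG) hg this, one_mul]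
  exact hf

open scoped IsMulCommutative in
lemma H1a {W B : Subgroup Y} [IsMulCommutative W] (hn : B ≤ Nz W) (hc : Nat.Coprime (Nat.card B) (Nat.card W))
    (θ : Y → Y) (hθ : ∀ a ∈ B, ∀ b ∈ B, θ (a * b) = θ a * θ b) (hW : ∀ b ∈ B, θ b * b⁻¹ ∈ W) :
    ∃ w ∈ W, ∀ b ∈ B, θ b = w * b * w⁻¹ := by
  classical
  have := Fintype.ofFinite B
  let δ : B → Additive W := fun b => mk (hW b b.2)
  have hδ : ∀ c b : B, δ (c * b) = δ c + ac W c (δ b) := by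
    intro c b
    apply val_inj
    rw [val_add, val_ac (hn c.2)]
    simp only [δ, val_mk]
    rw [Subgroup.coe_mul, hθ c c.2 b b.2]
    group
  set S := ∑ b, δ b with hS
  have h1 : ∀ c : B, S = (Nat.card B) • δ c + ac W c S := by
    intro c
    have : S = ∑ b, δ (c * b) := (Equiv.sum_comp (Equiv.mulLeft c) δ).symm
    refine this.trans ?_
    simp only [hδ, Finset.sum_add_distrib, Finset.sum_const, Finset.card_univ, Nat.card_eq_fintype_card]
    rw [hS, map_sum]
  obtain ⟨u, v, huv⟩ := Nat.isCoprime_iff_coprime.2 hc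
  have h2 : ∀ x : Additive W, u • ((Nat.card B) • x) = x := by
    intro x
    have h3 : (Nat.card W) • x = 0 := by
      apply val_inj
      rw [val_nsmul, val_zero, pow_card_mem (val_mem x)]
    calc u • ((Nat.card B) • x) = (u * (Nat.card B : ℤ)) • x + v • ((Nat.card W) • x) := by
          rw [h3, smul_zero, add_zero, mul_smul, natCast_zsmul]
      _ = (u * (Nat.card B : ℤ) + v * (Nat.card W : ℤ)) • x := by
          rw [add_smul, mul_smul v, natCast_zsmul]
      _ = x := by rw [huv, one_smul]
  refine ⟨val (u • S), val_mem _, fun b hb => ?_⟩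
  have h4 := h2 (δ ⟨b, hb⟩)
  have h5 : (Nat.card B) • δ ⟨b, hb⟩ = S - ac W b S := eq_sub_of_add_eq (h1 ⟨b, hb⟩).symm
  rw [h5, smul_sub, ← map_zsmul] at h4
  have h6 := congrArg val h4
  rw [val_sub, val_ac (hn hb)] at h6
  simp only [δ, val_mk] at h6
  have h7 : θ b = θ b * b⁻¹ * b := by group
  rw [h7, ← h6]; group

lemma H1 {q : ℕ} [hq : Fact q.Prime] {W F : Subgroup Y} (hab : ∀ x ∈ W, ∀ y ∈ W, x * y = y * x) (hWq : IsPGroup q W)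
    (hn : F ≤ Nz W) (hF : Group.IsNilpotent F) (hCF : CF W F)
    (θ : Y → Y) (hθ : ∀ a ∈ F, ∀ b ∈ F, θ (a * b) = θ a * θ b) (hW : ∀ b ∈ F, θ b * b⁻¹ ∈ W) :
    ∃ w ∈ W, ∀ b ∈ F, θ b = w * b * w⁻¹ := by
  have : IsMulCommutative W := ⟨⟨fun a b => Subtype.ext (hab a a.2 b b.2)⟩⟩
  obtain ⟨A, B, hs⟩ := nilp_split hF q
  have hc : Nat.Coprime (Nat.card B) (Nat.card W) := by
    obtain ⟨n, hn⟩ := hWq.exists_card_eq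
    rw [hn]
    exact (Nat.Coprime.pow_left n ((hq.out.coprime_iff_not_dvd).2 hs.pc.2.2.1)).symm
  obtain ⟨w, hw, hwB⟩ := H1a (hs.pc.1.trans hn) hc θ (fun a ha b hb => hθ a (hs.pc.1 ha) b (hs.pc.1 hb))
    (fun b hb => hW b (hs.pc.1 hb))
  have hA : ∀ a ∈ A, θ a = w * a * w⁻¹ := by
    intro a ha
    have haF := hs.syl.1 ha
    have h1 : w⁻¹ * θ a * w * a⁻¹ = 1 := by
      apply hCF.cent_p hn hs hWq
      · have : w⁻¹ * θ a * w * a⁻¹ = w⁻¹ * (θ a * a⁻¹) * (a * w * a⁻¹) := by group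
        rw [this]
        exact W.mul_mem (W.mul_mem (W.inv_mem hw) (hW a haF)) (Nz_conj (hn haF) hw)
      · intro b hb
        have hbF := hs.pc.1 hb
        have e1 : θ a * θ b = θ b * θ a := by
          rw [← hθ a haF b hbF, ← hθ b hbF a haF, hs.comm a ha b hb]
        rw [hwB b hb] at e1
        have e2 := hs.comm a ha b hb
        have e3 : a⁻¹ * b = b * a⁻¹ := by
          rw [inv_mul_eq_iff_eq_mul, ← mul_assoc, e2, mul_inv_cancel_right]
        calc b * (w⁻¹ * θ a * w * a⁻¹) = w⁻¹ * (w * b * w⁻¹ * θ a) * w * a⁻¹ := by group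
          _ = w⁻¹ * θ a * w * (b * a⁻¹) := by rw [← e1]; group
          _ = w⁻¹ * θ a * w * a⁻¹ * b := by rw [← e3]; group
    have : θ a = w * (w⁻¹ * θ a * w * a⁻¹) * a * w⁻¹ := by group
    rw [this, h1, mul_one]
  refine ⟨w, hw, fun f hf => ?_⟩
  obtain ⟨b, hb, a, ha, rfl⟩ := hs.mul hf
  rw [hθ b (hs.pc.1 hb) a (hs.syl.1 ha), hwB b hb, hA a ha]
  group

lemma L0 {q : ℕ} [hq : Fact q.Prime] {W F G : Subgroup Y} [hWn : W.Normal] (hab : ∀ x ∈ W, ∀ y ∈ W, x * y = y * x)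
    (hWq : IsPGroup q W) (hF : Group.IsNilpotent F) (hCF : CF G F) (hWG : W ≤ G) :
    CF (G.map (QuotientGroup.mk' W)) (F.map (QuotientGroup.mk' W)) := by
  rintro _ ⟨g, hg, rfl⟩ hc
  obtain ⟨w, hw, h⟩ := H1 hab hWq (le_Nz_normal hWn (X := F)) hF (hCF.mono hWG) (fun f => g * f * g⁻¹)
    (fun a _ b _ => by group) (fun f hf => by
      have h1 := hc _ ⟨f, hf, rfl⟩
      rw [← map_mul, ← map_mul] at h1
      have h2 := (QuotientGroup.eq (s := W)).1 h1
      have h3 := hWn.conj_mem _ h2 (f * g)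
      have h4 : g * f * g⁻¹ * f⁻¹ = f * g * ((f * g)⁻¹ * (g * f)) * (f * g)⁻¹ := by group
      rw [h4]; exact h3)
  have h1 : w⁻¹ * g = 1 := by
    apply hCF _ (G.mul_mem (G.inv_mem (hWG hw)) hg)
    intro f hf
    have := h f hf
    calc f * (w⁻¹ * g) = w⁻¹ * (w * f * w⁻¹) * g := by group
      _ = w⁻¹ * g * f := by rw [← this]; group
  have : g = w := by rw [inv_mul_eq_one] at h1; exact h1.symm
  rw [this]
  exact (QuotientGroup.eq_one_iff w).2 hw

end
end FrobGen

set_option linter.unusedSectionVars false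
namespace FrobGen
open Subgroup
universe u

def TC (Y : Type u) [Group Y] : Prop :=
  ∀ G F : Subgroup Y, G.Normal → Group.IsNilpotent F → G ⊔ F = ⊤ → CF G F → ∀ T : Subgroup Y, G ⊔ T = ⊤ →
    ∃ y, cj y F ≤ T

def IHyp (Y : Type u) [Group Y] : Prop :=
  ∀ (Z : Type u) [Group Z] [Finite Z], Nat.card Z < Nat.card Y → TC Z

section
variable {Y : Type u} [Group Y] [Finite Y]

def Good (F T : Subgroup Y) : Prop := ∃ y, cj y F ≤ T

lemma Good.mono {F T T' : Subgroup Y} (h : Good F T) (hle : T ≤ T') : Good F T' := by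
  obtain ⟨y, hy⟩ := h
  exact ⟨y, hy.trans hle⟩

lemma Good.of_cj {F T : Subgroup Y} {y : Y} (h : Good (cj y F) T) : Good F T := by
  obtain ⟨z, hz⟩ := h
  exact ⟨z * y, by rwa [cj_mul]⟩

lemma nilp_cj {F : Subgroup Y} (h : Group.IsNilpotent F) (y : Y) : Group.IsNilpotent (cj y F) := nilp_map h _

lemma map_cj {Y' : Type*} [Group Y'] (f : Y →* Y') (y : Y) (F : Subgroup Y) : (cj y F).map f = cj (f y) (F.map f) := by
  unfold cj
  rw [Subgroup.map_map, Subgroup.map_map]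
  congr 1
  ext x; simp

lemma sup_cj {G F : Subgroup Y} (hG : G.Normal) (h : G ⊔ F = ⊤) (y : Y) : G ⊔ cj y F = ⊤ := by
  have := congrArg (cj y) h
  rw [cj_sup, cj_normal hG] at this
  rw [this]
  exact cj_eq_of_mem (Subgroup.mem_top y)

lemma dedekind {G T Z : Subgroup Y} (hG : G.Normal) (h : G ⊔ T = ⊤) (hT : T ≤ Z) : Z ≤ (G ⊓ Z) ⊔ T := by
  intro z hz
  obtain ⟨g, hg, t, ht, rfl⟩ := exists_of_cover h z
  refine Subgroup.mul_mem_sup ⟨hg, ?_⟩ ht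
  have := Z.mul_mem hz (Z.inv_mem (hT ht))
  rwa [mul_inv_cancel_right] at this

lemma IHyp.rel (IH : IHyp Y) {Z G F T : Subgroup Y} (hZ : Z ≠ ⊤) (hGZ : G ≤ Z) (hZG : Z ≤ Nz G) (hFZ : F ≤ Z)
    (hF : Group.IsNilpotent F) (hGF : Z ≤ G ⊔ F) (hCF : CF G F) (hTZ : T ≤ Z) (hGT : Z ≤ G ⊔ T) :
    ∃ z ∈ Z, cj z F ≤ T := by
  have h := IH Z (card_sub_lt hZ) (G.subgroupOf Z) (F.subgroupOf Z) ?_ ?_ ?_ ?_ (T.subgroupOf Z) ?_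
  · obtain ⟨z, hz⟩ := h
    refine ⟨z, z.2, ?_⟩
    rw [cj_le_iff]
    intro f hf
    have h1 : z * (⟨f, hFZ hf⟩ : Z) * z⁻¹ ∈ T.subgroupOf Z := hz (cj_mem (Subgroup.mem_subgroupOf.2 hf))
    rw [mem_cj, inv_inv]
    exact Subgroup.mem_subgroupOf.1 h1
  · rw [Subgroup.normal_subgroupOf_iff hGZ]
    intro h k hh hk
    exact Nz_conj (hZG hk) hh
  · exact (Group.isNilpotent_congr (Subgroup.subgroupOfEquivOfLe hFZ)).2 hF
  · rw [← Subgroup.subgroupOf_sup hGZ hFZ, Subgroup.subgroupOf_eq_top]; exact hGF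
  · intro g hg hc
    apply Subtype.ext
    refine hCF g (Subgroup.mem_subgroupOf.1 hg) fun f hf => ?_
    exact congrArg Subtype.val (hc ⟨f, hFZ hf⟩ (Subgroup.mem_subgroupOf.2 hf))
  · rw [← Subgroup.subgroupOf_sup hGZ hTZ, Subgroup.subgroupOf_eq_top]; exact hGT

structure C0 (G F : Subgroup Y) : Prop where
  nG : G.Normal
  nil : Group.IsNilpotent F
  sup : G ⊔ F = ⊤
  cf : CF G F

lemma C0.cj {G F : Subgroup Y} (c : C0 G F) (y : Y) : C0 G (cj y F) :=
  ⟨c.nG, nilp_cj c.nil y, sup_cj c.nG c.sup y, c.cf.cj (le_Nz_normal c.nG (Subgroup.mem_top y))⟩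

lemma C0.ihs {G F : Subgroup Y} (c : C0 G F) (IH : IHyp Y) {Z T : Subgroup Y} (hZ : Z ≠ ⊤) (hTZ : T ≤ Z)
    (hT : G ⊔ T = ⊤) (h : Good F Z) : Good F T := by
  obtain ⟨y, hy⟩ := h
  have c' := c.cj y
  apply Good.of_cj (y := y)
  obtain ⟨z, -, hz⟩ := IH.rel hZ (G := G ⊓ Z) inf_le_right
    ((le_inf (le_Nz_normal c.nG) (le_Nz Z)).trans (Nz_inf_le _ _)) hy c'.nil (dedekind c.nG c'.sup hy)
    (c'.cf.mono inf_le_left) hTZ (dedekind c.nG hT hTZ)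
  exact ⟨z, hz⟩

lemma C0.quot {G F W : Subgroup Y} (c : C0 G F) (IH : IHyp Y) {q : ℕ} [hq : Fact q.Prime] (hWn : W.Normal)
    (hab : ∀ x ∈ W, ∀ y ∈ W, x * y = y * x) (hWq : IsPGroup q W) (hWG : W ≤ G) (hW : W ≠ ⊥) {T : Subgroup Y}
    (hT : G ⊔ T = ⊤) : Good F (W ⊔ T) := by
  have hnG := c.nG
  have h := IH (Y ⧸ W) (card_quot_lt hW) (G.map (QuotientGroup.mk' W)) (F.map (QuotientGroup.mk' W))
    (hnG.map _ (mk_surj W)) (nilp_map c.nil _) (by rw [← Subgroup.map_sup, c.sup, map_top_mk])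
    (L0 hab hWq c.nil c.cf hWG) (T.map (QuotientGroup.mk' W)) (by rw [← Subgroup.map_sup, hT, map_top_mk])
  obtain ⟨y', hy⟩ := h
  obtain ⟨y, rfl⟩ := mk_surj W y'
  rw [← map_cj] at hy
  refine ⟨y, fun f hf => ?_⟩
  obtain ⟨t, ht, e⟩ := hy ⟨f, hf, rfl⟩
  have h2 := (QuotientGroup.eq (s := W)).1 e
  have : f = t * (t⁻¹ * f) * t⁻¹ * t := by group
  rw [this]
  exact Subgroup.mul_mem_sup (hWn.conj_mem _ h2 t) ht

lemma C0.L1 {G F W : Subgroup Y} (c : C0 G F) (IH : IHyp Y) {q : ℕ} [hq : Fact q.Prime] (hWn : W.Normal)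
    (hab : ∀ x ∈ W, ∀ y ∈ W, x * y = y * x) (hWq : IsPGroup q W) (hWG : W ≤ G) (hW : W ≠ ⊥) {T : Subgroup Y}
    (hT : G ⊔ T = ⊤) : Good F T := by
  obtain ⟨y, hy⟩ := c.quot IH hWn hab hWq hWG hW hT
  have c' := c.cj y
  apply Good.of_cj (y := y)
  set F' := FrobGen.cj y F with hF'
  by_cases hZ : W ⊔ F' = ⊤
  · have hGW : G ≤ W := by
      intro g hg
      obtain ⟨w, hw, f, hf, e⟩ := exists_of_cover hZ g
      have h1 : f ∈ F' ⊓ G := by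
        refine ⟨hf, ?_⟩
        have : f = w⁻¹ * g := by rw [e]; group
        rw [this]
        exact G.mul_mem (G.inv_mem (hWG hw)) hg
      rw [c'.cf.inf_eq_bot c'.nil (le_Nz_normal c.nG), Subgroup.mem_bot] at h1
      rw [e, h1, mul_one]; exact hw
    have hGW : G = W := le_antisymm hGW hWG
    subst hGW
    by_cases hD : T ⊓ G = ⊥
    · have hex : ∀ y : Y, ∃ t ∈ T, t * y⁻¹ ∈ G := by
        intro y
        obtain ⟨w, hw, t, ht, e⟩ := exists_of_cover hT y
        refine ⟨t, ht, ?_⟩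
        have : t * y⁻¹ = w⁻¹ := by rw [e]; group
        rw [this]; exact G.inv_mem hw
      choose θ hθT hθ using hex
      obtain ⟨w, -, hw⟩ := H1 hab hWq (le_Nz_normal hWn (X := F')) c'.nil c'.cf θ (fun a _ b _ => by
        have : θ (a * b) * (θ a * θ b)⁻¹ ∈ T ⊓ G := by
          refine ⟨T.mul_mem (hθT _) (T.inv_mem (T.mul_mem (hθT _) (hθT _))), ?_⟩
          have : θ (a * b) * (θ a * θ b)⁻¹ =
            (θ (a * b) * (a * b)⁻¹) * (a * (θ b * b⁻¹)⁻¹ * a⁻¹) * (θ a * a⁻¹)⁻¹ := by group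
          rw [this]
          exact G.mul_mem (G.mul_mem (hθ _) (hWn.conj_mem _ (G.inv_mem (hθ b)) a)) (G.inv_mem (hθ a))
        rw [hD, Subgroup.mem_bot] at this
        exact mul_inv_eq_one.1 this) (fun b _ => hθ b)
      refine ⟨w, ?_⟩
      rw [cj_le_iff]
      intro f hf
      rw [mem_cj, inv_inv, ← hw f hf]
      exact hθT f
    · have hDn : (T ⊓ G).Normal := by
        apply normal_of_le_Nz
        rw [← hT]
        refine sup_le ?_ ((le_inf (le_Nz T) (le_Nz_normal hWn)).trans (Nz_inf_le _ _))
        intro g hg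
        apply mem_Nz_of_le
        intro x hx
        rw [hab g hg x hx.2, mul_inv_cancel_right]
        exact hx
      have := c'.quot IH hDn (fun x hx y hy => hab x hx.2 y hy.2) (hWq.to_le inf_le_right) inf_le_right hD hT
      rwa [sup_eq_right.2 inf_le_left] at this
  · obtain ⟨z, -, hz⟩ := IH.rel hZ (G := W) (F := F') (T := T ⊓ (W ⊔ F')) le_sup_left (le_Nz_normal hWn) le_sup_right
      c'.nil le_rfl (c'.cf.mono hWG) inf_le_right (by
        intro z hz
        have h1 : z ∈ W ⊔ T := (sup_le le_sup_left hy) hz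
        obtain ⟨w, hw, t, ht, rfl⟩ := (mem_sup_of_le_Nz (le_Nz_normal hWn)).1 h1
        refine Subgroup.mul_mem_sup hw ⟨ht, ?_⟩
        have := (W ⊔ F').mul_mem ((W ⊔ F').inv_mem (Subgroup.mem_sup_left hw)) hz
        rwa [inv_mul_cancel_left] at this)
    exact ⟨z, hz.trans inf_le_left⟩

/-- no normal `q`-subgroups in `G` -/
def NNH (G : Subgroup Y) : Prop :=
  ∀ q : ℕ, q.Prime → ∀ R : Subgroup Y, R ≤ G → IsPGroup q R → R.Normal → R = ⊥

lemma C0.nn {G F : Subgroup Y} (c : C0 G F) (IH : IHyp Y) (h : ¬ NNH G) {T : Subgroup Y} (hT : G ⊔ T = ⊤) : Good F T := by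
  unfold NNH at h
  push Not at h
  obtain ⟨q, hq, R, hRG, hRq, hRn, hR⟩ := h
  have : Fact q.Prime := ⟨hq⟩
  refine c.L1 IH (q := q) (W := Zp q R) (normal_of_le_Nz ((le_Nz_normal hRn).trans (Nz_le_Zp R))) ?_ (hRq.to_le (Zp_le R))
    ((Zp_le R).trans hRG) (Zp_ne_bot hRq hR) hT
  intro x hx y hy
  exact (mem_Zp.1 hy).2.2 x (Zp_le R hx)

lemma nilp_of_sylows {T : Subgroup Y} (h : ∀ q : ℕ, q.Prime → ∀ S, IsSyl q S T → T ≤ Nz S) : Group.IsNilpotent T := by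
  refine ((Group.isNilpotent_of_finite_tfae (G := T)).out 0 3 rfl rfl).2 ?_
  intro q hq S
  have h1 := h q hq.out _ (isSyl_of_sylow S)
  refine ⟨fun s hs t => ?_⟩
  have := Nz_conj (h1 t.2) (Subgroup.mem_map_of_mem T.subtype hs)
  obtain ⟨s', hs', e⟩ := this
  have : s' = t * s * t⁻¹ := Subtype.ext e
  rwa [← this]

lemma C0.quot_nil {G F : Subgroup Y} (c : C0 G F) [G.Normal] : Group.IsNilpotent (⊤ : Subgroup (Y ⧸ G)) := by
  have : (⊤ : Subgroup (Y ⧸ G)) = F.map (QuotientGroup.mk' G) := by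
    rw [← map_top_mk G, ← c.sup, Subgroup.map_sup]
    have : G.map (QuotientGroup.mk' G) = ⊥ := by
      rw [Subgroup.map_eq_bot_iff, QuotientGroup.ker_mk']
    rw [this, bot_sup_eq]
  rw [this]
  exact nilp_map c.nil _

lemma map_cover {G T : Subgroup Y} [G.Normal] (h : G ⊔ T = ⊤) : T.map (QuotientGroup.mk' G) = ⊤ := by
  rw [← map_top_mk G, ← h, Subgroup.map_sup]
  have : G.map (QuotientGroup.mk' G) = ⊥ := by
    rw [Subgroup.map_eq_bot_iff, QuotientGroup.ker_mk']
  rw [this, bot_sup_eq]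

lemma C0.minCover {G F : Subgroup Y} (c : C0 G F) {T : Subgroup Y} (hT : G ⊔ T = ⊤) :
    ∃ T' ≤ T, G ⊔ T' = ⊤ ∧ Group.IsNilpotent T' := by
  have hnG := c.nG
  obtain ⟨T', ⟨hle, hT'⟩, hmin⟩ := Set.exists_min_image {T' : Subgroup Y | T' ≤ T ∧ G ⊔ T' = ⊤}
    (fun A => Nat.card A) (Set.toFinite _) ⟨T, le_rfl, hT⟩
  refine ⟨T', hle, hT', nilp_of_sylows ?_⟩
  intro q hq S hS
  have : Fact q.Prime := ⟨hq⟩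
  have h1 := hS.map (QuotientGroup.mk' G)
  rw [map_cover hT'] at h1
  have h2 := nilp_sylow_normal c.quot_nil h1
  have h3 : ∀ t : Y, FrobGen.cj t S ≤ G ⊔ S := by
    intro t
    rw [cj_le_iff]
    intro s hs
    rw [mem_cj, inv_inv]
    have h4 := Nz_conj (h2 (Subgroup.mem_top (QuotientGroup.mk' G t))) (Subgroup.mem_map_of_mem (QuotientGroup.mk' G) hs)
    obtain ⟨s', hs', e⟩ := h4
    rw [← map_inv, ← map_mul, ← map_mul] at e
    have h5 := (QuotientGroup.eq (s := G)).1 e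
    have : t * s * t⁻¹ = s' * (s'⁻¹ * (t * s * t⁻¹)) := by group
    rw [this]
    exact (G ⊔ S).mul_mem (Subgroup.mem_sup_right hs') (Subgroup.mem_sup_left h5)
  have h4 : G ⊔ (Nz S ⊓ T') = ⊤ := by
    rw [eq_top_iff, ← hT']
    refine sup_le le_sup_left fun t ht => ?_
    have h5 : IsSyl q S ((G ⊔ S) ⊓ T') := hS.of_le (le_inf le_sup_right hS.1) inf_le_right
    have h6 : IsSyl q (FrobGen.cj t S) ((G ⊔ S) ⊓ T') :=
      (hS.cj_mem ht).of_le (le_inf (h3 t) (hS.cj_mem ht).1) inf_le_right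
    obtain ⟨x, hx, e⟩ := h6.conj h5
    obtain ⟨g, hg, s, hs, rfl⟩ := (mem_sup_of_le_Nz (le_Nz_normal hnG)).1 hx.1
    rw [← cj_mul, ← mem_Nz] at e
    have : t = (s⁻¹ * g⁻¹ * s) * (s⁻¹ * (g * s * t)) := by group
    rw [this]
    refine Subgroup.mul_mem_sup ?_ ⟨?_, ?_⟩
    · have := hnG.conj_mem _ (G.inv_mem hg) s⁻¹
      rwa [inv_inv] at this
    · exact (Nz S).mul_mem ((Nz S).inv_mem (le_Nz S hs)) e
    · exact T'.mul_mem (T'.inv_mem (hS.1 hs)) (T'.mul_mem hx.2 ht)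
  have h5 := hmin _ ⟨inf_le_right.trans hle, h4⟩
  have h6 : Nz S ⊓ T' = T' := Subgroup.eq_of_le_of_card_ge inf_le_right h5
  exact inf_eq_right.1 h6

end
end FrobGen

set_option linter.unusedSectionVars false
namespace FrobGen
open Subgroup
universe u

section
variable {Y : Type u} [Group Y] [Finite Y]

lemma IsPC.map {Y' : Type*} [Group Y'] [Finite Y'] {q : ℕ} [hq : Fact q.Prime] {N X : Subgroup Y} (h : IsPC q N X)
    (f : Y →* Y') : IsPC q (N.map f) (X.map f) := by
  obtain ⟨h1, h2, h3, h4⟩ := h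
  refine ⟨Subgroup.map_mono h1, Nz_map_le f h2, fun hd => h3 (hd.trans (Subgroup.card_map_dvd N f)), ?_⟩
  rintro _ ⟨x, hx, rfl⟩
  obtain ⟨k, hk⟩ := h4 x hx
  exact ⟨k, by rw [← map_pow]; exact Subgroup.mem_map_of_mem f hk⟩

lemma pc_le {q : ℕ} [hq : Fact q.Prime] {G T1 T2 B1 B2 : Subgroup Y} (hG : G.Normal) (h1 : G ⊔ T1 = ⊤) (h2 : G ⊔ T2 = ⊤)
    (p1 : IsPC q B1 T1) (p2 : IsPC q B2 T2) : B1 ≤ G ⊔ B2 := by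
  have e1 := p1.map (QuotientGroup.mk' G)
  have e2 := p2.map (QuotientGroup.mk' G)
  rw [map_cover h1] at e1
  rw [map_cover h2] at e2
  intro b hb
  have h3 := (e1.mem_iff (Subgroup.mem_top _)).1 (Subgroup.mem_map_of_mem (QuotientGroup.mk' G) hb)
  obtain ⟨b', hb', e⟩ := (e2.mem_iff (Subgroup.mem_top _)).2 h3
  have h5 := (QuotientGroup.eq (s := G)).1 e
  have : b = b' * (b'⁻¹ * b) := by group
  rw [this]
  exact (G ⊔ B2).mul_mem (Subgroup.mem_sup_right hb') (Subgroup.mem_sup_left h5)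

lemma syl_lift {q : ℕ} [hq : Fact q.Prime] {G T U E : Subgroup Y} (hG : G.Normal) (hT : G ⊔ T = ⊤) (hU : IsSyl q U T)
    (hE : IsPGroup q E) (hUE : U ≤ E) (hEG : E ⊓ G = ⊥) : E = U := by
  have e1 := hU.map (QuotientGroup.mk' G)
  rw [map_cover hT] at e1
  have e2 := e1.eq_of_le (hE.map (QuotientGroup.mk' G)) le_top (Subgroup.map_mono hUE)
  refine le_antisymm (fun x hx => ?_) hUE
  have h3 : QuotientGroup.mk' G x ∈ U.map (QuotientGroup.mk' G) := by
    rw [e2]; exact Subgroup.mem_map_of_mem _ hx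
  obtain ⟨u, hu, e⟩ := h3
  have h5 : u⁻¹ * x ∈ E ⊓ G := ⟨E.mul_mem (E.inv_mem (hUE hu)) hx, (QuotientGroup.eq (s := G)).1 e⟩
  rw [hEG, Subgroup.mem_bot, inv_mul_eq_one] at h5
  rw [← h5]; exact hu

lemma C0.caseT {G F : Subgroup Y} (c : C0 G F) (IH : IHyp Y) {q : ℕ} [hq : Fact q.Prime] {A B : Subgroup Y}
    (hs : Spl q F A B) (hA : A ≠ ⊥) (hAn : A.Normal) {T : Subgroup Y} (hT : G ⊔ T = ⊤) : Good F T := by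
  have hFG : F ⊓ G = ⊥ := c.cf.inf_eq_bot c.nil (le_Nz_normal c.nG)
  have hAG : A ⊓ G = ⊥ := le_bot_iff.1 ((inf_le_inf_right G hs.syl.1).trans hFG.le)
  have hBG : B ⊓ G = ⊥ := le_bot_iff.1 ((inf_le_inf_right G hs.pc.1).trans hFG.le)
  have hcB : CF G B := by
    intro g hg hc
    refine c.cf g hg fun f hf => ?_
    obtain ⟨b, hb, a, ha, rfl⟩ := hs.mul hf
    have h1 := commute_of_Nz (le_Nz_normal c.nG) (le_Nz_normal hAn) hAG ha hg
    rw [mul_assoc, h1, ← mul_assoc, hc b hb, mul_assoc]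
  have hZ : G ⊔ B ≠ ⊤ := by
    intro ht
    apply hA
    have hAB : A ⊓ B = ⊥ := inf_eq_bot_of_coprime hs.syl.2.1 hs.pc.2.2.1
    rw [← le_bot_iff, ← hAB]
    refine le_inf le_rfl fun a ha => ?_
    have hnG := c.nG
    obtain ⟨g, hg, b, hb, e⟩ := exists_of_cover ht a
    have h1 : g ∈ F ⊓ G := by
      refine ⟨?_, hg⟩
      have : g = a * b⁻¹ := by rw [e]; group
      rw [this]
      exact F.mul_mem (hs.syl.1 ha) (F.inv_mem (hs.pc.1 hb))
    rw [hFG, Subgroup.mem_bot] at h1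
    rw [e, h1, one_mul]; exact hb
  obtain ⟨T', hle, hT', hnil⟩ := c.minCover hT
  obtain ⟨U, V, ht⟩ := nilp_split hnil q
  obtain ⟨z, -, hz⟩ := IH.rel hZ (G := G) (F := B) (T := V) le_sup_left (le_Nz_normal c.nG) le_sup_right hs.nilB le_rfl
    hcB (pc_le c.nG hT' c.sup ht.pc hs.pc)
    (sup_le le_sup_left (pc_le c.nG c.sup hT' hs.pc ht.pc))
  have hU : U ≤ FrobGen.cj z F := by
    have h1 : U ≤ Nz (FrobGen.cj z B) := by
      intro x hx
      apply mem_Nz_of_le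
      intro v hv
      rw [ht.comm x hx v (hz hv), mul_inv_cancel_right]
      exact hv
    rw [Nz_cj] at h1
    exact h1.trans (cj_mono (CF.Nz_le c.nG c.sup hcB hBG (hs.pc.2.1)))
  have hUA : U ≤ A := by
    have h1 := hs.syl.cj z
    obtain ⟨x, -, hx⟩ := h1.conj_le ht.syl.2.1 hU
    rw [cj_le_iff, cj_normal hAn, cj_normal hAn] at hx
    exact hx
  have hAU : A = U := syl_lift c.nG hT' ht.syl hs.syl.2.1 hUA hAG
  refine ⟨z, ?_⟩
  rw [← hs.sup, cj_sup, cj_normal hAn]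
  refine (sup_le (hz.trans ht.pc.1) ?_).trans hle
  rw [hAU]; exact ht.syl.1

lemma syl_of_Nz {q : ℕ} [hq : Fact q.Prime] {G W : Subgroup Y} (h : IsSyl q W (Nz W ⊓ G)) : IsSyl q W G := by
  obtain ⟨S, hS, hle⟩ := exists_isSyl_ge h.2.1 (h.1.trans inf_le_right)
  rcases hle.eq_or_lt with e | hlt
  · rw [e]; exact hS
  · exfalso
    have h1 := lt_Nz_of_lt hS.2.1 hlt
    have h2 := h.eq_of_le (hS.2.1.to_le (inf_le_right : Nz W ⊓ S ≤ S)) (inf_le_inf_left _ hS.1) h1.le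
    exact h1.ne h2

lemma cover_Nz {q : ℕ} [hq : Fact q.Prime] {G T W : Subgroup Y} (hG : G.Normal) (hT : G ⊔ T = ⊤)
    (hW : IsSyl q W (T ⊓ G)) : G ⊔ (Nz W ⊓ T) = ⊤ := by
  rw [eq_top_iff, ← hT]
  refine sup_le le_sup_left fun t ht => ?_
  obtain ⟨n, hn, hnt⟩ := hW.frattini ((le_inf (le_Nz T) (le_Nz_normal hG)).trans (Nz_inf_le _ _)) ht
  have : t = n⁻¹ * (n * t) := by group
  rw [this]
  exact Subgroup.mul_mem_sup (G.inv_mem hn.2) ⟨hnt, T.mul_mem hn.1 ht⟩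

lemma Good.of_Nz {F P : Subgroup Y} (h : F ≤ Nz P) (g : Y) : Good F (Nz (FrobGen.cj g P)) :=
  ⟨g, by rw [Nz_cj]; exact cj_mono h⟩

lemma C0.step1 {G F : Subgroup Y} (c : C0 G F) (IH : IHyp Y) (nn : NNH G) {w : ℕ} [hw : Fact w.Prime] {P : Subgroup Y}
    (hP : IsSyl w P G) (hFP : F ≤ Nz P) (n : ℕ) : ∀ T W : Subgroup Y, G ⊔ T = ⊤ → IsSyl w W (T ⊓ G) → W ≠ ⊥ →
      Nat.card G - Nat.card W ≤ n → Good F T := by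
  induction n with
  | zero =>
    intro T W hT hW hne hn
    have hWG : W ≤ G := hW.1.trans inf_le_right
    have : W = G := Subgroup.eq_of_le_of_card_ge hWG (by omega)
    exfalso
    apply hne
    apply nn w hw.out W hWG hW.2.1
    rw [this]; exact c.nG
  | succ n ih =>
    intro T W hT hW hne hn
    have hWG : W ≤ G := hW.1.trans inf_le_right
    have hZ : Nz W ≠ ⊤ := by
      intro h
      exact hne (nn w hw.out W hWG hW.2.1 (Nz_eq_top.1 h))
    have hc := cover_Nz c.nG hT hW
    have hgood : Good F (Nz W) := by
      obtain ⟨W', hW', hle⟩ := exists_isSyl_ge hW.2.1 (le_inf (le_Nz W) hWG)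
      rcases hle.eq_or_lt with e | hlt
      · rw [← e] at hW'
        obtain ⟨g, -, rfl⟩ := hP.conj (syl_of_Nz hW')
        exact Good.of_Nz hFP g
      · refine ih (Nz W) W' ?_ hW' (fun hb => ?_) ?_
        · rw [eq_top_iff, ← hc]; exact sup_le_sup_left inf_le_left _
        · rw [hb] at hlt; exact not_lt_bot hlt
        · have h1 : Nat.card W < Nat.card W' := by
            by_contra hcon
            exact hlt.ne (Subgroup.eq_of_le_of_card_ge hlt.le (by omega))
          have h2 : Nat.card W' ≤ Nat.card G :=
            Nat.le_of_dvd Nat.card_pos (Subgroup.card_dvd_of_le (hW'.1.trans inf_le_right))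
          omega
    exact (c.ihs IH hZ inf_le_left hc hgood).mono inf_le_right

lemma C0.FS {G F : Subgroup Y} (c : C0 G F) (IH : IHyp Y) {q : ℕ} [hq : Fact q.Prime] {Z X R : Subgroup Y}
    (hZ : Z ≠ ⊤) (hFZ : F ≤ Z) (hXG : X ≤ G) (hXZ : X ≤ Z) (hZX : Z ≤ Nz X) (hR : IsSyl q R X) :
    ∃ y, F ≤ Nz (FrobGen.cj y R) := by
  have hc : G ⊔ (Nz R ⊓ Z) = ⊤ := by
    rw [eq_top_iff, ← c.sup]
    refine sup_le le_sup_left fun t ht => ?_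
    obtain ⟨n, hn, hnt⟩ := hR.frattini hZX (hFZ ht)
    have : t = n⁻¹ * (n * t) := by group
    rw [this]
    exact Subgroup.mul_mem_sup (G.inv_mem (hXG hn)) ⟨hnt, Z.mul_mem (hXZ hn) (hFZ ht)⟩
  obtain ⟨y, hy⟩ := c.ihs IH hZ inf_le_right hc ⟨1, by rw [cj_one]; exact hFZ⟩
  refine ⟨y⁻¹, ?_⟩
  rw [Nz_cj, ← cj_le_iff]
  exact hy.trans inf_le_left

lemma cent_le_Nz (A : Subgroup Y) : Subgroup.centralizer (A : Set Y) ≤ Nz A := by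
  intro x hx
  apply mem_Nz_of_le
  intro a ha
  rw [← Subgroup.mem_centralizer_iff.1 hx a ha, mul_inv_cancel_right]
  exact ha

lemma Nz_le_cent (A : Subgroup Y) : Nz A ≤ Nz (Subgroup.centralizer (A : Set Y)) := by
  intro x hx
  apply mem_Nz_of_le
  intro g hg
  rw [Subgroup.mem_centralizer_iff] at hg ⊢
  intro a ha
  have h1 := hg (x⁻¹ * a * x) (by
    have := Nz_conj (inv_mem hx) ha
    rwa [inv_inv] at this)
  have h2 : x * (x⁻¹ * a * x * g) * x⁻¹ = x * (g * (x⁻¹ * a * x)) * x⁻¹ := by rw [h1]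
  have e1 : a * (x * g * x⁻¹) = x * (x⁻¹ * a * x * g) * x⁻¹ := by group
  rw [e1, h2]; group

/-- fixed `q`-elements -/
lemma q_fixed {q : ℕ} [hq : Fact q.Prime] {G A : Subgroup Y} (hG : G.Normal) (hA : IsPGroup q A) (hd : q ∣ Nat.card G) :
    q ∣ Nat.card (G ⊓ Subgroup.centralizer (A : Set Y) : Subgroup Y) := by
  obtain ⟨Q, hQ, hle⟩ := exists_isSyl_ge hA (le_top : A ≤ ⊤)
  have h1 := hQ.inf (le_Nz_normal hG) (le_top : G ≤ ⊤)
  obtain ⟨w, hw, hw1, hc⟩ := exists_fixed hA (pGroup_dvd h1.2.1 (h1.ne_bot hd))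
    ((le_inf (hle.trans (le_Nz Q)) (le_Nz_normal hG)).trans (Nz_inf_le _ _))
  have hm : w ∈ (G ⊓ Subgroup.centralizer (A : Set Y)) ⊓ Q :=
    ⟨⟨hw.2, Subgroup.mem_centralizer_iff.2 fun a ha => hc a ha⟩, hw.1⟩
  refine (pGroup_dvd (hQ.2.1.to_le (inf_le_right : (G ⊓ Subgroup.centralizer (A : Set Y)) ⊓ Q ≤ Q)) ?_).trans
    (Subgroup.card_dvd_of_le inf_le_left)
  intro hb
  rw [hb] at hm
  exact hw1 (Subgroup.mem_bot.1 hm)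

lemma C0.step2 {G F : Subgroup Y} (c : C0 G F) (IH : IHyp Y) (nn : NNH G) {q : ℕ} [hq : Fact q.Prime] {A B : Subgroup Y}
    (hs : Spl q F A B) (hA : Nz A ≠ ⊤) (hd : q ∣ Nat.card G) : ∃ P, IsSyl q P G ∧ F ≤ Nz P := by
  have h1 := q_fixed c.nG hs.syl.2.1 hd
  obtain ⟨R1, hR1⟩ := exists_isSyl q (G ⊓ Subgroup.centralizer (A : Set Y))
  obtain ⟨y, hy⟩ := c.FS IH hA hs.nA inf_le_left (inf_le_right.trans (cent_le_Nz A))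
    ((le_inf (le_Nz_normal c.nG) (Nz_le_cent A)).trans (Nz_inf_le _ _)) hR1
  have hle : ∀ (y : Y) {R : Subgroup Y}, R ≤ G → FrobGen.cj y R ≤ G := by
    intro y R h
    have := cj_mono (g := y) h
    rwa [cj_normal c.nG] at this
  obtain ⟨R, ⟨hRG, hRq, hFR⟩, hmax⟩ := Set.exists_max_image {R : Subgroup Y | R ≤ G ∧ IsPGroup q R ∧ F ≤ Nz R}
    (fun A => Nat.card A) (Set.toFinite _) ⟨_, hle y (hR1.1.trans inf_le_left), isPGroup_cj y hR1.2.1, hy⟩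
  refine ⟨R, ?_, hFR⟩
  have h2 : Nat.card R1 ≤ Nat.card R := by
    have := hmax _ ⟨hle y (hR1.1.trans inf_le_left), isPGroup_cj y hR1.2.1, hy⟩
    simpa [card_cj] using this
  have hZ : Nz R ≠ ⊤ := by
    intro h
    have := nn q hq.out R hRG hRq (Nz_eq_top.1 h)
    rw [this, Subgroup.card_bot] at h2
    exact hR1.ne_bot h1 (Subgroup.card_eq_one.1 (le_antisymm h2 Nat.card_pos))
  obtain ⟨R2, hR2, hle2⟩ := exists_isSyl_ge hRq (le_inf (le_Nz R) hRG)
  obtain ⟨y2, hy2⟩ := c.FS IH hZ hFR inf_le_right inf_le_left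
    ((le_inf (le_Nz _) (le_Nz_normal c.nG)).trans (Nz_inf_le _ _)) hR2
  have h3 := hmax _ ⟨hle y2 (hR2.1.trans inf_le_right), isPGroup_cj y2 hR2.2.1, hy2⟩
  simp only [card_cj] at h3
  have : R = R2 := Subgroup.eq_of_le_of_card_ge hle2 h3
  rw [← this] at hR2
  exact syl_of_Nz hR2

lemma C0.main {G F : Subgroup Y} (c : C0 G F) (IH : IHyp Y) {T : Subgroup Y} (hT : G ⊔ T = ⊤) : Good F T := by
  by_cases nn : NNH G
  swap
  · exact c.nn IH nn hT
  by_cases hF : F = ⊥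
  · refine ⟨1, ?_⟩
    rw [cj_one, hF]; exact bot_le
  have h2 : Nat.card F ≠ 1 := fun h => hF (Subgroup.card_eq_one.1 h)
  obtain ⟨q, hq, hqF⟩ := Nat.exists_prime_and_dvd h2
  have : Fact q.Prime := ⟨hq⟩
  obtain ⟨A, B, hs⟩ := nilp_split c.nil q
  have hA := hs.syl.ne_bot hqF
  by_cases hAn : A.Normal
  · exact c.caseT IH hs hA hAn hT
  have hNA : Nz A ≠ ⊤ := fun h => hAn (Nz_eq_top.1 h)
  obtain ⟨T', hle, hT', hnil⟩ := c.minCover hT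
  refine Good.mono ?_ hle
  obtain ⟨U, V, ht⟩ := nilp_split hnil q
  have hZc : G ⊔ Nz U = ⊤ := by
    rw [eq_top_iff, ← hT']; exact sup_le_sup_left ht.nA _
  have hgood : Good F (Nz U) := by
    by_cases hd : q ∣ Nat.card G
    · obtain ⟨P, hP, hFP⟩ := c.step2 IH nn hs hNA hd
      have h1 := (q_fixed c.nG ht.syl.2.1 hd).trans
        (Subgroup.card_dvd_of_le (le_inf (inf_le_right.trans (cent_le_Nz U)) inf_le_left))
      obtain ⟨W, hW⟩ := exists_isSyl q (Nz U ⊓ G)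
      exact c.step1 IH nn hP hFP _ (Nz U) W hZc hW (hW.ne_bot h1) le_rfl
    · have key : ∀ {S U : Subgroup Y}, G ⊔ S = ⊤ → IsSyl q U S → IsSyl q U ⊤ := by
        intro S U hS hU
        obtain ⟨Q, hQ, hleQ⟩ := exists_isSyl_ge hU.2.1 (le_top : U ≤ ⊤)
        rw [← syl_lift c.nG hS hU hQ.2.1 hleQ (inf_eq_bot_of_coprime hQ.2.1 hd)]
        exact hQ
      obtain ⟨x, -, rfl⟩ := (key c.sup hs.syl).conj (key hT' ht.syl)
      exact Good.of_Nz hs.nA x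
  by_cases hZ : Nz U = ⊤
  swap
  · exact c.ihs IH hZ ht.nA hT' hgood
  exfalso
  have hUn : U.Normal := Nz_eq_top.1 hZ
  have hGn := c.nG
  have hUG : U ⊓ G = ⊥ := nn q hq _ inf_le_right (ht.syl.2.1.to_le inf_le_left) inferInstance
  have hBU : ∀ u ∈ U, ∀ b ∈ B, u * b = b * u := by
    intro u hu b hb
    obtain ⟨g, hg, v, hv, rfl⟩ := (mem_sup_of_le_Nz (le_Nz_normal c.nG)).1 (pc_le c.nG c.sup hT' hs.pc ht.pc hb)
    have h1 := commute_of_Nz (le_Nz_normal c.nG) (le_Nz_normal hUn) hUG hu hg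
    rw [← mul_assoc, h1, mul_assoc, ht.comm u hu v hv, mul_assoc]
  have hE : IsPGroup q (A ⊔ U : Subgroup Y) := IsPGroup.to_sup_of_normal_right hs.syl.2.1 ht.syl.2.1
  have hEG : (A ⊔ U) ⊓ G = ⊥ := by
    by_contra hne
    have h1 := pGroup_dvd (hE.to_le (inf_le_left : (A ⊔ U) ⊓ G ≤ A ⊔ U)) hne
    apply c.cf.cent (le_Nz_normal c.nG) hs
    refine h1.trans (Subgroup.card_dvd_of_le (le_inf inf_le_right (inf_le_left.trans (sup_le ?_ ?_))))
    · exact fun a ha => Subgroup.mem_centralizer_iff.2 fun b hb => (hs.comm a ha b hb).symm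
    · exact fun a ha => Subgroup.mem_centralizer_iff.2 fun b hb => (hBU a ha b hb).symm
  have e1 := syl_lift c.nG c.sup hs.syl hE le_sup_left hEG
  have e2 := syl_lift c.nG hT' ht.syl hE le_sup_right hEG
  exact hAn (by rw [← e1, e2]; exact hUn)

end

theorem tc_aux (n : ℕ) : ∀ (Y : Type u) [Group Y] [Finite Y], Nat.card Y = n → TC Y := by
  induction n using Nat.strong_induction_on with
  | _ n ih =>
    intro Y _ _ hn G F h1 h2 h3 h4 T hT
    refine C0.main ⟨h1, h2, h3, h4⟩ (fun Z _ _ hZ => ?_) hT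
    exact ih _ (hn ▸ hZ) Z rfl

theorem tc (Y : Type u) [Group Y] [Finite Y] : TC Y := tc_aux _ Y rfl

end FrobGen

set_option linter.unusedSectionVars false
namespace FrobGen
open Subgroup
universe u

section
variable {Y : Type u} [Group Y] [Finite Y]

lemma tc_rel {Z G F T : Subgroup Y} (hGZ : G ≤ Z) (hZG : Z ≤ Nz G) (hFZ : F ≤ Z)
    (hF : Group.IsNilpotent F) (hGF : Z ≤ G ⊔ F) (hCF : CF G F) (hTZ : T ≤ Z) (hGT : Z ≤ G ⊔ T) :
    ∃ z ∈ Z, cj z F ≤ T := by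
  have h := tc Z (G.subgroupOf Z) (F.subgroupOf Z) ?_ ?_ ?_ ?_ (T.subgroupOf Z) ?_
  · obtain ⟨z, hz⟩ := h
    refine ⟨z, z.2, ?_⟩
    rw [cj_le_iff]
    intro f hf
    have h1 : z * (⟨f, hFZ hf⟩ : Z) * z⁻¹ ∈ T.subgroupOf Z := hz (cj_mem (Subgroup.mem_subgroupOf.2 hf))
    rw [mem_cj, inv_inv]
    exact Subgroup.mem_subgroupOf.1 h1
  · rw [Subgroup.normal_subgroupOf_iff hGZ]
    intro h k hh hk
    exact Nz_conj (hZG hk) hh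
  · exact (Group.isNilpotent_congr (Subgroup.subgroupOfEquivOfLe hFZ)).2 hF
  · rw [← Subgroup.subgroupOf_sup hGZ hFZ, Subgroup.subgroupOf_eq_top]; exact hGF
  · intro g hg hc
    apply Subtype.ext
    refine hCF g (Subgroup.mem_subgroupOf.1 hg) fun f hf => ?_
    exact congrArg Subtype.val (hc ⟨f, hFZ hf⟩ (Subgroup.mem_subgroupOf.2 hf))
  · rw [← Subgroup.subgroupOf_sup hGZ hTZ, Subgroup.subgroupOf_eq_top]; exact hGT

lemma dedekind' {G T Z : Subgroup Y} (hG : G.Normal) (h : Z ≤ G ⊔ T) (hT : T ≤ Z) : Z ≤ (G ⊓ Z) ⊔ T := by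
  intro z hz
  obtain ⟨g, hg, t, ht, rfl⟩ := (mem_sup_of_le_Nz (le_Nz_normal hG)).1 (h hz)
  refine Subgroup.mul_mem_sup ⟨hg, ?_⟩ ht
  have := Z.mul_mem hz (Z.inv_mem (hT ht))
  rwa [mul_inv_cancel_right] at this

lemma inv_sylow_unique {G F P Q : Subgroup Y} (hG : G.Normal) (hF : Group.IsNilpotent F) (hcf : CF G F)
    {p : ℕ} [hp : Fact p.Prime] (hP : IsSyl p P G) (hFP : F ≤ Nz P) (hQ : IsSyl p Q G) (hFQ : F ≤ Nz Q) : P = Q := by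
  obtain ⟨g, hg, rfl⟩ := hP.conj hQ
  rw [Nz_cj] at hFQ
  have hF' : cj g⁻¹ F ≤ Nz P := by rw [cj_le_iff, inv_inv]; exact hFQ
  set Z := Nz P ⊓ (G ⊔ F) with hZ
  have hF'Z : cj g⁻¹ F ≤ Z := le_inf hF' (cj_le_of_le le_sup_right (Subgroup.mem_sup_left (G.inv_mem hg)) |>.trans le_rfl)
  have hFZ : F ≤ Z := le_inf hFP le_sup_right
  have hsup : Z ≤ G ⊔ cj g⁻¹ F := by
    refine inf_le_right.trans (sup_le le_sup_left fun f hf => ?_)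
    have : f = g * (g⁻¹ * f * g⁻¹⁻¹) * g⁻¹ := by group
    rw [this]
    exact (G ⊔ cj g⁻¹ F).mul_mem ((G ⊔ cj g⁻¹ F).mul_mem (Subgroup.mem_sup_left hg) (Subgroup.mem_sup_right (cj_mem hf)))
      (Subgroup.mem_sup_left (G.inv_mem hg))
  have hd := dedekind' hG (inf_le_right : Z ≤ G ⊔ F) hFZ
  obtain ⟨z, hz, hzF⟩ := tc_rel (Z := Z) (G := G ⊓ Z) (F := cj g⁻¹ F) (T := F) inf_le_right
    ((le_inf (le_Nz_normal hG) (le_Nz _)).trans (Nz_inf_le _ _)) hF'Z (nilp_cj hF _)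
    (dedekind' hG hsup hF'Z) ((hcf.cj (le_Nz_normal hG (Subgroup.mem_top g⁻¹))).mono inf_le_left) hFZ hd
  have hFn : F ≤ Nz (G ⊓ Z) := (le_inf (le_Nz_normal hG) (hFZ.trans (le_Nz Z))).trans (Nz_inf_le _ _)
  obtain ⟨x, hx, f, hf, e⟩ := (mem_sup_of_le_Nz hFn).1 (hd hz)
  have h1 : cj (z * g⁻¹) F = F := by
    rw [cj_mul]
    exact Subgroup.eq_of_le_of_card_ge hzF (by rw [card_cj, card_cj])
  have h2 : (f⁻¹ * x * f) * g⁻¹ ∈ Nz F := by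
    have h3 : f⁻¹ * (z * g⁻¹) ∈ Nz F := (Nz F).mul_mem ((Nz F).inv_mem (le_Nz F hf)) (mem_Nz.2 h1)
    have : f⁻¹ * x * f * g⁻¹ = f⁻¹ * (z * g⁻¹) := by rw [e]; group
    rwa [this]
  have h4 : f⁻¹ * x * f ∈ G ⊓ Z := by
    have := Nz_conj (hFn (F.inv_mem hf)) hx
    rwa [inv_inv] at this
  have h3 := hcf.Nz_inf (hcf.inf_eq_bot hF (le_Nz_normal hG)) (le_Nz_normal hG) (G.mul_mem h4.1 (G.inv_mem hg)) h2
  have h5 : f⁻¹ * x * f = g := mul_inv_eq_one.1 h3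
  rw [h5] at h4
  exact (mem_Nz.1 h4.2.1).symm

/-- existence of an invariant Sylow subgroup, also invariant under the normalizer of `F` -/
theorem exists_inv_sylow {G F : Subgroup Y} (hG : G.Normal) (hF : Group.IsNilpotent F) (hcf : CF G F)
    (p : ℕ) [hp : Fact p.Prime] : ∃ P, IsSyl p P G ∧ Nz F ≤ Nz P := by
  obtain ⟨S, hS⟩ := exists_isSyl p G
  obtain ⟨z, -, hzF⟩ := tc_rel (Z := G ⊔ F) (G := G) (F := F) (T := Nz S ⊓ (G ⊔ F)) le_sup_left (le_Nz_normal hG)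
    le_sup_right hF le_rfl hcf inf_le_right (by
      intro t ht
      obtain ⟨n, hn, hnt⟩ := hS.frattini (le_Nz_normal hG) (Subgroup.mem_top t)
      have : t = n⁻¹ * (n * t) := by group
      rw [this]
      exact Subgroup.mul_mem_sup (G.inv_mem hn) ⟨hnt, (G ⊔ F).mul_mem (Subgroup.mem_sup_left hn) ht⟩)
  have hP : IsSyl p (cj z⁻¹ S) G := by
    have := hS.cj z⁻¹
    rwa [cj_normal hG] at this
  have hFP : F ≤ Nz (cj z⁻¹ S) := by
    rw [Nz_cj, ← cj_le_iff]; exact hzF.trans inf_le_left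
  refine ⟨_, hP, fun h hh => mem_Nz.2 ?_⟩
  have h1 := hP.cj h
  rw [cj_normal hG] at h1
  refine (inv_sylow_unique hG hF hcf hP hFP h1 ?_).symm
  rw [Nz_cj h]
  have := cj_mono (g := h) hFP
  rwa [mem_Nz.1 hh] at this

/-! Part IV -/

def Lc (P B H : Subgroup Y) : Subgroup Y :=
  Subgroup.closure {x | ∃ b ∈ B, ∃ c ∈ P, (∀ h ∈ H, h * c = c * h) ∧ x = b * c * b⁻¹}

lemma Lc_mono {P P' B B' H : Subgroup Y} (h : P ≤ P') (hB : B ≤ B') : Lc P B H ≤ Lc P' B' H := by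
  apply Subgroup.closure_mono
  rintro x ⟨b, hb, c, hc, h1, rfl⟩
  exact ⟨b, hB hb, c, h hc, h1, rfl⟩

def Fpf (H B : Subgroup Y) : Prop := ∀ h ∈ H, h ≠ 1 → ∀ b ∈ B, h * b = b * h → b = 1

open scoped IsMulCommutative in
lemma inv_exists {N : Subgroup Y} [IsMulCommutative N] {n : ℕ} (hc : Nat.Coprime n (Nat.card N)) :
    ∃ u : ℤ, ∀ x : Additive N, u • (n • x) = x := by
  obtain ⟨u, v, huv⟩ := Nat.isCoprime_iff_coprime.2 hc
  refine ⟨u, fun x => ?_⟩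
  have h3 : (Nat.card N) • x = 0 := by
    apply val_inj
    rw [val_nsmul, val_zero, pow_card_mem (val_mem x)]
  calc u • (n • x) = (u * (n : ℤ)) • x + v • ((Nat.card N) • x) := by
        rw [h3, smul_zero, add_zero, mul_smul, natCast_zsmul]
    _ = (u * (n : ℤ) + v * (Nat.card N : ℤ)) • x := by
        rw [add_smul, mul_smul v, natCast_zsmul]
    _ = x := by rw [huv, one_smul]

open scoped IsMulCommutative in
lemma norm_zero {N B : Subgroup Y} [IsMulCommutative N] [Fintype B] (hBN : B ≤ Nz N) (hcf : CF N B) :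
    ∑ b : B, ac N b = 0 := by
  refine DFunLike.ext _ _ fun x => ?_
  set S := (∑ b : B, ac N b) x with hS
  have h1 : ∀ c : B, ac N c S = S := by
    intro c
    have : ac N c * ∑ b : B, ac N b = ∑ b : B, ac N b := by
      rw [Finset.mul_sum, ← Equiv.sum_comp (Equiv.mulLeft c) (fun b : B => ac N b)]
      refine Finset.sum_congr rfl fun b _ => ?_
      rw [← ac_mul (hBN c.2) (hBN b.2)]; rfl
    exact congrArg (fun e : AddMonoid.End (Additive N) => e x) this
  apply val_inj
  change val S = val 0
  rw [val_zero]
  refine hcf _ (val_mem S) fun b hb => ?_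
  have h2 := congrArg val (h1 ⟨b, hb⟩)
  rw [val_ac (hBN hb)] at h2
  exact mul_inv_eq_iff_eq_mul.1 h2

open scoped IsMulCommutative in
lemma val_sum_mem {N L : Subgroup Y} [IsMulCommutative N] {ι : Type*} (s : Finset ι) (f : ι → Additive N)
    (h : ∀ i ∈ s, val (f i) ∈ L) : val (∑ i ∈ s, f i) ∈ L := by
  classical
  induction s using Finset.induction_on with
  | empty => rw [Finset.sum_empty, val_zero]; exact L.one_mem
  | insert a s ha ih =>
    rw [Finset.sum_insert ha, val_add]
    exact L.mul_mem (h a (Finset.mem_insert_self a s)) (ih fun i hi => h i (Finset.mem_insert_of_mem hi))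

open scoped IsMulCommutative in
lemma ab_case {N B H : Subgroup Y} [IsMulCommutative N] (hBN : B ≤ Nz N) (hHN : H ≤ Nz N) (hHB : H ≤ Nz B)
    (hc : Nat.Coprime (Nat.card B) (Nat.card N)) (hcf : CF N B) (hf : Fpf H B) : N ≤ Lc N B H := by
  classical
  have := Fintype.ofFinite B
  have := Fintype.ofFinite H
  have hG := G1 (M := Additive N) (B := B) (ι := H) (fun b => ac N b) (ac_one) (fun a b => ac_mul (hBN a.2) (hBN b.2))
    (fun h => ac N h) (fun h b => ⟨h * b * (h : Y)⁻¹, Nz_conj (hHB h.2) b.2⟩) 1 ac_one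
    (fun b => Subtype.ext (by simp)) (fun h b => by
      rw [← ac_mul (hHN h.2) (hBN b.2), ← ac_mul (hBN (Nz_conj (hHB h.2) b.2)) (hHN h.2)]
      congr 1; group) (fun h b => Subtype.ext (by simp [mul_assoc]))
    (fun h hh => by
      intro b b' e
      have e := congrArg Subtype.val e
      simp only [Subgroup.coe_mul, Subgroup.coe_inv] at e
      have h1 := hf h h.2 (fun h1 => hh (Subtype.ext h1)) ((b' : Y)⁻¹ * b) (B.mul_mem (B.inv_mem b'.2) b.2) (by
        have e2 : (b' : Y)⁻¹ * b * h * ((b : Y)⁻¹ * b') = h := by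
          calc (b' : Y)⁻¹ * b * h * ((b : Y)⁻¹ * b') = (b' : Y)⁻¹ * (b * ((h : Y) * b * (h : Y)⁻¹)⁻¹) * h * b' := by group
            _ = h := by rw [e]; group
        calc (h : Y) * ((b' : Y)⁻¹ * b) = ((b' : Y)⁻¹ * b * h * ((b : Y)⁻¹ * b')) * ((b' : Y)⁻¹ * b) := by rw [e2]
          _ = _ := by group)
      rw [inv_mul_eq_one] at h1
      exact Subtype.ext h1.symm)
  simp only [norm_zero hBN hcf, zero_mul, Finset.sum_const_zero, add_zero] at hG
  obtain ⟨u, hu⟩ := inv_exists hc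
  intro x hx
  have h1 : val ((Nat.card B) • (mk hx : Additive N)) ∈ Lc N B H := by
    have h2 := congrArg (fun e : AddMonoid.End (Additive N) => e (mk hx)) hG
    have h3 : (Nat.card B) • (mk hx : Additive N) =
        ∑ b : B, ac N b ((∑ h : H, ac N h) (ac N (b : Y)⁻¹ (mk hx))) := by
      rw [Nat.card_eq_fintype_card]
      refine Eq.trans h2.symm ?_
      exact AddMonoidHom.finsetSum_apply
        (fun b : B => ac N b * (∑ h : H, ac N h) * ac N ((b⁻¹ : B) : Y)) Finset.univ (mk hx)
    rw [h3]
    apply val_sum_mem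
    intro b _
    rw [val_ac (hBN b.2)]
    apply Subgroup.subset_closure
    refine ⟨b, b.2, _, val_mem _, fun k hk => ?_, rfl⟩
    set y := ac N (b : Y)⁻¹ (mk hx)
    have h4 : ac N k ((∑ h : H, ac N h) y) = (∑ h : H, ac N h) y := by
      have : ac N k * ∑ b : H, ac N b = ∑ b : H, ac N b := by
        rw [Finset.mul_sum, ← Equiv.sum_comp (Equiv.mulLeft (⟨k, hk⟩ : H)) (fun b : H => ac N b)]
        refine Finset.sum_congr rfl fun b _ => ?_
        rw [← ac_mul (hHN hk) (hHN b.2)]; rfl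
      exact congrArg (fun e : AddMonoid.End (Additive N) => e y) this
    have h5 := congrArg val h4
    rw [val_ac (hHN hk)] at h5
    exact mul_inv_eq_iff_eq_mul.1 h5
  have h2 := congrArg val (hu (mk hx))
  rw [val_mk, val_zsmul] at h2
  rw [← h2]
  exact Subgroup.zpow_mem _ h1 u

end
end FrobGen

set_option linter.unusedSectionVars false
namespace FrobGen
open Subgroup
universe u

section
variable {Y : Type u} [Group Y] [Finite Y]

/-- orbit representatives -/
lemma exists_reps (H : Subgroup Y) : ∃ r : Y → Y, (∀ f, ∃ h ∈ H, r f = h * f * h⁻¹) ∧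
    ∀ f, ∀ h ∈ H, r (h * f * h⁻¹) = r f := by
  let s : Setoid Y := ⟨fun a b => ∃ h ∈ H, b = h * a * h⁻¹, fun a => ⟨1, H.one_mem, by simp⟩, by
    rintro a b ⟨h, hh, rfl⟩
    exact ⟨h⁻¹, H.inv_mem hh, by group⟩, by
    rintro a b c ⟨h, hh, rfl⟩ ⟨k, hk, rfl⟩
    exact ⟨k * h, H.mul_mem hk hh, by group⟩⟩
  refine ⟨fun f => (Quotient.mk s f).out, fun f => ?_, fun f h hh => ?_⟩
  · exact Setoid.symm (Quotient.mk_out (s := s) f)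
  · have : Quotient.mk s (h * f * h⁻¹) = Quotient.mk s f := (Quotient.sound (s := s) (⟨h, hh, rfl⟩ : s.r _ _)).symm
    simp only [this]

open scoped IsMulCommutative in
lemma trace_one {N B H : Subgroup Y} [IsMulCommutative N] (hBN : B ≤ Nz N) (hHN : H ≤ Nz N) (hHB : H ≤ Nz B)
    [Fintype H] [Fintype B]
    (hcf : CF N B) (hf : Fpf H B) : ∃ θ : AddMonoid.End (Additive N),
      ∑ h : H, ac N h * θ * ac N (h : Y)⁻¹ = (Nat.card B) • 1 := by
  classical
  obtain ⟨r, hr1, hr2⟩ := exists_reps H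
  let χ : Y → AddMonoid.End (Additive N) := fun f => if r f = f then 1 else 0
  have hχ : ∀ f ∈ B, f ≠ 1 → ∑ h : H, χ ((h : Y)⁻¹ * f * h) = 1 := by
    intro f hfB hf1
    obtain ⟨k, hk, e⟩ := hr1 f
    rw [Finset.sum_eq_single (⟨k⁻¹, H.inv_mem hk⟩ : H)]
    · have h1 := hr2 f k hk
      simp only [χ, inv_inv]
      rw [h1, if_pos e]
    · intro h _ hne
      have h1 := hr2 f (h : Y)⁻¹ (H.inv_mem h.2)
      rw [inv_inv] at h1
      simp only [χ]
      rw [h1, if_neg]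
      intro h2
      apply hne
      apply Subtype.ext
      change (h : Y) = k⁻¹
      by_contra hh
      apply hf1
      apply hf (h * k) (H.mul_mem h.2 hk) (fun h3 => hh (mul_eq_one_iff_eq_inv.1 h3)) f hfB
      rw [e] at h2
      calc (h : Y) * k * f = h * (k * f * k⁻¹) * k := by group
        _ = f * (h * k) := by rw [h2]; group
    · intro h; exact absurd (Finset.mem_univ _) h
  refine ⟨∑ b : B, χ b * (1 - ac N b), ?_⟩
  have h1 : ∀ h : H, ac N h * (∑ b : B, χ b * (1 - ac N b)) * ac N (h : Y)⁻¹ =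
      ∑ b : B, χ ((h : Y)⁻¹ * b * h) * (1 - ac N b) := by
    intro h
    have hb : ∀ b : B, (h : Y)⁻¹ * b * h ∈ B := by
      intro b
      have := Nz_conj (hHB (H.inv_mem h.2)) b.2
      rwa [inv_inv] at this
    let e : B ≃ B :=
      { toFun := fun b => ⟨h * b * (h : Y)⁻¹, Nz_conj (hHB h.2) b.2⟩
        invFun := fun b => ⟨(h : Y)⁻¹ * b * h, hb b⟩
        left_inv := fun b => Subtype.ext (by simp [mul_assoc])
        right_inv := fun b => Subtype.ext (by simp [mul_assoc]) }
    refine Eq.trans ?_ (Equiv.sum_comp e (fun b : B => χ ((h : Y)⁻¹ * b * h) * (1 - ac N b)))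
    rw [Finset.mul_sum, Finset.sum_mul]
    refine Finset.sum_congr rfl fun b _ => ?_
    have e1 : (h : Y)⁻¹ * (e b) * h = b := by
      change (h : Y)⁻¹ * (h * b * (h : Y)⁻¹) * h = b
      group
    have hcm : ac N h * (χ b * (1 - ac N b)) = χ b * (ac N h * (1 - ac N b)) := by
      simp only [χ]
      split_ifs <;> simp
    simp only [e1]
    rw [hcm, mul_assoc]
    congr 1
    rw [mul_sub, sub_mul, mul_one, ← ac_mul (hHN h.2) (hHN (H.inv_mem h.2)),
      ← ac_mul (hHN h.2) (hBN b.2), ← ac_mul ((Nz N).mul_mem (hHN h.2) (hBN b.2)) (hHN (H.inv_mem h.2)),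
      mul_inv_cancel, ac_one]
    rfl
  simp only [h1]
  rw [Finset.sum_comm]
  have h2 : ∀ b : B, ∑ h : H, χ ((h : Y)⁻¹ * b * h) * (1 - ac N b) = 1 - ac N b := by
    intro b
    rw [← Finset.sum_mul]
    by_cases hb : (b : Y) = 1
    · rw [hb, ac_one, sub_self, mul_zero]
    · rw [hχ b b.2 hb, one_mul]
  simp only [h2]
  rw [Finset.sum_sub_distrib, norm_zero hBN hcf, sub_zero, Finset.sum_const, Finset.card_univ, Nat.card_eq_fintype_card]

open scoped IsMulCommutative in
lemma lift_fix {N B H : Subgroup Y} [IsMulCommutative N] (hBN : B ≤ Nz N) (hHN : H ≤ Nz N) (hHB : H ≤ Nz B)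
    (hc : Nat.Coprime (Nat.card B) (Nat.card N)) (hcf : CF N B) (hf : Fpf H B) {c : Y}
    (hcN : ∀ h ∈ H, c * h * c⁻¹ * h⁻¹ ∈ N) : ∃ n ∈ N, ∀ h ∈ H, h * (n * c) = n * c * h := by
  classical
  have := Fintype.ofFinite B
  have := Fintype.ofFinite H
  obtain ⟨θ, hθ⟩ := trace_one hBN hHN hHB hcf hf
  obtain ⟨u, hu⟩ := inv_exists hc
  let δ : H → Additive N := fun h => mk (hcN h h.2)
  have hδ : ∀ a b : H, δ (a * b) = δ a + ac N a (δ b) := by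
    intro a b
    apply val_inj
    rw [val_add, val_ac (hHN a.2)]
    simp only [δ, val_mk]
    rw [Subgroup.coe_mul]
    group
  set v : Additive N := ∑ k : H, ac N k (θ (δ k⁻¹)) with hv
  have h1 : ∀ h : H, ac N h v = v + (Nat.card B) • δ h := by
    intro h
    have e1 : ac N h v = ∑ k : H, ac N ((h * k : H) : Y) (θ (δ ((h * k)⁻¹ * h))) := by
      rw [hv, map_sum]
      refine Finset.sum_congr rfl fun k _ => ?_
      have e2 : (h * k)⁻¹ * h = k⁻¹ := by group
      rw [e2, Subgroup.coe_mul, ac_mul (hHN h.2) (hHN k.2)]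
      rfl
    refine (e1.trans (Equiv.sum_comp (Equiv.mulLeft h) (fun m : H => ac N (m : Y) (θ (δ (m⁻¹ * h)))))).trans ?_
    simp only [hδ, map_add, Finset.sum_add_distrib]
    congr 1
    have e3 := congrArg (fun e : AddMonoid.End (Additive N) => e (δ h)) hθ
    refine Eq.trans ?_ e3
    exact (AddMonoidHom.finsetSum_apply
        (fun h : H => ac N h * θ * ac N (h : Y)⁻¹) Finset.univ (δ h)).symm
  refine ⟨val (u • v), val_mem _, fun h hh => ?_⟩
  have h2 := congrArg (fun x => val (u • x)) (h1 ⟨h, hh⟩)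
  simp only [smul_add, hu] at h2
  rw [← map_zsmul, val_ac (hHN hh), val_add] at h2
  simp only [δ, val_mk] at h2
  have h3 := mul_inv_eq_iff_eq_mul.1 h2
  rw [← mul_assoc, h3]
  group

end

theorem partIV_aux {p : ℕ} [hp : Fact p.Prime] (n : ℕ) : ∀ (Y : Type u) [Group Y] [Finite Y] (P B H : Subgroup Y),
    Nat.card P = n → P.Normal → IsPGroup p P → Group.IsNilpotent B → H ≤ Nz B → ¬ p ∣ Nat.card B → CF P B → Fpf H B →
      P ≤ Lc P B H := by
  induction n using Nat.strong_induction_on with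
  | _ n ih =>
    intro Y _ _ P B H hn hPn hPp hBn hHB hpB hcf hf
    by_cases hP : P = ⊥
    · rw [hP]; exact bot_le
    set N := Zp p P with hN
    have hNP : N ≤ P := Zp_le P
    have hNn : N.Normal := normal_of_le_Nz ((le_Nz_normal hPn).trans (Nz_le_Zp P))
    have hNb : N ≠ ⊥ := Zp_ne_bot hPp hP
    have hab : ∀ x ∈ N, ∀ y ∈ N, x * y = y * x := fun x hx y hy => (mem_Zp.1 hy).2.2 x (hNP hx)
    have hcomm : IsMulCommutative N := ⟨⟨fun a b => Subtype.ext (hab a a.2 b b.2)⟩⟩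
    have hNp := hPp.to_le hNP
    have hc : Nat.Coprime (Nat.card B) (Nat.card N) := by
      obtain ⟨n, hn⟩ := hNp.exists_card_eq
      rw [hn]
      exact (Nat.Coprime.pow_left n ((hp.out.coprime_iff_not_dvd).2 hpB)).symm
    have hNL : N ≤ Lc P B H :=
      (ab_case (le_Nz_normal hNn) (le_Nz_normal hNn) hHB hc (hcf.mono hNP) hf).trans (Lc_mono hNP le_rfl)
    have hlt : Nat.card (P.map (QuotientGroup.mk' N)) < n := by
      rw [← hn]
      by_contra hcon
      have hd := Subgroup.card_map_dvd P (QuotientGroup.mk' N)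
      have heq : Nat.card (P.map (QuotientGroup.mk' N)) = Nat.card P :=
        le_antisymm (Nat.le_of_dvd Nat.card_pos hd) (not_lt.1 hcon)
      have hsurj := (QuotientGroup.mk' N).subgroupMap_surjective P
      have hbij := (Nat.bijective_iff_surjective_and_card _).2 ⟨hsurj, heq.symm⟩
      apply hNb
      rw [eq_bot_iff]
      intro x hx
      have h1 : (QuotientGroup.mk' N).subgroupMap P ⟨x, hNP hx⟩ = (QuotientGroup.mk' N).subgroupMap P 1 := by
        apply Subtype.ext
        rw [map_one]
        exact (QuotientGroup.eq_one_iff x).2 hx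
      exact congrArg Subtype.val (hbij.1 h1)
    have hIH := ih _ hlt (Y ⧸ N) (P.map (QuotientGroup.mk' N)) (B.map (QuotientGroup.mk' N)) (H.map (QuotientGroup.mk' N))
      rfl (hPn.map _ (mk_surj N)) (hPp.map _) (nilp_map hBn _) (Nz_map_le _ hHB)
      (fun hd => hpB (hd.trans (Subgroup.card_map_dvd B _))) (L0 hab hNp hBn hcf hNP) (by
        rintro _ ⟨h, hh, rfl⟩ hne _ ⟨b, hb, rfl⟩ e
        rw [← map_mul, ← map_mul] at e
        have h2 := (QuotientGroup.eq (s := N)).1 e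
        have h3 : h⁻¹ * b * h ∈ B := by
          have := Nz_conj (hHB (H.inv_mem hh)) hb
          rwa [inv_inv] at this
        have h4 : (h * b)⁻¹ * (b * h) ∈ N ⊓ B := by
          refine ⟨h2, ?_⟩
          have : (h * b)⁻¹ * (b * h) = b⁻¹ * (h⁻¹ * b * h) := by group
          rw [this]
          exact B.mul_mem (B.inv_mem hb) h3
        rw [inf_eq_bot_of_coprime hNp hpB, Subgroup.mem_bot, inv_mul_eq_one] at h4
        have h5 := hf h hh (fun h1 => hne (by rw [h1, map_one])) b hb h4
        rw [h5, map_one])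
    have hle : Lc (P.map (QuotientGroup.mk' N)) (B.map (QuotientGroup.mk' N)) (H.map (QuotientGroup.mk' N)) ≤
        (Lc P B H).map (QuotientGroup.mk' N) := by
      refine (Subgroup.closure_le _).2 ?_
      rintro _ ⟨_, ⟨b, hb, rfl⟩, _, ⟨c, hcP, rfl⟩, hfix, rfl⟩
      obtain ⟨m, hm, hmc⟩ := lift_fix (N := N) (B := B) (H := H) (c := c) (le_Nz_normal hNn) (le_Nz_normal hNn) hHB hc
        (hcf.mono hNP) hf (fun h hh => by
          have h1 := hfix _ ⟨h, hh, rfl⟩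
          rw [← map_mul, ← map_mul] at h1
          have h2 := (QuotientGroup.eq (s := N)).1 h1
          have h3 := hNn.conj_mem _ h2 (h * c)
          have h4 : c * h * c⁻¹ * h⁻¹ = h * c * ((h * c)⁻¹ * (c * h)) * (h * c)⁻¹ := by group
          rw [h4]; exact h3)
      refine ⟨b * (m * c) * b⁻¹, Subgroup.subset_closure ⟨b, hb, m * c, P.mul_mem (hNP hm) hcP, hmc, rfl⟩, ?_⟩
      have : QuotientGroup.mk' N m = 1 := (QuotientGroup.eq_one_iff m).2 hm
      rw [map_mul, map_mul, map_mul, this, one_mul, map_inv]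
    intro x hx
    obtain ⟨l, hl, e⟩ := hle (hIH (Subgroup.mem_map_of_mem _ hx))
    have h2 := (QuotientGroup.eq (s := N)).1 e
    have : x = l * (l⁻¹ * x) := by group
    rw [this]
    exact (Lc P B H).mul_mem hl (hNL h2)

section
variable {Y : Type u} [Group Y] [Finite Y]

theorem partIV {p : ℕ} [hp : Fact p.Prime] {P F H : Subgroup Y} (hPp : IsPGroup p P) (hFP : F ≤ Nz P) (hHP : H ≤ Nz P)
    (hF : Group.IsNilpotent F) (hHF : H ≤ Nz F) (hcf : CF P F) (hf : Fpf H F) : P ≤ Lc P F H := by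
  obtain ⟨A, B, hs⟩ := nilp_split hF p
  refine le_trans ?_ (Lc_mono le_rfl hs.pc.1)
  have hBP := hs.pc.1.trans hFP
  have hHB := hHF.trans hs.pc.Nz_le
  have hcB := hcf.cent_p hFP hs hPp
  have hle := le_Nz P
  have h := partIV_aux (p := p) _ (Nz P) (P.subgroupOf (Nz P)) (B.subgroupOf (Nz P)) (H.subgroupOf (Nz P)) rfl ?_ ?_ ?_ ?_ ?_ ?_ ?_
  · intro x hx
    have h1 := Subgroup.mem_map_of_mem (Nz P).subtype (h (Subgroup.mem_subgroupOf.2 hx : (⟨x, hle hx⟩ : Nz P) ∈ P.subgroupOf (Nz P)))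
    revert h1
    unfold Lc
    rw [MonoidHom.map_closure]
    intro h1
    refine (Subgroup.closure_mono ?_) h1
    rintro _ ⟨_, ⟨b, hb, c, hc, hfix, rfl⟩, rfl⟩
    refine ⟨b, hb, c, hc, fun h hh => ?_, rfl⟩
    exact congrArg Subtype.val (hfix ⟨h, hHP hh⟩ hh)
  · rw [Subgroup.normal_subgroupOf_iff hle]
    intro h k hh hk
    exact Nz_conj hk hh
  · exact isPGroup_subgroupOf hPp
  · exact (Group.isNilpotent_congr (Subgroup.subgroupOfEquivOfLe hBP)).2 hs.nilB
  · intro h hh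
    apply mem_Nz_of_le
    intro b hb
    have := Nz_conj (hHB hh) (Subgroup.mem_subgroupOf.1 hb)
    exact this
  · rw [Nat.card_congr (Subgroup.subgroupOfEquivOfLe hBP).toEquiv]
    exact hs.pc.2.2.1
  · intro g hg hc
    apply Subtype.ext
    refine hcB g (Subgroup.mem_subgroupOf.1 hg) fun f hf => ?_
    exact congrArg Subtype.val (hc ⟨f, hBP hf⟩ (Subgroup.mem_subgroupOf.2 hf))
  · intro h hh hne b hb e
    apply Subtype.ext
    exact hf h hh (fun h1 => hne (Subtype.ext h1)) b (hs.pc.1 hb) (congrArg Subtype.val e)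

end
end FrobGen

set_option linter.unusedSectionVars false
namespace FrobGen
open Subgroup
universe u

lemma kernel_nilp {Y : Type u} [Group Y] [Finite Y] {F H : Subgroup Y} (hH : H ≠ ⊥)
    (hn : ∀ h ∈ H, ∀ f ∈ F, h * f * h⁻¹ ∈ F)
    (hf : Fpf H F) : Group.IsNilpotent F := by
  have hc : Nat.card H ≠ 1 := fun h => hH (Subgroup.card_eq_one.1 h)
  obtain ⟨s, hs, hd⟩ := Nat.exists_prime_and_dvd hc
  have := Fact.mk hs
  obtain ⟨h, hh, ho⟩ := exists_sylow_of_prime_dvd hd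
  have hne : h ≠ 1 := by
    rintro rfl
    rw [orderOf_one] at ho
    exact hs.one_lt.ne ho
  have hn' : ∀ f ∈ F, h⁻¹ * f * h ∈ F := fun f hf' => by
    have := hn h⁻¹ (H.inv_mem hh) f hf'
    rwa [inv_inv] at this
  let α : MulAut F :=
    { toFun := fun f => ⟨h * f * h⁻¹, hn h hh f f.2⟩
      invFun := fun f => ⟨h⁻¹ * f * h, hn' f f.2⟩
      left_inv := fun f => Subtype.ext (by simp [mul_assoc])
      right_inv := fun f => Subtype.ext (by simp [mul_assoc])
      map_mul' := fun a b => Subtype.ext (by simp [mul_assoc]) }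
  have hpow : ∀ n : ℕ, ∀ f : F, (((α ^ n) f : F) : Y) = h ^ n * f * (h ^ n)⁻¹ := by
    intro n
    induction n with
    | zero => intro f; simp
    | succ n ih =>
      intro f
      rw [pow_succ, MulAut.mul_apply, ih]
      change h ^ n * (h * f * h⁻¹) * (h ^ n)⁻¹ = _
      rw [pow_succ]; group
  refine thompson_nilp hs (α := α) ?_ ?_
  · ext f
    rw [hpow, ← ho, pow_orderOf_eq_one]
    simp
  · intro x hx
    apply Subtype.ext
    refine hf h hh hne x x.2 ?_
    have := congrArg Subtype.val hx
    exact mul_inv_eq_iff_eq_mul.1 this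

lemma final {G : Type u} [Group G] [Finite G]
    (F H : Subgroup (MulAut G)) (hH : H ≠ ⊥)
    (hn : ∀ h ∈ H, ∀ f ∈ F, h * f * h⁻¹ ∈ F)
    (hFrob : ∀ h ∈ H, h ≠ 1 → ∀ f ∈ F, h * f * h⁻¹ = f → f = 1)
    (hCGF : ∀ g : G, (∀ f ∈ F, f g = g) → g = 1) :
    Subgroup.closure {x : G | ∃ f ∈ F, ∃ c : G, (∀ h ∈ H, h c = c) ∧ x = f c} = ⊤ := by
  have : Finite (MulAut G) := Finite.of_injective (fun a : MulAut G => (a : G → G)) DFunLike.coe_injective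
  let Y := SemidirectProduct G (MulAut G) (MonoidHom.id _)
  have : Finite Y := Finite.of_equiv _ (SemidirectProduct.equivProd (φ := MonoidHom.id (MulAut G))).symm
  let il : G →* Y := SemidirectProduct.inl
  let ir : MulAut G →* Y := SemidirectProduct.inr
  have hil : Function.Injective il := SemidirectProduct.inl_injective
  have hir : Function.Injective ir := SemidirectProduct.inr_injective
  have hact : ∀ (f : MulAut G) (g : G), ir f * il g * (ir f)⁻¹ = il (f g) := by
    intro f g
    have := SemidirectProduct.inl_aut (φ := MonoidHom.id (MulAut G)) f g
    rw [map_inv] at this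
    exact this.symm
  have hcomm : ∀ (f : MulAut G) (g : G), ir f * il g = il g * ir f ↔ f g = g := by
    intro f g
    rw [← mul_inv_eq_iff_eq_mul, hact]
    exact hil.eq_iff
  have hfpf : Fpf H F := fun h hh hne f hf e => hFrob h hh hne f hf (mul_inv_eq_iff_eq_mul.2 e)
  have hnil := kernel_nilp hH hn hfpf
  have hnilY : Group.IsNilpotent (F.map ir) := nilp_map hnil ir
  have hGn : (il.range).Normal := by
    have : il.range = (SemidirectProduct.rightHom (φ := MonoidHom.id (MulAut G))).ker :=
      SemidirectProduct.range_inl_eq_ker_rightHom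
    rw [this]; infer_instance
  have hcf : CF il.range (F.map ir) := by
    rintro _ ⟨g, rfl⟩ h
    rw [hCGF g fun f hf => (hcomm f g).1 (h _ (Subgroup.mem_map_of_mem _ hf)), map_one]
  have hHF : H.map ir ≤ Nz (F.map ir) := by
    rintro _ ⟨h, hh, rfl⟩
    apply mem_Nz_of_le
    rintro _ ⟨f, hf, rfl⟩
    exact ⟨h * f * h⁻¹, hn h hh f hf, by simp⟩
  have hfY : Fpf (H.map ir) (F.map ir) := by
    rintro _ ⟨h, hh, rfl⟩ hne _ ⟨f, hf, rfl⟩ e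
    rw [hfpf h hh (fun h1 => hne (by rw [h1, map_one])) f hf (hir (by simpa using e)), map_one]
  apply eq_top_of_sylows
  intro p hp
  have := Fact.mk hp
  obtain ⟨P, hP, hN⟩ := exists_inv_sylow hGn hnilY hcf p
  have hle := partIV hP.2.1 ((le_Nz _).trans hN) (hHF.trans hN) hnilY hHF
    (fun g hg h => hcf g (hP.1 hg) h) hfY
  have hmap : (P.comap il).map il = P := Subgroup.map_comap_eq_self hP.1
  refine ⟨P.comap il, isSyl_of_map_inj hil ?_, fun x hx => ?_⟩
  · rw [hmap, ← MonoidHom.range_eq_map]; exact hP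
  · have h1 := hle hx
    have h2 : Lc P (F.map ir) (H.map ir) ≤ (Subgroup.closure {x : G | ∃ f ∈ F, ∃ c : G, (∀ h ∈ H, h c = c) ∧ x = f c}).map il := by
      unfold Lc
      rw [Subgroup.closure_le]
      rintro _ ⟨_, ⟨f, hf, rfl⟩, c, hc, hfix, rfl⟩
      obtain ⟨c, rfl⟩ := hP.1 hc
      rw [hact]
      refine Subgroup.mem_map_of_mem _ (Subgroup.subset_closure ⟨f, hf, c, fun h hh => ?_, rfl⟩)
      exact (hcomm h c).1 (hfix _ (Subgroup.mem_map_of_mem _ hh))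
    obtain ⟨y, hy, e⟩ := h2 h1
    rwa [← hil e]

end FrobGen

theorem stmt17 (G : Type*) [Group G] [Finite G]
    (K F H : Subgroup (MulAut G)) (hFK : F ≤ K) (hHK : H ≤ K)
    -- `F` is a nontrivial proper normal subgroup of `K`
    (hFnontriv : F ≠ ⊥) (hFproper : F ≠ K)
    (hFnormal : ∀ k ∈ K, ∀ f ∈ F, k * f * k⁻¹ ∈ F)
    -- `K = FH` with `F ∩ H = 1`
    (hKFH : ∀ k ∈ K, ∃ f ∈ F, ∃ h ∈ H, k = f * h) (hFH : F ⊓ H = ⊥)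
    -- `C_F(h) = 1` for every nontrivial `h ∈ H` (Frobenius condition)
    (hFrob : ∀ h ∈ H, h ≠ 1 → ∀ f ∈ F, h * f * h⁻¹ = f → f = 1)
    -- `C_G(F) = 1`
    (hCGF : ∀ g : G, (∀ f ∈ F, f g = g) → g = 1) :
    -- `G` is generated by the images of `C_G(H)` under the elements of `F`
    Subgroup.closure {x : G | ∃ f ∈ F, ∃ c : G, (∀ h ∈ H, h c = c) ∧ x = f c} = ⊤ := by

  refine FrobGen.final F H ?_ (fun h hh => hFnormal h (hHK hh)) hFrob hCGF
  rintro rfl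
  refine hFproper (le_antisymm hFK fun k hk => ?_)
  obtain ⟨f, hf, h, hh, rfl⟩ := hKFH k hk
  rw [Subgroup.mem_bot] at hh
  rwa [hh, mul_one]
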